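/- There exist constants c₁ > 0, c₂ > 0 and q₀ such that for every integer q ≥ q₀ the following holds: if ρ₁ = 1 − λ₁/log q is a real zero of ∏_{χ mod q} L(s,χ) with 0 < λ₁ ≤ c₁, then every zero s = σ + it of ∏_{χ mod q} L(s,χ) other than ρ₁ satisfies σ < 1 − c₂·log(λ₁^{−1})/log(q(2 + |t|)). -/

import Mathlib

open scoped Classical

/-- The product of all Dirichlet L-functions modulo `q`, as a function of `s`. -/
noncomputable def LProd (q : ℕ) [NeZero q] (s : ℂ) : ℂ :=
  ∏ χ : DirichletCharacter ℂ q, χ.LFunction s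

section
open Complex Metric Set Filter Topology

/-- base case: no zeros -/
lemma LF_base {f : ℂ → ℂ} {c : ℂ} {R M : ℝ} (hR : 0 < R) (hM : 0 ≤ M) (hf : Differentiable ℂ f)
    (h0 : f c ≠ 0) (hb : ∀ s ∈ closedBall c R, ‖f s‖ ≤ Real.exp M * ‖f c‖)
    (hz : ∀ z ∈ closedBall c (R/3), f z ≠ 0) (k : ℕ) :
    ‖iteratedDeriv k (logDeriv f) c‖ ≤ 6 * M * (k+1).factorial * (4/R)^(k+1) := by
  have hd : DifferentiableOn ℂ (logDeriv f) (ball c (R/3)) := by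
    intro z hz'
    have := hz z (ball_subset_closedBall hz')
    unfold logDeriv
    have h1 : DifferentiableAt ℂ (deriv f) z := hf.contDiff.differentiable_deriv_two.differentiableAt
    exact (h1.div hf.differentiableAt this).differentiableWithinAt
  obtain ⟨h, hh⟩ := (hd.isExactOn_ball).with_val_at c 0
  obtain ⟨hh0, hh1⟩ := hh
  have hR3 : 0 < R/3 := by positivity
  -- f = f c * exp h on the ball
  have hfe : ∀ z ∈ ball c (R/3), f z = f c * exp (h z) := by
    have key : ∀ z ∈ ball c (R/3), f z * exp (-h z) = f c * exp (-h c) := by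
      intro z hz'
      have hderiv : ∀ w ∈ ball c (R/3), HasDerivAt (fun w => f w * exp (-h w)) 0 w := by
        intro w hw
        have e1 := (hf w).hasDerivAt
        have e2 := (hh1 w hw)
        have e3 := e1.mul (e2.neg.cexp)
        have := hz w (ball_subset_closedBall hw)
        refine HasDerivAt.congr_deriv (f := fun w => f w * exp (-h w)) e3 ?_
        rw [logDeriv_apply]
        simp only [Pi.neg_apply]
        field_simp
        ring
      exact (convex_ball c (R/3)).is_const_of_fderivWithin_eq_zero (𝕜 := ℂ)
        (fun w hw => (hderiv w hw).differentiableAt.differentiableWithinAt)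
        (fun w hw => by
          rw [fderivWithin_of_isOpen isOpen_ball hw]
          have := (hderiv w hw).hasFDerivAt.fderiv
          rw [this]; ext; simp) hz' (mem_ball_self hR3)
    intro z hz'
    have := key z hz'
    rw [hh0, neg_zero, exp_zero, mul_one, exp_neg] at this
    have h2 := exp_ne_zero (h z)
    field_simp at this
    rw [this, mul_comm]
  have hre : ∀ z ∈ ball c (R/3), (h z).re ≤ M := by
    intro z hz'
    have h1 := hb z (closedBall_subset_closedBall (by linarith) (ball_subset_closedBall hz'))
    rw [hfe z hz', norm_mul, norm_exp, mul_comm] at h1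
    have h2 : 0 < ‖f c‖ := norm_pos_iff.mpr h0
    exact Real.exp_le_exp.mp (le_of_mul_le_mul_right h1 h2)
  have hhd : DifferentiableOn ℂ h (ball c (R/3)) := fun z hz' => (hh1 z hz').differentiableAt.differentiableWithinAt
  -- Borel-Caratheodory for any M' > M
  have hbd : ∀ M' > M, ∀ z ∈ closedBall c (R/4), ‖h z‖ ≤ 6 * M' := by
    intro M' hM' z hz'
    have hzn : ‖z - c‖ ≤ R/4 := by simpa [dist_eq_norm] using hz'
    have hm : ∀ w ∈ ball (0:ℂ) (R/3), c + w ∈ ball c (R/3) := by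
      intro w hw; simpa [dist_eq_norm] using hw
    have := borelCaratheodory_zero (f := fun w => h (c + w)) (M := M') (R := R/3) (z := z - c)
      (by linarith) (hhd.comp (by fun_prop) hm) (fun w hw => by
        have := hre _ (hm w hw); simp only [Set.mem_ofPred_eq]; linarith) hR3
      (by rw [mem_ball_zero_iff]; linarith) (by simpa using hh0)
    simp only [add_sub_cancel] at this
    refine this.trans ?_
    rw [div_le_iff₀ (by linarith)]
    nlinarith
  have hbd' : ∀ z ∈ closedBall c (R/4), ‖h z‖ ≤ 6 * M := by
    intro z hz'
    refine le_of_forall_pos_le_add fun e he => ?_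
    have := hbd (M + e/6) (by linarith) z hz'
    linarith
  have hcl : DiffContOnCl ℂ h (ball c (R/4)) := by
    apply (hhd.mono _).diffContOnCl
    rw [closure_ball _ (by positivity)]
    exact closedBall_subset_ball (by linarith)
  have hcauchy := Complex.norm_iteratedDeriv_le_of_forall_mem_sphere_norm_le (n := k+1) (c := c) (R := R/4)
    (C := 6*M) (by positivity) hcl (fun z hz' => hbd' z (sphere_subset_closedBall hz'))
  have heq : iteratedDeriv (k+1) h c = iteratedDeriv k (logDeriv f) c := by
    rw [iteratedDeriv_succ']
    apply Filter.EventuallyEq.iteratedDeriv_eq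
    filter_upwards [isOpen_ball.mem_nhds (mem_ball_self hR3)] with w hw
    exact (hh1 w hw).deriv
  rw [← heq]
  refine hcauchy.trans (le_of_eq ?_)
  rw [div_pow, div_pow]
  field_simp

lemma iteratedDeriv_inv_sub (k : ℕ) (z c : ℂ) :
    iteratedDeriv k (fun s => (s - z)⁻¹) c = (-1)^k * k.factorial / (c - z)^(k+1) := by
  have := congrFun (iteratedDeriv_comp_sub_const k (fun s : ℂ => s⁻¹) z) c
  rw [this, iteratedDeriv_eq_iterate, iter_deriv_inv]
  have h1 : (-1 - (k:ℤ)) = -((k+1:ℕ):ℤ) := by push_cast; ring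
  rw [h1, zpow_neg, zpow_natCast, div_eq_mul_inv]

lemma differentiable_dslope' {f : ℂ → ℂ} (hf : Differentiable ℂ f) (r : ℂ) :
    Differentiable ℂ (dslope f r) := by
  rw [← differentiableOn_univ]
  exact (Complex.differentiableOn_dslope univ_mem).mpr hf.differentiableOn

lemma LF' {c : ℂ} {R : ℝ} (hR : 0 < R) (n : ℕ) : ∀ {f : ℂ → ℂ} {M : ℝ}, M < n * Real.log 2 → Differentiable ℂ f →
    f c ≠ 0 → (∀ s ∈ closedBall c R, ‖f s‖ ≤ Real.exp M * ‖f c‖) →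
    ∃ Z : Multiset ℂ, (∀ z ∈ Z, f z = 0 ∧ z ∈ closedBall c (R/3)) ∧
      (∀ z ∈ closedBall c (R/3), f z = 0 → z ∈ Z) ∧ Multiset.card Z * Real.log 2 ≤ M ∧
      ∀ k : ℕ, ‖iteratedDeriv k (logDeriv f) c -
        (Z.map (fun z => (-1)^k * k.factorial / (c - z)^(k+1))).sum‖
          ≤ 6 * M * (k+1).factorial * (4/R)^(k+1) := by
  induction n with
  | zero =>
    intro f M hM hf h0 hb
    have := hb c (mem_closedBall_self hR.le)
    have h2 : 0 < ‖f c‖ := norm_pos_iff.mpr h0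
    have : 1 ≤ Real.exp M := by nlinarith
    have := Real.one_le_exp_iff.mp this
    simp at hM; linarith
  | succ n ih =>
    intro f M hM hf h0 hb
    have hM0 : 0 ≤ M := by
      have := hb c (mem_closedBall_self hR.le)
      have h2 : 0 < ‖f c‖ := norm_pos_iff.mpr h0
      have : 1 ≤ Real.exp M := by nlinarith
      exact Real.one_le_exp_iff.mp this
    by_cases hz : ∀ z ∈ closedBall c (R/3), f z ≠ 0
    · refine ⟨0, by simp, fun z h1 h2 => (hz z h1 h2).elim, by simpa using hM0, fun k => ?_⟩
      simpa using LF_base hR hM0 hf h0 hb hz k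
    push Not at hz
    obtain ⟨ρ, hρ, hfρ⟩ := hz
    have hρn : ‖ρ - c‖ ≤ R/3 := by simpa [dist_eq_norm] using hρ
    have hcρ : c ≠ ρ := fun h => h0 (h ▸ hfρ)
    set g := dslope f ρ with hg
    have hgd : Differentiable ℂ g := differentiable_dslope' hf ρ
    have hfg : ∀ s, f s = (s - ρ) * g s := by
      intro s
      have := sub_smul_dslope f ρ s
      rw [hfρ, sub_zero] at this
      rw [← this]; rfl
    have hg0 : g c ≠ 0 := fun h => h0 (by rw [hfg, h, mul_zero])
    have hgb : ∀ s ∈ closedBall c R, ‖g s‖ ≤ Real.exp (M - Real.log 2) * ‖g c‖ := by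
      intro s hs
      apply Complex.norm_le_of_forall_mem_frontier_norm_le (U := ball c R) isBounded_ball
        hgd.diffContOnCl
      · intro z hz
        rw [frontier_ball _ hR.ne'] at hz
        have hzn : ‖z - c‖ = R := by simpa [dist_eq_norm] using hz
        have h1 := hb z (sphere_subset_closedBall hz)
        rw [hfg z, hfg c, norm_mul, norm_mul] at h1
        have h2 : 2*R/3 ≤ ‖z - ρ‖ := by
          have : ‖z - c‖ ≤ ‖z - ρ‖ + ‖ρ - c‖ := by
            have := norm_add_le (z - ρ) (ρ - c); simpa using this
          linarith
        rw [Real.exp_sub, Real.exp_log (by norm_num)]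
        rw [norm_sub_rev] at hρn
        have h3 : 2*R/3 * ‖g z‖ ≤ Real.exp M * (R/3 * ‖g c‖) := by
          calc _ ≤ ‖z - ρ‖ * ‖g z‖ := by gcongr
            _ ≤ _ := h1
            _ ≤ _ := by gcongr
        have h4 : (2*R/3) * ‖g z‖ ≤ (2*R/3) * (Real.exp M / 2 * ‖g c‖) := by
          refine h3.trans (le_of_eq (by ring))
        exact le_of_mul_le_mul_left h4 (by positivity)
      · rwa [closure_ball _ hR.ne']
    obtain ⟨Z, hZ1, hZ2, hZ3, hZ4⟩ := ih (f := g) (M := M - Real.log 2)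
      (by push_cast at hM; linarith) hgd hg0 hgb
    refine ⟨ρ ::ₘ Z, ?_, ?_, ?_, ?_⟩
    · intro z hz
      rcases Multiset.mem_cons.mp hz with rfl | hz
      · exact ⟨hfρ, hρ⟩
      · exact ⟨by rw [hfg, (hZ1 z hz).1, mul_zero], (hZ1 z hz).2⟩
    · intro z hz hfz
      rw [hfg] at hfz
      rcases mul_eq_zero.mp hfz with h | h
      · rw [Multiset.mem_cons]; left; exact sub_eq_zero.mp h
      · rw [Multiset.mem_cons]; right; exact hZ2 z hz h
    · rw [Multiset.card_cons]; push_cast; linarith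
    · intro k
      have hld : iteratedDeriv k (logDeriv f) c =
          (-1)^k * k.factorial / (c - ρ)^(k+1) + iteratedDeriv k (logDeriv g) c := by
        have e1 : logDeriv f =ᶠ[𝓝 c] (fun s => (s - ρ)⁻¹) + logDeriv g := by
          have h1 : ∀ᶠ s in 𝓝 c, g s ≠ 0 := hgd.continuous.continuousAt.eventually_ne hg0
          have h2 : ∀ᶠ s in 𝓝 c, s ≠ ρ := continuousAt_id.eventually_ne hcρ
          filter_upwards [h1, h2] with s h1 h2
          have : f = fun s => (s - ρ) * g s := funext hfg
          rw [this, logDeriv_mul (f := fun s => s - ρ) (g := g) s (sub_ne_zero.mpr h2) h1 (by fun_prop) hgd.differentiableAt]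
          simp [logDeriv_apply, deriv_sub_const]
        rw [e1.iteratedDeriv_eq, iteratedDeriv_add, iteratedDeriv_inv_sub]
        · exact ContDiffAt.inv (f := fun s => s - ρ) (by fun_prop) (sub_ne_zero.mpr hcρ)
        · have : ContDiffAt ℂ k (deriv g) c := by
            have := hgd.contDiff (n := ⊤)
            exact (ContDiff.deriv' (n := k) (hgd.contDiff)).contDiffAt
          exact this.div hgd.contDiff.contDiffAt hg0
      rw [hld, Multiset.map_cons, Multiset.sum_cons, add_sub_add_left_eq_sub]
      refine (hZ4 k).trans ?_
      have : 0 ≤ Real.log 2 := Real.log_nonneg (by norm_num)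
      gcongr
      linarith

lemma LF {c : ℂ} {R : ℝ} (hR : 0 < R) {f : ℂ → ℂ} {M : ℝ} (hf : Differentiable ℂ f)
    (h0 : f c ≠ 0) (hb : ∀ s ∈ closedBall c R, ‖f s‖ ≤ Real.exp M * ‖f c‖) :
    ∃ Z : Multiset ℂ, (∀ z ∈ Z, f z = 0 ∧ z ∈ closedBall c (R/3)) ∧
      (∀ z ∈ closedBall c (R/3), f z = 0 → z ∈ Z) ∧ Multiset.card Z * Real.log 2 ≤ M ∧
      ∀ k : ℕ, ‖iteratedDeriv k (logDeriv f) c -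
        (Z.map (fun z => (-1)^k * k.factorial / (c - z)^(k+1))).sum‖
          ≤ 6 * M * (k+1).factorial * (4/R)^(k+1) := by
  obtain ⟨n, hn⟩ := exists_nat_gt (M / Real.log 2)
  rw [div_lt_iff₀ (Real.log_pos (by norm_num))] at hn
  exact LF' hR n hn hf h0 hb
end

section
open Complex Metric Set Filter Topology

noncomputable def blk {q : ℕ} (χ : DirichletCharacter ℂ q) (m : ℕ) (s : ℂ) : ℂ :=
  ∑ a ∈ Finset.range q, χ ((a+1 : ℕ) : ZMod q) * ((s - 1) * ((m*q+a+1 : ℕ) : ℂ)^(-s)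
    + (1/(q:ℂ)) * (((m*q+q : ℕ):ℂ)^(1-s) - ((m*q:ℕ):ℂ)^(1-s)))

noncomputable def avgc {q : ℕ} (χ : DirichletCharacter ℂ q) : ℂ :=
  (1/(q:ℂ)) * ∑ a ∈ Finset.range q, χ ((a+1 : ℕ) : ZMod q)

lemma chi_period {q : ℕ} (χ : DirichletCharacter ℂ q) (m a : ℕ) :
    χ ((m*q+a : ℕ) : ZMod q) = χ ((a : ℕ) : ZMod q) := by
  congr 1; simp

lemma cpow_sub_le {x y b : ℝ} (hb : 0 < b) (hx : b ≤ x) (hy : b ≤ y) (s : ℂ) (hs : -1 ≤ s.re) :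
    ‖(x:ℂ)^(-s) - (y:ℂ)^(-s)‖ ≤ ‖s‖ * b^(-s.re-1) * |x - y| := by
  have hd : ∀ u ∈ Ici b, HasDerivWithinAt (fun u : ℝ => (u:ℂ)^(-s)) (-s * (u:ℂ)^(-s-1)) (Ici b) u := by
    intro u hu
    have hu0 : 0 < u := lt_of_lt_of_le hb hu
    by_cases hs0 : s = 0
    · subst hs0; simp; exact hasDerivWithinAt_const _ _ _
    exact (hasDerivAt_ofReal_cpow_const (x := u) (r := -s) hu0.ne' (by simpa using hs0)).hasDerivWithinAt
  have := (convex_Ici b).norm_image_sub_le_of_norm_hasDerivWithin_le (C := ‖s‖ * b^(-s.re-1)) hd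
    (fun u hu => by
      have hu0 : 0 < u := lt_of_lt_of_le hb hu
      rw [norm_mul, norm_neg, norm_cpow_eq_rpow_re_of_pos hu0]
      simp only [sub_re, neg_re, one_re]
      gcongr ?_ * ?_
      exact Real.rpow_le_rpow_of_nonpos hb hu (by linarith)) (show y ∈ Ici b from hy) (show x ∈ Ici b from hx)
  simpa [Real.norm_eq_abs] using this

lemma brk_le {x b h : ℝ} (hb : 0 < b) (hh : 0 < h) (hx : b ≤ x) (hx2 : x ≤ b + h) (s : ℂ) (hs : -1 ≤ s.re) :
    ‖(s-1) * (x:ℂ)^(-s) + (1/(h:ℂ)) * (((b+h:ℝ):ℂ)^(1-s) - (b:ℂ)^(1-s))‖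
      ≤ ‖s-1‖ * ‖s‖ * h * b^(-s.re-1) := by
  have hd : ∀ u ∈ Icc b (b+h), HasDerivWithinAt
      (fun u : ℝ => (s-1) * (x:ℂ)^(-s) * (u:ℂ) + (u:ℂ)^(1-s)) ((s-1)*((x:ℂ)^(-s) - (u:ℂ)^(-s))) (Icc b (b+h)) u := by
    intro u hu
    have hu0 : 0 < u := lt_of_lt_of_le hb hu.1
    have e1 : HasDerivAt (fun u : ℝ => (s-1) * (x:ℂ)^(-s) * (u:ℂ)) ((s-1) * (x:ℂ)^(-s) * 1) u :=
      (ofRealCLM.hasDerivAt (x := u)).const_mul _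
    by_cases hs0 : s = 1
    · subst hs0
      simp; exact hasDerivWithinAt_const _ _ _
    have e2 := hasDerivAt_ofReal_cpow_const (x := u) (r := 1-s) hu0.ne' (by rw [sub_ne_zero]; exact Ne.symm hs0)
    have e3 := (e1.add e2).hasDerivWithinAt (s := Icc b (b+h))
    refine HasDerivWithinAt.congr_deriv (f := (fun u : ℝ => (s-1) * (x:ℂ)^(-s) * (u:ℂ) + (u:ℂ)^(1-s))) e3 ?_
    have : 1 - s - 1 = -s := by ring
    rw [this]; ring
  have := (convex_Icc b (b+h)).norm_image_sub_le_of_norm_hasDerivWithin_le (C := ‖s-1‖*(‖s‖ * b^(-s.re-1) * h)) hd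
    (fun u hu => by
      rw [norm_mul]
      have := cpow_sub_le hb hx hu.1 s hs
      have h2 : |x - u| ≤ h := by rw [abs_le]; constructor <;> linarith [hu.1, hu.2]
      gcongr
      refine this.trans ?_
      gcongr) (left_mem_Icc.mpr (by linarith : b ≤ b + h)) (right_mem_Icc.mpr (by linarith))
  have hne : (h:ℂ) ≠ 0 := by exact_mod_cast hh.ne'
  have e : (s-1) * (x:ℂ)^(-s) + (1/(h:ℂ)) * (((b+h:ℝ):ℂ)^(1-s) - (b:ℂ)^(1-s)) =
    (1/(h:ℂ)) * (((s-1) * (x:ℂ)^(-s) * ((b+h:ℝ):ℂ) + ((b+h:ℝ):ℂ)^(1-s)) - ((s-1) * (x:ℂ)^(-s) * (b:ℂ) + (b:ℂ)^(1-s))) := by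
    push_cast; field_simp; ring
  rw [e, norm_mul]
  have h3 : ‖(1/(h:ℂ))‖ = 1/h := by simp [abs_of_pos hh]
  rw [h3]
  calc _ ≤ 1/h * (‖s-1‖*(‖s‖ * b^(-s.re-1) * h) * ‖(b+h) - b‖) := by gcongr
    _ = _ := by
      rw [add_sub_cancel_left, Real.norm_eq_abs, abs_of_pos hh]; field_simp

lemma norm_chi_le {q : ℕ} (χ : DirichletCharacter ℂ q) (a : ZMod q) : ‖χ a‖ ≤ 1 := χ.norm_le_one a

lemma blk_le {q : ℕ} (hq : 0 < q) (χ : DirichletCharacter ℂ q) {m : ℕ} (hm : 0 < m) (s : ℂ) (hs : -1 ≤ s.re) :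
    ‖blk χ m s‖ ≤ ‖s-1‖ * ‖s‖ * (q:ℝ)^2 * ((m:ℝ)*q)^(-s.re-1) := by
  unfold blk
  have : ∀ a ∈ Finset.range q, ‖χ ((a+1 : ℕ) : ZMod q) * ((s - 1) * ((m*q+a+1 : ℕ) : ℂ)^(-s)
    + (1/(q:ℂ)) * (((m*q+q : ℕ):ℂ)^(1-s) - ((m*q:ℕ):ℂ)^(1-s)))‖ ≤ ‖s-1‖ * ‖s‖ * q * ((m:ℝ)*q)^(-s.re-1) := by
    intro a ha
    have ha' : a + 1 ≤ q := Finset.mem_range.mp ha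
    have ha'' : (a:ℝ) + 1 ≤ q := by exact_mod_cast ha'
    have h1 := brk_le (x := (m:ℝ)*q + a + 1) (b := (m:ℝ)*q) (h := q) (by positivity) (by positivity)
      (by have : (0:ℝ) ≤ a := by positivity
          linarith) (by linarith) s hs
    rw [norm_mul]
    push_cast at h1 ⊢
    refine le_trans (mul_le_mul_of_nonneg_right (by exact_mod_cast norm_chi_le χ _) (norm_nonneg _)) ?_
    rw [one_mul]; exact h1
  refine (norm_sum_le_of_le _ this).trans (le_of_eq ?_)
  simp; ring

lemma blk_diff {q : ℕ} (hq : 0 < q) (χ : DirichletCharacter ℂ q) {m : ℕ} (hm : 0 < m) : Differentiable ℂ (blk χ m) := by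
  unfold blk
  refine Differentiable.fun_sum fun a _ => ?_
  have h1 : ((m*q+a+1 : ℕ) : ℂ) ≠ 0 := Nat.cast_ne_zero.mpr (Nat.succ_ne_zero _)
  have h2 : ((m*q+q : ℕ) : ℂ) ≠ 0 := Nat.cast_ne_zero.mpr (by positivity)
  have h3 : ((m*q : ℕ) : ℂ) ≠ 0 := Nat.cast_ne_zero.mpr (by positivity)
  have e1 : Differentiable ℂ fun s : ℂ => ((m*q+a+1 : ℕ) : ℂ)^(-s) := fun s => by
    exact (differentiableAt_id.neg).const_cpow (Or.inl h1)
  have e2 : Differentiable ℂ fun s : ℂ => ((m*q+q : ℕ) : ℂ)^(1-s) := fun s => by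
    exact (differentiableAt_id.const_sub 1).const_cpow (Or.inl h2)
  have e3 : Differentiable ℂ fun s : ℂ => ((m*q : ℕ) : ℂ)^(1-s) := fun s => by
    exact (differentiableAt_id.const_sub 1).const_cpow (Or.inl h3)
  fun_prop

lemma blk_finite {q : ℕ} (hq : 0 < q) (χ : DirichletCharacter ℂ q) (M : ℕ) (s : ℂ) (j : ℕ) :
    (s-1) * ∑ n ∈ Finset.range ((M+j)*q), χ ((n+1:ℕ) : ZMod q) * ((n+1:ℕ):ℂ)^(-s) + avgc χ * (((M+j)*q:ℕ):ℂ)^(1-s)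
    = (s-1) * ∑ n ∈ Finset.range (M*q), χ ((n+1:ℕ) : ZMod q) * ((n+1:ℕ):ℂ)^(-s) + avgc χ * ((M*q:ℕ):ℂ)^(1-s)
      + ∑ m ∈ Finset.range j, blk χ (M+m) s := by
  induction j with
  | zero => simp
  | succ j ih =>
    rw [Finset.sum_range_succ, ← add_assoc ((s-1) * _ + _), ← ih]
    have e : (M+(j+1))*q = (M+j)*q + q := by ring
    rw [e, Finset.sum_range_add]
    have : blk χ (M+j) s = (s-1) * (∑ a ∈ Finset.range q, χ (((M+j)*q+a+1 : ℕ) : ZMod q) * (((M+j)*q+a+1 : ℕ) : ℂ)^(-s))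
        + avgc χ * ((((M+j)*q+q : ℕ):ℂ)^(1-s) - (((M+j)*q:ℕ):ℂ)^(1-s)) := by
      unfold blk avgc
      rw [Finset.mul_sum, Finset.mul_sum, Finset.sum_mul, ← Finset.sum_add_distrib]
      refine Finset.sum_congr rfl fun a _ => ?_
      have := chi_period χ (M+j) (a+1)
      rw [← add_assoc] at this
      rw [this]; ring
    rw [this]; ring

/-- (s-1)L(s,χ) as entire function -/
noncomputable def L1 {q : ℕ} [NeZero q] (χ : DirichletCharacter ℂ q) (s : ℂ) : ℂ :=
  if χ = 1 then DirichletCharacter.LFunctionTrivChar₁ q s else (s-1) * χ.LFunction s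

lemma L1_diff {q : ℕ} [NeZero q] (χ : DirichletCharacter ℂ q) : Differentiable ℂ (L1 χ) := by
  unfold L1
  split_ifs with h
  · exact DirichletCharacter.differentiable_LFunctionTrivChar₁ q
  · have := DirichletCharacter.differentiable_LFunction h
    fun_prop

lemma L1_eq {q : ℕ} [NeZero q] (χ : DirichletCharacter ℂ q) {s : ℂ} (hs : s ≠ 1) : L1 χ s = (s-1) * χ.LFunction s := by
  unfold L1
  split_ifs with h
  · subst h; simp [DirichletCharacter.LFunctionTrivChar₁, Function.update_of_ne hs, DirichletCharacter.LFunctionTrivChar]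
  · rfl

lemma rpow_tele {σ y : ℝ} (hσ : 0 < σ) (hy : 1 < y) : σ * y^(-σ-1) ≤ (y-1)^(-σ) - y^(-σ) := by
  have hy0 : 0 < y := by linarith
  have h1 : (y-1)^(-σ) = y^(-σ) * (1 - 1/y)^(-σ) := by
    rw [← Real.mul_rpow hy0.le (by rw [sub_nonneg, div_le_one hy0]; exact hy.le)]
    congr 1; field_simp
  have h2 : 0 < 1 - 1/y := by rw [sub_pos, div_lt_one hy0]; exact hy
  have h3 : 1 + σ/y ≤ (1 - 1/y)^(-σ) := by
    rw [Real.rpow_def_of_pos h2]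
    have := Real.log_le_sub_one_of_pos h2
    have h4 := Real.add_one_le_exp (Real.log (1 - 1/y) * -σ)
    have h5 : σ / y = σ * (1/y) := by ring
    nlinarith
  have h6 : 0 < y^(-σ) := by positivity
  rw [h1, Real.rpow_sub hy0, Real.rpow_one]
  have : σ * (y^(-σ)/y) = y^(-σ) * (1+σ/y) - y^(-σ) := by ring
  rw [this]; gcongr

lemma sum_rpow_le {σ : ℝ} (hσ : 0 < σ) (hσ3 : σ ≤ 3) {M : ℕ} (hM : 0 < M) (J : ℕ) :
    ∑ j ∈ Finset.range J, ((M+j:ℕ):ℝ)^(-σ-1) ≤ 16/σ * ((M:ℝ)^(-σ) - ((M+J:ℕ):ℝ)^(-σ)) := by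
  induction J with
  | zero => simp
  | succ J ih =>
    rw [Finset.sum_range_succ]
    have h0 : (1:ℝ) ≤ ((M+J:ℕ):ℝ) := by exact_mod_cast (by omega)
    have h1 := rpow_tele (y := ((M+(J+1):ℕ):ℝ)) hσ (by push_cast at h0 ⊢; linarith)
    have e : ((M+(J+1):ℕ):ℝ) - 1 = ((M+J:ℕ):ℝ) := by push_cast; ring
    rw [e] at h1
    have h2 : ((M+J:ℕ):ℝ)^(-σ-1) ≤ 16 * ((M+(J+1):ℕ):ℝ)^(-σ-1) := by
      have h3 : ((2:ℝ) * ((M+J:ℕ):ℝ))^(-σ-1) ≤ ((M+(J+1):ℕ):ℝ)^(-σ-1) :=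
        Real.rpow_le_rpow_of_nonpos (by positivity) (by push_cast at h0 ⊢; linarith) (by linarith)
      rw [Real.mul_rpow (by norm_num) (by positivity)] at h3
      have h4 : (2:ℝ)^(-(4:ℝ)) ≤ 2^(-σ-1) := Real.rpow_le_rpow_of_exponent_le (by norm_num) (by linarith)
      have h5 : (2:ℝ)^(-(4:ℝ)) = 1/16 := by rw [Real.rpow_neg (by norm_num)]; norm_num
      rw [h5] at h4
      have h6 : 0 ≤ ((M+J:ℕ):ℝ)^(-σ-1) := by positivity
      nlinarith
    have h7 : ((M+(J+1):ℕ):ℝ)^(-σ-1) ≤ (1/σ) * ((((M+J:ℕ):ℝ))^(-σ) - ((M+(J+1):ℕ):ℝ)^(-σ)) := by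
      rw [one_div, inv_mul_eq_div, le_div_iff₀ hσ]; linarith
    calc _ ≤ 16/σ * ((M:ℝ)^(-σ) - ((M+J:ℕ):ℝ)^(-σ)) + 16 * ((1/σ) * ((((M+J:ℕ):ℝ))^(-σ) - ((M+(J+1):ℕ):ℝ)^(-σ))) := by
          linarith
      _ = _ := by ring

lemma summable_blkbd {σ : ℝ} (hσ : 0 < σ) {M : ℕ} (hM : 0 < M) : Summable fun j : ℕ => ((M+j:ℕ):ℝ)^(-σ-1) := by
  have : Summable fun j : ℕ => (j:ℝ)^(-σ-1) := Real.summable_nat_rpow.mpr (by linarith)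
  have h2 := (summable_nat_add_iff M).mpr this
  simpa [add_comm] using h2

lemma tsum_rpow_le {σ : ℝ} (hσ : 0 < σ) (hσ3 : σ ≤ 3) {M : ℕ} (hM : 0 < M) :
    ∑' j : ℕ, ((M+j:ℕ):ℝ)^(-σ-1) ≤ 16/σ * (M:ℝ)^(-σ) := by
  refine Real.tsum_le_of_sum_range_le (fun j => by positivity) fun J => (sum_rpow_le hσ hσ3 hM J).trans ?_
  have : 0 ≤ ((M+J:ℕ):ℝ)^(-σ) := by positivity
  gcongr; linarith

lemma blk_summable {q : ℕ} (hq : 0 < q) (χ : DirichletCharacter ℂ q) {M : ℕ} (hM : 0 < M) {s : ℂ} (hs : 0 < s.re) :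
    Summable fun j => ‖blk χ (M+j) s‖ := by
  have : ∀ j, ‖blk χ (M+j) s‖ ≤ ‖s-1‖ * ‖s‖ * (q:ℝ)^2 * (q:ℝ)^(-s.re-1) * ((M+j:ℕ):ℝ)^(-s.re-1) := by
    intro j
    refine (blk_le hq χ (by omega) s (by linarith)).trans (le_of_eq ?_)
    rw [Real.mul_rpow (by positivity) (by positivity)]; ring
  exact Summable.of_nonneg_of_le (fun _ => norm_nonneg _) this ((summable_blkbd hs hM).mul_left _)

lemma blk_tsum_le {q : ℕ} (hq : 0 < q) (χ : DirichletCharacter ℂ q) {M : ℕ} (hM : 0 < M) {s : ℂ} (hs : 0 < s.re)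
    (hs3 : s.re ≤ 3) : ‖∑' j, blk χ (M+j) s‖ ≤ 16 / s.re * ‖s-1‖ * ‖s‖ * (q:ℝ)^(1-s.re) * (M:ℝ)^(-s.re) := by
  have : ∀ j, ‖blk χ (M+j) s‖ ≤ ‖s-1‖ * ‖s‖ * (q:ℝ)^2 * (q:ℝ)^(-s.re-1) * ((M+j:ℕ):ℝ)^(-s.re-1) := by
    intro j
    refine (blk_le hq χ (by omega) s (by linarith)).trans (le_of_eq ?_)
    rw [Real.mul_rpow (by positivity) (by positivity)]; ring
  refine (norm_tsum_le_tsum_norm (blk_summable hq χ hM hs)).trans ?_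
  refine ((blk_summable hq χ hM hs).tsum_le_tsum this ((summable_blkbd hs hM).mul_left _)).trans ?_
  rw [tsum_mul_left]
  have hq' : (0:ℝ) < q := by positivity
  have e : (q:ℝ)^2 * (q:ℝ)^(-s.re-1) = (q:ℝ)^(1-s.re) := by
    rw [← Real.rpow_natCast, ← Real.rpow_add hq']; congr 1; push_cast; ring
  calc _ ≤ ‖s-1‖ * ‖s‖ * (q:ℝ)^2 * (q:ℝ)^(-s.re-1) * (16/s.re * (M:ℝ)^(-s.re)) := by
        gcongr; exact tsum_rpow_le hs hs3 hM
    _ = _ := by rw [← e]; ring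

noncomputable def psum {q : ℕ} (χ : DirichletCharacter ℂ q) (N : ℕ) (s : ℂ) : ℂ :=
  ∑ n ∈ Finset.range N, χ ((n+1:ℕ) : ZMod q) * ((n+1:ℕ):ℂ)^(-s)

lemma psum_tendsto {q : ℕ} [NeZero q] (χ : DirichletCharacter ℂ q) {s : ℂ} (hs : 1 < s.re) :
    Tendsto (fun N => psum χ N s) atTop (𝓝 (χ.LFunction s)) := by
  rw [DirichletCharacter.LFunction_eq_LSeries χ hs]
  have h1 : LSeriesSummable (fun n => χ n) s := DirichletCharacter.LSeriesSummable_of_one_lt_re χ hs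
  have h2 := (h1.hasSum.tendsto_sum_nat).comp (tendsto_add_atTop_nat 1)
  refine h2.congr fun N => ?_
  simp only [Function.comp]
  rw [Finset.sum_range_succ']
  simp only [psum, LSeries.term_zero, add_zero]
  refine Finset.sum_congr rfl fun n _ => ?_
  rw [LSeries.term_of_ne_zero (by omega), cpow_neg, div_eq_mul_inv]

lemma L1_formula_gt {q : ℕ} [NeZero q] (χ : DirichletCharacter ℂ q) {M : ℕ} (hM : 0 < M) {s : ℂ} (hs : 1 < s.re) :
    L1 χ s = (s-1) * psum χ (M*q) s + avgc χ * ((M*q:ℕ):ℂ)^(1-s) + ∑' j, blk χ (M+j) s := by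
  have hq : 0 < q := Nat.pos_of_ne_zero (NeZero.ne q)
  have hs1 : s ≠ 1 := by rintro rfl; simp at hs
  rw [L1_eq χ hs1]
  have ht : Tendsto (fun j : ℕ => (M+j)*q) atTop atTop := by
    refine tendsto_atTop_mono (fun j => ?_) tendsto_id
    simp only [id]; nlinarith
  have h1 := ((psum_tendsto χ hs).comp ht).const_mul (s-1)
  have h2 : Tendsto (fun j : ℕ => avgc χ * (((M+j)*q:ℕ):ℂ)^(1-s)) atTop (𝓝 (avgc χ * 0)) := by
    refine Tendsto.const_mul _ ?_
    rw [tendsto_zero_iff_norm_tendsto_zero]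
    have h3 : Tendsto (fun n : ℕ => (n:ℝ)^(-(s.re-1))) atTop (𝓝 0) :=
      (tendsto_rpow_neg_atTop (by linarith)).comp tendsto_natCast_atTop_atTop
    refine (h3.comp ht).congr fun j => ?_
    have : 0 < (M+j)*q := by positivity
    simp only [Function.comp]
    rw [norm_natCast_cpow_of_pos this]; congr 1; simp
  have h4 := (blk_summable hq χ hM (by linarith : 0 < s.re)).of_norm.hasSum.tendsto_sum_nat
  have h5 := h4.const_add ((s-1) * psum χ (M*q) s + avgc χ * ((M*q:ℕ):ℂ)^(1-s))
  have h6 := h1.add h2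
  rw [mul_zero, add_zero] at h6
  refine tendsto_nhds_unique h6 (h5.congr fun j => ?_)
  exact (blk_finite hq χ M s j).symm

lemma L1_formula {q : ℕ} [NeZero q] (χ : DirichletCharacter ℂ q) {M : ℕ} (hM : 0 < M) {s : ℂ} (hs : 0 < s.re) :
    L1 χ s = (s-1) * psum χ (M*q) s + avgc χ * ((M*q:ℕ):ℂ)^(1-s) + ∑' j, blk χ (M+j) s := by
  have hq : 0 < q := Nat.pos_of_ne_zero (NeZero.ne q)
  set a := min (s.re/2) 1 with ha
  have ha0 : 0 < a := lt_min (by linarith) one_pos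
  set B := ‖s‖ + 3
  set U : Set ℂ := {z | a < z.re} ∩ ball 0 B with hU
  have hUo : IsOpen U := (isOpen_lt continuous_const continuous_re).inter isOpen_ball
  have hUc : IsPreconnected U := ((convex_halfSpace_re_gt a).inter (convex_ball 0 B)).isPreconnected
  have hsU : s ∈ U := ⟨lt_of_le_of_lt (min_le_left (s.re/2) 1) (half_lt_self hs), by simp [B]⟩
  have h2U : (2:ℂ) ∈ U := ⟨lt_of_le_of_lt (min_le_right (s.re/2) 1) (show (1:ℝ) < (2:ℂ).re by norm_num), by
    rw [mem_ball_zero_iff]; simp [B]; linarith [norm_nonneg s]⟩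
  have hpd : Differentiable ℂ (psum χ (M*q)) := by
    unfold psum
    refine Differentiable.fun_sum fun a _ => ?_
    have h1 : ((a+1 : ℕ) : ℂ) ≠ 0 := Nat.cast_ne_zero.mpr (Nat.succ_ne_zero _)
    have e1 : Differentiable ℂ fun s : ℂ => ((a+1 : ℕ) : ℂ)^(-s) := fun s => by
      exact (differentiableAt_id.neg).const_cpow (Or.inl h1)
    fun_prop
  have e2 : Differentiable ℂ fun s : ℂ => ((M*q : ℕ) : ℂ)^(1-s) := fun s => by
    exact (differentiableAt_id.const_sub 1).const_cpow (Or.inl (Nat.cast_ne_zero.mpr (by positivity)))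
  have e3 : DifferentiableOn ℂ (fun s => ∑' j, blk χ (M+j) s) U := by
    refine Complex.differentiableOn_tsum_of_summable_norm
      (u := fun j => (B+1) * B * (q:ℝ)^2 * ((M+j:ℕ):ℝ)^(-a-1)) ((summable_blkbd ha0 hM).mul_left _)
      (fun j => (blk_diff hq χ (by omega)).differentiableOn) hUo ?_
    intro j w hw
    have hw1 : a < w.re := hw.1
    have hw2 : ‖w‖ < B := by simpa using hw.2
    refine (blk_le hq χ (by omega) w (by linarith)).trans ?_
    have h3 : ‖w - 1‖ ≤ B + 1 := (norm_sub_le _ _).trans (by simp; exact hw2.le)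
    have h1 : (1:ℝ) ≤ ((M+j:ℕ):ℝ) := by exact_mod_cast (by omega)
    have h2 : (1:ℝ) ≤ q := by exact_mod_cast hq
    have h4 : (((M+j:ℕ):ℝ)*q)^(-w.re-1) ≤ ((M+j:ℕ):ℝ)^(-a-1) := by
      calc _ ≤ ((M+j:ℕ):ℝ)^(-w.re-1) := Real.rpow_le_rpow_of_nonpos (by positivity) (by nlinarith) (by linarith)
        _ ≤ _ := Real.rpow_le_rpow_of_exponent_le h1 (by linarith)
    gcongr
  have A1 : AnalyticOnNhd ℂ (L1 χ) U := (L1_diff χ).differentiableOn.analyticOnNhd hUo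
  have A2 : AnalyticOnNhd ℂ (fun s => (s-1) * psum χ (M*q) s + avgc χ * ((M*q:ℕ):ℂ)^(1-s) + ∑' j, blk χ (M+j) s) U := by
    refine DifferentiableOn.analyticOnNhd ?_ hUo
    refine DifferentiableOn.add ?_ e3
    exact Differentiable.differentiableOn (by fun_prop)
  refine A1.eqOn_of_preconnected_of_eventuallyEq A2 hUc h2U ?_ hsU
  have : ∀ᶠ z : ℂ in 𝓝 2, 1 < z.re := (isOpen_lt continuous_const continuous_re).mem_nhds (by norm_num)
  filter_upwards [this] with z hz using L1_formula_gt χ hM hz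
end

section
open Complex Metric Set Filter Topology

lemma avgc_le {q : ℕ} (χ : DirichletCharacter ℂ q) : ‖avgc χ‖ ≤ 1 := by
  unfold avgc
  have h : ‖∑ a ∈ Finset.range q, χ ((a+1 : ℕ) : ZMod q)‖ ≤ q := by
    refine (norm_sum_le_of_le (f := fun a => χ ((a+1 : ℕ) : ZMod q)) _ (fun a _ => norm_chi_le χ _)).trans ?_
    simp
  rw [norm_mul]
  rcases Nat.eq_zero_or_pos q with h0 | h0
  · subst h0; simp
  have : ‖(1/(q:ℂ))‖ = 1/q := by simp
  rw [this, one_div, inv_mul_le_iff₀ (by positivity)]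
  simpa using h

lemma avgc_zero {q : ℕ} [NeZero q] {χ : DirichletCharacter ℂ q} (hχ : χ ≠ 1) : avgc χ = 0 := by
  have h0 : 0 < q := Nat.pos_of_ne_zero (NeZero.ne q)
  have h1 := MulChar.sum_eq_zero_of_ne_one hχ
  unfold avgc
  have e : ∑ a ∈ Finset.range q, χ ((a+1 : ℕ) : ZMod q) = ∑ a : ZMod q, χ a := by
    rw [← Equiv.sum_comp (Equiv.addRight (1 : ZMod q)) (fun a => χ a)]
    symm
    refine Finset.sum_bij (fun a _ => ZMod.val a) (fun a _ => Finset.mem_range.mpr (ZMod.val_lt a))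
      (fun a _ b _ h => ZMod.val_injective q h) (fun b hb => ⟨(b : ZMod q), Finset.mem_univ _, ZMod.val_cast_of_lt (Finset.mem_range.mp hb)⟩) ?_
    intro a _
    simp
  rw [e, h1, mul_zero]

lemma psum_le {q : ℕ} (χ : DirichletCharacter ℂ q) (N : ℕ) {s : ℂ} (hs : 0 ≤ s.re) : ‖psum χ N s‖ ≤ N := by
  unfold psum
  have : ∀ n ∈ Finset.range N, ‖χ ((n+1:ℕ) : ZMod q) * ((n+1:ℕ):ℂ)^(-s)‖ ≤ 1 := by
    intro n _
    rw [norm_mul, norm_natCast_cpow_of_pos (by omega)]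
    have h1 : ((n+1:ℕ):ℝ)^((-s).re) ≤ 1 :=
      Real.rpow_le_one_of_one_le_of_nonpos (by exact_mod_cast (by omega)) (by simpa using hs)
    have h2 := norm_chi_le χ ((n+1:ℕ) : ZMod q)
    have h3 : 0 ≤ ((n+1:ℕ):ℝ)^((-s).re) := by positivity
    nlinarith [norm_nonneg (χ ((n+1:ℕ) : ZMod q))]
  refine (norm_sum_le_of_le _ this).trans ?_
  simp

lemma q_rpow_le {q : ℕ} (h0 : 0 < q) {x : ℝ} (hx : 0 ≤ x) : (q:ℝ)^(1-x) ≤ q := by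
  have : (1:ℝ) ≤ q := by exact_mod_cast h0
  calc (q:ℝ)^(1-x) ≤ (q:ℝ)^(1:ℝ) := Real.rpow_le_rpow_of_exponent_le this (by linarith)
    _ = q := Real.rpow_one _

lemma tail_simple {q : ℕ} (hq : 0 < q) (χ : DirichletCharacter ℂ q) {s : ℂ} (hs : 1/16 ≤ s.re)
    (hs3 : s.re ≤ 3) : ‖∑' j, blk χ (1+j) s‖ ≤ 256 * ‖s-1‖ * ‖s‖ * q := by
  refine (blk_tsum_le hq χ one_pos (by linarith) hs3).trans ?_
  have h1 : 16 / s.re ≤ 256 := by rw [div_le_iff₀ (by linarith)]; linarith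
  have h2 := q_rpow_le hq (by linarith : 0 ≤ s.re)
  have h3 : ((1:ℕ):ℝ)^(-s.re) = 1 := by simp
  rw [h3, mul_one]
  gcongr

lemma L1_bound {q : ℕ} [NeZero q] (χ : DirichletCharacter ℂ q) {s : ℂ} (hs : 1/16 ≤ s.re) (hs3 : s.re ≤ 3) :
    ‖L1 χ s‖ ≤ q * (‖s-1‖ + 1 + 256 * ‖s-1‖ * ‖s‖) := by
  have h0 : 0 < q := Nat.pos_of_ne_zero (NeZero.ne q)
  rw [L1_formula χ one_pos (by linarith)]
  have h1 := tail_simple h0 χ hs hs3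
  have h2 : ‖avgc χ * ((1*q:ℕ):ℂ)^(1-s)‖ ≤ q := by
    rw [norm_mul, one_mul, norm_natCast_cpow_of_pos h0]
    have h3 := q_rpow_le h0 (by linarith : 0 ≤ s.re)
    have h4 : 0 ≤ (q:ℝ)^(1-s).re := by positivity
    simp only [sub_re, one_re] at h4 ⊢
    nlinarith [avgc_le χ, norm_nonneg (avgc χ)]
  have h3 : ‖(s-1) * psum χ (1*q) s‖ ≤ ‖s-1‖ * q := by
    rw [norm_mul, one_mul]; gcongr; exact psum_le χ q (by linarith)
  refine (norm_add₃_le).trans ?_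
  linarith

lemma L_bound {q : ℕ} [NeZero q] {χ : DirichletCharacter ℂ q} (hχ : χ ≠ 1) {s : ℂ} (hs : 1/16 < s.re) (hs3 : s.re < 3) :
    ‖χ.LFunction s‖ ≤ q * (1 + 256 * ‖s‖) := by
  have h0 : 0 < q := Nat.pos_of_ne_zero (NeZero.ne q)
  have key : ∀ s : ℂ, 1/16 < s.re → s.re < 3 → s ≠ 1 → ‖χ.LFunction s‖ ≤ q * (1 + 256 * ‖s‖) := by
    intro s hs hs3 hs1
    have h1 := tail_simple h0 χ hs.le hs3.le
    have h2 := L1_formula χ (M := 1) one_pos (s := s) (by linarith)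
    rw [avgc_zero hχ, zero_mul, add_zero, L1_eq χ hs1] at h2
    have h3 : ‖(s-1) * psum χ (1*q) s‖ ≤ ‖s-1‖ * q := by
      rw [norm_mul, one_mul]; gcongr; exact psum_le χ q (by linarith)
    have h4 : ‖(s-1) * χ.LFunction s‖ ≤ ‖s-1‖ * (q * (1 + 256 * ‖s‖)) := by
      rw [h2]; refine (norm_add_le _ _).trans ?_
      linarith
    rw [norm_mul] at h4
    exact le_of_mul_le_mul_left h4 (norm_pos_iff.mpr (sub_ne_zero.mpr hs1))
  by_cases hs1 : s = 1
  · have hc : Continuous χ.LFunction := (DirichletCharacter.differentiable_LFunction hχ).continuous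
    have t1 : Tendsto (fun z => ‖χ.LFunction z‖) (𝓝[≠] s) (𝓝 ‖χ.LFunction s‖) :=
      (hc.norm.tendsto s).mono_left nhdsWithin_le_nhds
    have t2 : Tendsto (fun z : ℂ => (q:ℝ) * (1 + 256 * ‖z‖)) (𝓝[≠] s) (𝓝 ((q:ℝ) * (1 + 256 * ‖s‖))) :=
      (Continuous.tendsto (by fun_prop) s).mono_left nhdsWithin_le_nhds
    refine le_of_tendsto_of_tendsto t1 t2 ?_
    have o1 : ∀ᶠ z : ℂ in 𝓝 s, 1/16 < z.re := (isOpen_lt continuous_const continuous_re).mem_nhds hs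
    have o2 : ∀ᶠ z : ℂ in 𝓝 s, z.re < 3 := (isOpen_lt continuous_re continuous_const).mem_nhds hs3
    filter_upwards [o1.filter_mono nhdsWithin_le_nhds, o2.filter_mono nhdsWithin_le_nhds, self_mem_nhdsWithin] with z h1 h2 h3
    exact key z h1 h2 (by rw [← hs1]; exact h3)
  · exact key s hs hs3 hs1

lemma tsum_term_le {f : ℕ → ℂ} (hf : ∀ n, ‖f n‖ ≤ 1) {s : ℂ} (hs : 1 < s.re) (hs4 : s.re ≤ 4) :
    ‖LSeries f s‖ ≤ 16 / (s.re - 1) := by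
  have hσ : 0 < s.re - 1 := by linarith
  have hb : ∀ n, ‖LSeries.term f s n‖ ≤ (n:ℝ)^(-(s.re-1)-1) := by
    intro n
    rcases Nat.eq_zero_or_pos n with h | h
    · subst h; simp; positivity
    rw [LSeries.norm_term_eq, if_neg h.ne']
    have : (n:ℝ)^(-(s.re-1)-1) = 1 / (n:ℝ)^s.re := by
      rw [one_div, ← Real.rpow_neg (by positivity)]; congr 1; ring
    rw [this]; gcongr; exact hf n
  have hsum : Summable fun n : ℕ => (n:ℝ)^(-(s.re-1)-1) := Real.summable_nat_rpow.mpr (by linarith)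
  have hsn : Summable fun n => ‖LSeries.term f s n‖ := Summable.of_nonneg_of_le (fun _ => norm_nonneg _) hb hsum
  have h1 : ‖LSeries f s‖ ≤ ∑' n, ‖LSeries.term f s n‖ := norm_tsum_le_tsum_norm hsn
  have h2 : ∑' n, ‖LSeries.term f s n‖ ≤ ∑' n : ℕ, (n:ℝ)^(-(s.re-1)-1) := hsn.tsum_le_tsum hb hsum
  have h3 : ∑' n : ℕ, (n:ℝ)^(-(s.re-1)-1) = 0 + ∑' j : ℕ, ((1+j:ℕ):ℝ)^(-(s.re-1)-1) := by
    rw [hsum.tsum_eq_zero_add]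
    congr 1
    · rw [Nat.cast_zero, Real.zero_rpow (by linarith)]
    · congr 1; ext j; rw [add_comm]
  have h4 := tsum_rpow_le hσ (by linarith) (M := 1) one_pos
  simp only [Nat.cast_one, Real.one_rpow, mul_one] at h4
  linarith

lemma L_lower {q : ℕ} [NeZero q] (χ : DirichletCharacter ℂ q) {s : ℂ} (hs : 1 < s.re) (hs4 : s.re ≤ 4) :
    (s.re - 1)/16 ≤ ‖χ.LFunction s‖ := by
  have h1 := DirichletCharacter.LSeries.mul_mu_eq_one χ hs
  rw [← DirichletCharacter.LFunction_eq_LSeries χ hs] at h1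
  have h2 := tsum_term_le (f := (fun n => χ n * (ArithmeticFunction.moebius n : ℂ))) (fun n => by
    rw [norm_mul]
    have e1 := norm_chi_le χ (n : ZMod q)
    have e2 : ‖(ArithmeticFunction.moebius n : ℂ)‖ ≤ 1 := by
      rw [norm_intCast]; exact_mod_cast ArithmeticFunction.abs_moebius_le_one
    exact mul_le_one₀ e1 (norm_nonneg _) e2) hs hs4
  have h3 : ‖χ.LFunction s‖ * ‖LSeries (fun n => χ n * (ArithmeticFunction.moebius n : ℂ)) s‖ = 1 := by
    rw [← norm_mul]; erw [h1]; simp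
  have hσ : 0 < s.re - 1 := by linarith
  have h4 : 1 ≤ ‖χ.LFunction s‖ * (16/(s.re-1)) := by
    refine h3.ge.trans ?_
    gcongr
  rw [← mul_div_assoc, le_div_iff₀ hσ] at h4
  linarith

lemma L_upper {q : ℕ} [NeZero q] (χ : DirichletCharacter ℂ q) {s : ℂ} (hs : 1 < s.re) (hs4 : s.re ≤ 4) :
    ‖χ.LFunction s‖ ≤ 16/(s.re - 1) := by
  rw [DirichletCharacter.LFunction_eq_LSeries χ hs]
  exact tsum_term_le (fun n => norm_chi_le χ _) hs hs4
end

section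
open Complex Metric Set Filter Topology

noncomputable def ee (x : ℝ) : ℂ := exp ((2 * Real.pi * x : ℝ) * I)

lemma ee_norm (x : ℝ) : ‖ee x‖ = 1 := by unfold ee; exact norm_exp_ofReal_mul_I _
lemma ee_add (x y : ℝ) : ee (x+y) = ee x * ee y := by
  unfold ee; rw [← Complex.exp_add]; congr 1; push_cast; ring
lemma ee_conj (x : ℝ) : (starRingEnd ℂ) (ee x) = ee (-x) := by
  unfold ee; rw [← Complex.exp_conj]; congr 1; simp [Complex.conj_ofNat]

lemma weyl_id (e : ℕ → ℂ) (he : ∀ n, ‖e n‖ = 1) (N : ℕ) :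
    (‖∑ n ∈ Finset.range N, e n‖^2 : ℝ) = N + 2 * (∑ h ∈ Finset.range N, ∑ n ∈ Finset.range (N-1-h),
      e (n+h+1) * (starRingEnd ℂ) (e n)).re := by
  induction N with
  | zero => simp
  | succ N ih =>
    rw [Finset.sum_range_succ]
    have h1 : ‖∑ n ∈ Finset.range N, e n + e N‖^2 = ‖∑ n ∈ Finset.range N, e n‖^2 + 1
        + 2 * (e N * (starRingEnd ℂ) (∑ n ∈ Finset.range N, e n)).re := by
      rw [Complex.sq_norm, Complex.normSq_add, ← Complex.sq_norm, ← Complex.sq_norm, he N]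
      have : (∑ n ∈ Finset.range N, e n * (starRingEnd ℂ) (e N)).re = (e N * (starRingEnd ℂ) (∑ n ∈ Finset.range N, e n)).re := by
        rw [← Finset.sum_mul]; simp [mul_re]; ring
      rw [← Finset.sum_mul] at this
      rw [this]; ring
    have h2 : ∑ h ∈ Finset.range (N+1), ∑ n ∈ Finset.range (N+1-1-h), e (n+h+1) * (starRingEnd ℂ) (e n)
      = ∑ h ∈ Finset.range N, ∑ n ∈ Finset.range (N-1-h), e (n+h+1) * (starRingEnd ℂ) (e n)
        + e N * (starRingEnd ℂ) (∑ n ∈ Finset.range N, e n) := by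
      rw [Finset.sum_range_succ]
      simp only [Nat.add_sub_cancel, Nat.sub_self, Finset.range_zero, Finset.sum_empty, add_zero]
      rw [map_sum, Finset.mul_sum, ← Finset.sum_range_reflect (fun h => e N * _), ← Finset.sum_add_distrib]
      refine Finset.sum_congr rfl fun h hh => ?_
      have hh' : h < N := Finset.mem_range.mp hh
      have e1 : N - h = (N-1-h) + 1 := by omega
      have e2 : N-1-h+h+1 = N := by omega
      rw [e1, Finset.sum_range_succ, e2]
    rw [h1, h2, ih, add_re]; push_cast; ring

lemma weyl_ineq (f : ℕ → ℝ) (N : ℕ) :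
    (‖∑ n ∈ Finset.range N, ee (f n)‖^2 : ℝ) ≤ N + 2 * ∑ h ∈ Finset.range N, ‖∑ n ∈ Finset.range (N-1-h),
      ee (f (n+h+1) - f n)‖ := by
  rw [weyl_id (fun n => ee (f n)) (fun n => ee_norm _)]
  gcongr
  refine (re_le_norm _).trans ((norm_sum_le _ _).trans (le_of_eq ?_))
  refine Finset.sum_congr rfl fun h _ => ?_
  congr 1
  refine Finset.sum_congr rfl fun n _ => ?_
  rw [ee_conj, ← ee_add]; rfl

/-- 1/(1-e(d)) = 1/2 + (i/2) cot(pi d) -/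
lemma kl_g {d : ℝ} (h0 : 0 < d) (h1 : d ≤ 1/2) :
    (1/2 + (Real.cos (Real.pi*d) / Real.sin (Real.pi*d) / 2 : ℝ) * I) * (1 - ee d) = 1 := by
  have hs : 0 < Real.sin (Real.pi*d) := Real.sin_pos_of_pos_of_lt_pi (by positivity) (by nlinarith [Real.pi_pos])
  have e1 : ee d = (Real.cos (Real.pi*d) + Real.sin (Real.pi*d) * I)^2 := by
    rw [ofReal_cos, ofReal_sin, ← Complex.exp_mul_I, ← Complex.exp_nat_mul]; unfold ee; congr 1; push_cast; ring
  rw [e1]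
  have h2 := Real.sin_sq_add_cos_sq (Real.pi*d)
  set S := Real.sin (Real.pi*d)
  set C := Real.cos (Real.pi*d)
  have e2 : (S:ℂ)^2 + (C:ℂ)^2 = 1 := by exact_mod_cast h2
  have e3 : (S:ℂ) ≠ 0 := by exact_mod_cast hs.ne'
  push_cast
  field_simp
  have e4 : (1 - ((C:ℂ) + S * I)^2) = 2*S*(S - C*I) := by
    linear_combination (-S^2:ℂ) * Complex.I_sq - e2
  rw [e4]
  linear_combination (-2*S*C^2:ℂ) * Complex.I_sq + 2*S*e2

lemma sin_pi_ge {d : ℝ} (h0 : 0 ≤ d) (h1 : d ≤ 1/2) : 2*d ≤ Real.sin (Real.pi*d) := by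
  have := Real.mul_le_sin (x := Real.pi*d) (by positivity) (by nlinarith [Real.pi_pos])
  refine le_trans (le_of_eq ?_) this
  field_simp

lemma cot_bd {d μ : ℝ} (hμ : 0 < μ) (h0 : μ ≤ d) (h1 : d ≤ 1/2) :
    0 ≤ Real.cos (Real.pi*d) / Real.sin (Real.pi*d) ∧ Real.cos (Real.pi*d) / Real.sin (Real.pi*d) ≤ 1/(2*μ) := by
  have h2 := sin_pi_ge (by linarith : 0 ≤ d) h1
  have hc : 0 ≤ Real.cos (Real.pi*d) := Real.cos_nonneg_of_mem_Icc ⟨by nlinarith [Real.pi_pos], by nlinarith [Real.pi_pos]⟩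
  refine ⟨div_nonneg hc (by linarith), ?_⟩
  gcongr
  · exact Real.cos_le_one _
  · linarith

lemma cot_mono {d d' : ℝ} (h0 : 0 < d) (h1 : d ≤ d') (h2 : d' ≤ 1/2) :
    Real.cos (Real.pi*d') / Real.sin (Real.pi*d') ≤ Real.cos (Real.pi*d) / Real.sin (Real.pi*d) := by
  have s1 := sin_pi_ge (by linarith : 0 ≤ d) (by linarith)
  have s2 := sin_pi_ge (by linarith : 0 ≤ d') (by linarith)
  have hc : 0 ≤ Real.cos (Real.pi*d) := Real.cos_nonneg_of_mem_Icc ⟨by nlinarith [Real.pi_pos], by nlinarith [Real.pi_pos]⟩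
  have pp := Real.pi_pos
  have h3 : Real.cos (Real.pi*d') ≤ Real.cos (Real.pi*d) :=
    Real.cos_le_cos_of_nonneg_of_le_pi (by positivity) (by nlinarith) (by gcongr)
  have h4 : Real.sin (Real.pi*d) ≤ Real.sin (Real.pi*d') :=
    Real.sin_le_sin_of_le_of_le_pi_div_two (by nlinarith) (by nlinarith) (by gcongr)
  gcongr
  linarith

/-- Kusmin-Landau -/
lemma KL (f : ℕ → ℝ) {μ : ℝ} (hμ : 0 < μ) (N : ℕ) (h1 : ∀ n < N, μ ≤ f (n+1) - f n ∧ f (n+1) - f n ≤ 1/2)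
    (h2 : ∀ n, f (n+2) - f (n+1) ≤ f (n+1) - f n) : ‖∑ n ∈ Finset.range N, ee (f n)‖ ≤ 3/2/μ := by
  set c : ℕ → ℝ := fun n => Real.cos (Real.pi*(f (n+1) - f n)) / Real.sin (Real.pi*(f (n+1) - f n)) with hc
  set g : ℕ → ℂ := fun n => 1/2 + (c n / 2 : ℝ) * I with hg
  have hgn : ∀ n < N, ‖g n‖ ≤ 1/(2*μ) := by
    intro n hn
    have hh := h1 n hn
    have hd0 : 0 < f (n+1) - f n := by linarith
    have := cot_bd hμ hh.1 hh.2
    have h3 : ‖g n‖ ≤ 1/2 + c n/2 := by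
      refine (norm_add_le _ _).trans ?_
      rw [norm_mul, norm_I, mul_one, norm_real, Real.norm_eq_abs, abs_of_nonneg (by have := this.1; positivity)]
      norm_num
    have h4 : 1/2 ≤ 1/(4*μ) := by rw [div_le_div_iff₀ (by norm_num) (by positivity)]; linarith
    have h5 : c n / 2 ≤ 1/(4*μ) := by
      have := this.2
      have e : 1/(4*μ) = (1/(2*μ))/2 := by field_simp; norm_num
      rw [e]; linarith
    have e : 1/(2*μ) = 1/(4*μ) + 1/(4*μ) := by field_simp; norm_num
    rw [e]; linarith
  have hterm : ∀ n < N, ee (f n) = g n * (ee (f n) - ee (f (n+1))) := by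
    intro n hn
    have hh := h1 n hn
    have := kl_g (d := f (n+1) - f n) (by linarith) hh.2
    have e : ee (f (n+1)) = ee (f n) * ee (f (n+1) - f n) := by rw [← ee_add]; congr 1; ring
    rw [e]
    calc ee (f n) = ee (f n) * 1 := (mul_one _).symm
      _ = _ := by rw [← this]; ring
  -- partial statement
  have key : ∀ K, K < N → ‖(∑ n ∈ Finset.range (K+1), ee (f n)) + g K * ee (f (K+1))‖ ≤ 1/(2*μ) + (c K - c 0)/2 := by
    intro K
    induction K with
    | zero =>
      intro h
      have : (∑ n ∈ Finset.range (0+1), ee (f n)) + g 0 * ee (f (0+1)) = g 0 * ee (f 0) := by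
        simp only [zero_add, Finset.range_one, Finset.sum_singleton]
        have := hterm 0 h
        simp only [zero_add] at this
        linear_combination this
      rw [this, norm_mul, ee_norm, mul_one, sub_self, zero_div, add_zero]
      exact hgn 0 h
    | succ K ih =>
      intro h
      have ih' := ih (by omega)
      have e : (∑ n ∈ Finset.range (K+1+1), ee (f n)) + g (K+1) * ee (f (K+1+1)) =
          ((∑ n ∈ Finset.range (K+1), ee (f n)) + g K * ee (f (K+1))) + (g (K+1) - g K) * ee (f (K+1)) := by
        rw [Finset.sum_range_succ]
        linear_combination hterm (K+1) h
      rw [e]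
      refine (norm_add_le _ _).trans ?_
      have e2 : g (K+1) - g K = ((c (K+1) - c K)/2 : ℝ) * I := by simp only [hg]; push_cast; ring
      have hm : c K ≤ c (K+1) := cot_mono (by have := (h1 (K+1) h).1; linarith) (h2 K) (h1 K (by omega)).2
      rw [norm_mul, ee_norm, mul_one, e2, norm_mul, norm_I, mul_one, norm_real, Real.norm_eq_abs,
        abs_of_nonneg (by linarith)]
      linarith
  rcases Nat.eq_zero_or_pos N with h | h
  · subst h; simp; positivity
  obtain ⟨K, rfl⟩ : ∃ K, N = K+1 := ⟨N-1, by omega⟩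
  have h3 := key K (by omega)
  have h4 : ‖g K * ee (f (K+1))‖ ≤ 1/(2*μ) := by rw [norm_mul, ee_norm, mul_one]; exact hgn K (by omega)
  have h5 := (cot_bd hμ (h1 K (by omega)).1 (h1 K (by omega)).2).2
  have h6 := (cot_bd hμ (h1 0 (by omega)).1 (h1 0 (by omega)).2).1
  have h7 := norm_sub_le ((∑ n ∈ Finset.range (K+1), ee (f n)) + g K * ee (f (K+1))) (g K * ee (f (K+1)))
  rw [add_sub_cancel_right] at h7
  have e : 3/2/μ = 1/(2*μ) + 1/(2*μ) + 1/(2*μ) := by field_simp; norm_num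
  have h8 : 0 < 1/(2*μ) := by positivity
  have h9 : c K ≤ 1/(2*μ) := h5
  have h10 : 0 ≤ c 0 := h6
  rw [e]; linarith
end

section
open Complex Metric Set Filter Topology

def dl (f : ℕ → ℝ) : ℕ → ℝ := fun n => f (n+1) - f n

lemma dl_shift (k h : ℕ) : ∀ (f : ℕ → ℝ) (n : ℕ), dl^[k] (fun n => f (n+h) - f n) n = dl^[k] f (n+h) - dl^[k] f n := by
  induction k with
  | zero => intro f n; rfl
  | succ k ih =>
    intro f n
    rw [Function.iterate_succ_apply, Function.iterate_succ_apply]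
    rw [← ih (dl f) n]
    have e : dl (fun n => f (n+h) - f n) = fun n => dl f (n+h) - dl f n := by
      ext m; simp only [dl]
      have : m + 1 + h = m + h + 1 := by omega
      rw [this]; ring
    rw [e]

lemma dl_shift_sum (k h : ℕ) (f : ℕ → ℝ) (n : ℕ) : dl^[k] (fun n => f (n+h) - f n) n = ∑ j ∈ Finset.range h, dl^[k+1] f (n+j) := by
  rw [dl_shift]
  induction h with
  | zero => simp
  | succ h ih =>
    rw [Finset.sum_range_succ, ← ih, Function.iterate_succ_apply']
    simp only [dl]
    have : n + (h+1) = n+h+1 := by omega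
    rw [this]; ring

lemma sum_h_le {κ : ℝ} (h0 : 0 < κ) (h1 : κ ≤ 1/2) (N : ℕ) :
    ∑ h ∈ Finset.range N, ((h+1:ℕ):ℝ)^(-κ) ≤ 2 * (N:ℝ)^(1-κ) := by
  induction N with
  | zero => simp; positivity
  | succ N ih =>
    rw [Finset.sum_range_succ]
    -- 2 N^{1-κ} + (N+1)^{-κ} ≤ 2 (N+1)^{1-κ}
    have hN : (0:ℝ) < ((N+1:ℕ):ℝ) := by positivity
    have h2 : (N:ℝ)^(1-κ) ≤ ((N+1:ℕ):ℝ)^(1-κ) - (1/2) * ((N+1:ℕ):ℝ)^(-κ) := by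
      have e : ((N+1:ℕ):ℝ)^(1-κ) = ((N+1:ℕ):ℝ) * ((N+1:ℕ):ℝ)^(-κ) := by
        rw [sub_eq_add_neg, Real.rpow_add hN, Real.rpow_one]
      set y := ((N+1:ℕ):ℝ) with hy
      have hy1 : (N:ℝ) = y - 1 := by rw [hy]; push_cast; ring
      have hy2 : 1 ≤ y := by rw [hy]; push_cast; linarith [(Nat.cast_nonneg N : (0:ℝ) ≤ N)]
      -- (y-1)^{1-κ} = y^{1-κ} (1-1/y)^{1-κ} ≤ y^{1-κ}(1-(1-κ)/y)
      have hb : (1 + (-(1/y)))^(1-κ) ≤ 1 + (1-κ) * (-(1/y)) :=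
        rpow_one_add_le_one_add_mul_self (by rw [neg_le_neg_iff, div_le_one hN]; exact hy2) (by linarith) (by linarith)
      have e2 : (N:ℝ)^(1-κ) = y^(1-κ) * (1 + (-(1/y)))^(1-κ) := by
        rw [← Real.mul_rpow hN.le (by rw [← sub_eq_add_neg, sub_nonneg, div_le_one hN]; exact hy2), hy1]
        congr 1; field_simp; ring
      rw [e2]
      have h3 : 0 < y^(-κ) := by positivity
      have h4 : 0 < y^(1-κ) := by positivity
      calc _ ≤ y^(1-κ) * (1 + (1-κ) * (-(1/y))) := by gcongr
        _ = y^(1-κ) - (1-κ) * y^(-κ) := by rw [e]; field_simp; ring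
        _ ≤ _ := by nlinarith
    linarith

lemma VdC (k : ℕ) : ∀ (f : ℕ → ℝ) (μ : ℝ) (N : ℕ), 0 < μ → 0 < N → (∀ n < N, μ ≤ dl^[k+1] f n ∧ dl^[k+1] f n ≤ 2*μ) →
    (∀ n, dl^[k+1] f (n+1) ≤ dl^[k+1] f n) → 4 * μ * (N:ℝ)^k ≤ 1 →
    ‖∑ n ∈ Finset.range N, ee (f n)‖ ≤ 5 * N * (μ * (N:ℝ)^(k+1))^(-((1/2:ℝ)^(k+1))) := by
  induction k with
  | zero =>
    intro f μ N hμ hN h1 h2 h3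
    have hKL := KL f hμ N (fun n hn => ⟨(h1 n hn).1, by
      have := (h1 n hn).2
      simp only [zero_add, Function.iterate_one, dl, pow_zero] at this h3; linarith⟩) h2
    have htriv : ‖∑ n ∈ Finset.range N, ee (f n)‖ ≤ N := by
      refine (norm_sum_le _ _).trans ?_
      simp [ee_norm]
    set S := ‖∑ n ∈ Finset.range N, ee (f n)‖
    have hS : 0 ≤ S := norm_nonneg _
    have hN' : (0:ℝ) < N := by positivity
    simp only [zero_add, pow_one]
    rw [Real.rpow_neg (by positivity), ← Real.sqrt_eq_rpow]
    have hsq : 0 < Real.sqrt (μ * N) := Real.sqrt_pos.mpr (by positivity)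
    rw [← div_eq_mul_inv, le_div_iff₀ hsq]
    refine abs_le_of_sq_le_sq' ?_ (by positivity) |>.2
    rw [mul_pow, Real.sq_sqrt (by positivity)]
    rw [le_div_iff₀ hμ] at hKL
    nlinarith [mul_nonneg hS hμ.le, mul_le_mul htriv hKL (by positivity) (by positivity)]
  | succ k ih =>
    intro f μ N hμ hN h1 h2 h3
    have hN' : (1:ℝ) ≤ N := by exact_mod_cast hN
    have hN0 : (0:ℝ) < N := by linarith
    set κ : ℝ := (1/2)^(k+1) with hκ
    have hκ0 : 0 < κ := by positivity
    have hκ1 : κ ≤ 1/2 := by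
      rw [hκ, pow_succ]; nlinarith [pow_le_one₀ (n := k) (by norm_num : (0:ℝ) ≤ 1/2) (by norm_num)]
    have hkκ : ((k+1:ℕ):ℝ) * κ ≤ 1 := by
      have : ((k+1:ℕ):ℝ) ≤ 2^(k+1) := by exact_mod_cast Nat.lt_two_pow_self.le
      rw [hκ, div_pow, one_pow, mul_one_div, div_le_one (by positivity)]; exact this
    set P := (μ * (N:ℝ)^(k+2))^(-κ) with hP
    have hP0 : 0 < P := by positivity
    have hSh : ∀ h ∈ Finset.range N, ‖∑ n ∈ Finset.range (N-1-h), ee (f (n+h+1) - f n)‖ ≤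
        5 * N * (N:ℝ)^κ * P * ((h+1:ℕ):ℝ)^(-κ) := by
      intro h hh
      have hh' : h < N := Finset.mem_range.mp hh
      rcases Nat.eq_zero_or_pos (N-1-h) with h0 | h0
      · rw [h0]; simp; positivity
      set N' := N-1-h with hN'def
      have hle : (N':ℝ) ≤ N := by exact_mod_cast (by omega)
      have hN'0 : (0:ℝ) < N' := by exact_mod_cast h0
      have hhN : ((h+1:ℕ):ℝ) ≤ N := by exact_mod_cast (by omega)
      have hi := ih (fun n => f (n+(h+1)) - f n) (((h+1:ℕ):ℝ)*μ) N' (by positivity) h0 ?_ ?_ ?_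
      · refine hi.trans (le_of_le_of_eq (b := 5 * (((h+1:ℕ):ℝ)^(-κ) * μ^(-κ) * (N:ℝ)^(1-((k+1:ℕ):ℝ)*κ))) ?_ ?_)
        · have e : 5 * (N':ℝ) * (((h+1:ℕ):ℝ)*μ * (N':ℝ)^(k+1))^(-κ) =
            5 * (((h+1:ℕ):ℝ)^(-κ) * μ^(-κ) * (N':ℝ)^(1-((k+1:ℕ):ℝ)*κ)) := by
            rw [Real.mul_rpow (by positivity) (by positivity), Real.mul_rpow (by positivity) (by positivity),
              ← Real.rpow_natCast, ← Real.rpow_mul (by positivity), sub_eq_add_neg, Real.rpow_add hN'0, Real.rpow_one, mul_neg]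
            ring
          rw [e]
          gcongr
        · rw [hP, Real.mul_rpow (by positivity) (by positivity), ← Real.rpow_natCast, ← Real.rpow_mul (by positivity)]
          have e : (N:ℝ)^(1-((k+1:ℕ):ℝ)*κ) = N * (N:ℝ)^κ * (N:ℝ)^(((k+2:ℕ):ℝ) * -κ) := by
            rw [mul_assoc, ← Real.rpow_add hN0]
            nth_rewrite 2 [← Real.rpow_one (N:ℝ)]
            rw [← Real.rpow_add hN0]
            congr 1; push_cast; ring
          rw [e]; ring
      · intro n hn
        rw [dl_shift_sum]
        have hb : ∀ j ∈ Finset.range (h+1), μ ≤ dl^[k+1+1] f (n+j) ∧ dl^[k+1+1] f (n+j) ≤ 2*μ := fun j hj => by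
          have := Finset.mem_range.mp hj
          exact h1 _ (by omega)
        constructor
        · have := Finset.card_nsmul_le_sum _ _ _ (fun j hj => (hb j hj).1)
          simpa using this
        · have := Finset.sum_le_card_nsmul _ _ _ (fun j hj => (hb j hj).2)
          rw [Finset.card_range, nsmul_eq_mul] at this
          linarith
      · intro n
        rw [dl_shift_sum, dl_shift_sum]
        refine Finset.sum_le_sum fun j _ => ?_
        have : n + 1 + j = n + j + 1 := by omega
        rw [this]; exact h2 _
      · calc 4 * (((h+1:ℕ):ℝ)*μ) * (N':ℝ)^k ≤ 4 * (N*μ) * (N:ℝ)^k := by gcongr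
          _ = 4 * μ * (N:ℝ)^(k+1) := by ring
          _ ≤ 1 := h3
    have hw := weyl_ineq f N
    have hsum := Finset.sum_le_sum hSh
    rw [← Finset.mul_sum] at hsum
    have hs2 := sum_h_le hκ0 hκ1 N
    have hNP : (N:ℝ) ≤ N^2 * P := by
      rw [hP, Real.rpow_neg (by positivity), ← div_eq_mul_inv, le_div_iff₀ (by positivity), sq]
      gcongr
      have e1 : μ * (N:ℝ)^(k+2) ≤ N := by
        have : μ * (N:ℝ)^(k+2) = (4*μ*N^(k+1)) * N / 4 := by ring
        rw [this]; nlinarith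
      calc (μ * (N:ℝ)^(k+2))^κ ≤ (N:ℝ)^κ := by gcongr
        _ ≤ (N:ℝ)^(1:ℝ) := Real.rpow_le_rpow_of_exponent_le hN' (by linarith)
        _ = N := Real.rpow_one _
    have hfin : ‖∑ n ∈ Finset.range N, ee (f n)‖^2 ≤ (5*N)^2 * P := by
      have e2 : (N:ℝ)^κ * (N:ℝ)^(1-κ) = N := by rw [← Real.rpow_add hN0]; simp
      calc _ ≤ N + 2 * (5 * N * (N:ℝ)^κ * P * (2 * (N:ℝ)^(1-κ))) := by
            refine hw.trans ?_
            gcongr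
            refine hsum.trans ?_
            gcongr
        _ = N + 20 * N * ((N:ℝ)^κ * (N:ℝ)^(1-κ)) * P := by ring
        _ = N + 20 * N * N * P := by rw [e2]
        _ ≤ _ := by nlinarith
    have e3 : P = ((μ * (N:ℝ)^(k+1+1))^(-((1/2:ℝ)^(k+1+1))))^2 := by
      rw [← Real.rpow_natCast, ← Real.rpow_mul (by positivity), hP, hκ]
      congr 1; push_cast; rw [pow_succ (1/2:ℝ) (k+1)]; ring
    rw [e3, ← mul_pow] at hfin
    exact (abs_le_of_sq_le_sq' hfin (by positivity)).2
end

section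
open Complex Metric Set Filter Topology

noncomputable def Dg : ℕ → ℝ → ℝ
  | 0 => fun y => - Real.log y
  | (k+1) => fun y => Dg k y - Dg k (y+1)

noncomputable def Rg (k : ℕ) (y : ℝ) : ℝ := k.factorial / ∏ j ∈ Finset.range (k+1), (y+j)

lemma prod_pos' (k : ℕ) {y : ℝ} (hy : 0 < y) : 0 < ∏ j ∈ Finset.range k, (y+j) :=
  Finset.prod_pos fun j _ => by positivity

lemma Rg_sub (k : ℕ) {y : ℝ} (hy : 0 < y) : Rg k y - Rg k (y+1) = Rg (k+1) y := by
  unfold Rg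
  have h1 : ∏ j ∈ Finset.range (k+1+1), (y+j) = (∏ j ∈ Finset.range (k+1), (y+j)) * (y + (k+1:ℕ)) := Finset.prod_range_succ _ _
  have h2 : ∏ j ∈ Finset.range (k+1+1), (y+j) = (∏ j ∈ Finset.range (k+1), (y+1+j)) * y := by
    rw [Finset.prod_range_succ']
    congr 1
    · refine Finset.prod_congr rfl fun j _ => ?_
      push_cast; ring
    · simp
  have p1 := prod_pos' (k+1) hy
  have p2 := prod_pos' (k+1) (by linarith : 0 < y + 1)
  have p3 := prod_pos' (k+1+1) hy
  set P := ∏ j ∈ Finset.range (k+1+1), (y+j)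
  have e1 : ∏ j ∈ Finset.range (k+1), (y+j) = P / (y + (k+1:ℕ)) := by rw [h1]; field_simp
  have e2 : ∏ j ∈ Finset.range (k+1), (y+1+j) = P / y := by rw [h2]; field_simp
  rw [e1, e2, Nat.factorial_succ]
  push_cast
  field_simp
  ring

lemma Dg_deriv (k : ℕ) : ∀ {y : ℝ}, 0 < y → HasDerivAt (Dg k) (- Rg k y) y := by
  induction k with
  | zero =>
    intro y hy
    have := (Real.hasDerivAt_log hy.ne').neg
    refine HasDerivAt.congr_deriv (f := Dg 0) this ?_
    simp [Rg]
  | succ k ih =>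
    intro y hy
    have h1 := ih hy
    have h2 := ih (by linarith : 0 < y + 1)
    have h3 : HasDerivAt (fun y => Dg k (y+1)) (-Rg k (y+1)) y := h2.comp_add_const y 1
    have h4 := h1.sub h3
    rw [← Rg_sub k hy]
    refine HasDerivAt.congr_deriv (f := Dg (k+1)) h4 (by ring)

lemma Dg_mvt (k : ℕ) {y : ℝ} (hy : 0 < y) : ∃ ξ, y < ξ ∧ ξ < y + 1 ∧ Dg (k+1) y = Rg k ξ := by
  obtain ⟨ξ, hξ, he⟩ := exists_hasDerivAt_eq_slope (Dg k) (fun y => -Rg k y) (by linarith : y < y+1)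
    (fun z hz => (Dg_deriv k (by linarith [hz.1])).continuousAt.continuousWithinAt)
    (fun z hz => Dg_deriv k (by linarith [hz.1]))
  refine ⟨ξ, hξ.1, hξ.2, ?_⟩
  simp at he
  simp [Dg]; linarith

lemma Dg_le (k : ℕ) {y X : ℝ} (hX : 0 < X) (hy : X ≤ y) : Dg (k+1) y ≤ k.factorial / X^(k+1) := by
  obtain ⟨ξ, h1, h2, h3⟩ := Dg_mvt k (by linarith : 0 < y)
  rw [h3, Rg]
  gcongr
  have e : X^(k+1) = ∏ j ∈ Finset.range (k+1), X := by simp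
  rw [e]
  refine Finset.prod_le_prod (fun _ _ => hX.le) ?_
  intro j _
  have : (0:ℝ) ≤ j := by positivity
  linarith

lemma Dg_ge (k : ℕ) {y Z : ℝ} (hy0 : 0 < y) (hy : y + (k+1:ℕ) ≤ Z) : k.factorial / Z^(k+1) ≤ Dg (k+1) y := by
  obtain ⟨ξ, h1, h2, h3⟩ := Dg_mvt k hy0
  rw [h3, Rg]
  have hp := prod_pos' (k+1) (by linarith : 0 < ξ)
  gcongr
  have e : Z^(k+1) = ∏ j ∈ Finset.range (k+1), Z := by simp
  rw [e]
  refine Finset.prod_le_prod ?_ ?_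
  · intro j _; 
    have : (0:ℝ) ≤ j := by positivity
    linarith
  · intro j hj
    have : (j:ℝ) ≤ k := by exact_mod_cast Nat.lt_succ_iff.mp (Finset.mem_range.mp hj)
    push_cast at hy
    linarith

lemma Dg_anti (k : ℕ) {y : ℝ} (hy : 0 < y) : Dg (k+1) (y+1) ≤ Dg (k+1) y := by
  obtain ⟨ξ, h1, h2, h3⟩ := Dg_mvt (k+1) hy
  have h4 : Dg (k+1+1) y = Dg (k+1) y - Dg (k+1) (y+1) := rfl
  have h5 : 0 ≤ Rg (k+1) ξ := by
    unfold Rg; exact div_nonneg (by positivity) (prod_pos' _ (by linarith)).le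
  linarith

lemma dl_Dg (A X : ℝ) (j : ℕ) : ∀ (c : ℝ) (n : ℕ),
    dl^[j] (fun n : ℕ => c * Dg 0 (n+X)) n = (-1)^j * c * Dg j (n+X) := by
  induction j with
  | zero => intro c n; simp
  | succ j ih =>
    intro c n
    rw [Function.iterate_succ_apply']
    simp only [dl]
    rw [ih, ih]
    have : ((n+1:ℕ):ℝ) + X = n + X + 1 := by push_cast; ring
    rw [this]
    simp only [Dg]
    rw [pow_succ]; ring

lemma vdc_mono {μ κ a b : ℝ} (hμ : 0 < μ) (ha : 0 < a) (hab : a ≤ b) (k : ℕ) (hk : ((k:ℕ):ℝ)*κ ≤ 1) :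
    5 * a * (μ * a^k)^(-κ) ≤ 5 * b * (μ * b^k)^(-κ) := by
  have hb : 0 < b := by linarith
  have e : ∀ a : ℝ, 0 < a → 5 * a * (μ * a^k)^(-κ) = 5 * (μ^(-κ) * a^(1-(k:ℝ)*κ)) := by
    intro a ha
    rw [Real.mul_rpow (by positivity) (by positivity),
              ← Real.rpow_natCast, ← Real.rpow_mul (by positivity), sub_eq_add_neg, Real.rpow_add ha, Real.rpow_one, mul_neg]
    ring
  rw [e a ha, e b hb]
  gcongr

lemma kk_half (k : ℕ) : ((k:ℕ):ℝ) * (1/2)^k ≤ 1 := by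
  have : ((k:ℕ):ℝ) ≤ 2^k := by exact_mod_cast Nat.lt_two_pow_self.le
  rw [div_pow, one_pow, mul_one_div, div_le_one (by positivity)]; exact this

lemma pow_two_bd {k : ℕ} {X W : ℝ} (hX : 0 < X) (hW0 : 0 ≤ W) (hW : W ≤ X / (2*(k+1:ℕ))) : (X+W)^(k+1) ≤ 2 * X^(k+1) := by
  have h1 : X + W ≤ X * Real.exp (1/(2*(k+1:ℕ))) := by
    have := Real.add_one_le_exp (1/(2*(k+1:ℕ)) : ℝ)
    have e : X / (2*(k+1:ℕ)) = X * (1/(2*(k+1:ℕ))) := by ring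
    rw [e] at hW
    nlinarith
  calc (X+W)^(k+1) ≤ (X * Real.exp (1/(2*(k+1:ℕ))))^(k+1) := by gcongr
    _ = X^(k+1) * Real.exp (1/2) := by
      rw [mul_pow, ← Real.exp_nat_mul]; congr 2; field_simp
    _ ≤ X^(k+1) * 2 := by
      gcongr
      have h3 : Real.exp (1/2) ^2 = Real.exp 1 := by rw [← Real.exp_nat_mul]; norm_num
      have := Real.exp_one_lt_d9
      nlinarith [Real.exp_pos (1/2)]
    _ = _ := by ring

lemma vdc_block (k : ℕ) {A X : ℝ} (hA : 0 < A) (hX : 0 < X) {H N : ℕ} (hNH : N ≤ H) (hH : 0 < H)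
    (h1 : (H:ℝ) + (k+1:ℕ) ≤ X / (2*(k+1:ℕ))) (h2 : 4 * A * k.factorial * (H:ℝ)^k ≤ X^(k+1)) (ε : ℝ) (hε : ε = 1 ∨ ε = -1) :
    ‖∑ n ∈ Finset.range N, ee (ε * A * Real.log (n+X))‖ ≤
      5 * H * (A * k.factorial / (2 * X^(k+1)) * (H:ℝ)^(k+1))^(-((1/2:ℝ)^(k+1))) := by
  rcases Nat.eq_zero_or_pos N with h0 | h0
  · subst h0; simp; positivity
  have hH' : (0:ℝ) < H := by exact_mod_cast hH
  set c : ℝ := (-1)^(k+1) * A with hc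
  have hsum : ‖∑ n ∈ Finset.range N, ee (ε * A * Real.log (n+X))‖ = ‖∑ n ∈ Finset.range N, ee (c * Dg 0 (n+X))‖ := by
    have hcase : c = -(ε * A) ∨ c = ε * A := by
      rcases neg_one_pow_eq_or ℝ (k+1) with h | h <;> rcases hε with h' | h' <;> rw [hc, h, h'] <;> simp
    rcases hcase with h | h
    · congr 1; refine Finset.sum_congr rfl fun n _ => ?_
      rw [h]; simp only [Dg]; congr 1; ring
    · rw [← Complex.norm_conj, map_sum]
      congr 1; refine Finset.sum_congr rfl fun n _ => ?_
      rw [h, ee_conj]; simp only [Dg]; congr 1; ring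
  rw [hsum]
  set Z := X + ((H:ℝ) + (k+1:ℕ)) with hZ
  have hZ0 : 0 < Z := by positivity
  set μ := A * k.factorial / Z^(k+1) with hμ
  have hμ0 : 0 < μ := by positivity
  have hZ2 : Z^(k+1) ≤ 2 * X^(k+1) := pow_two_bd hX (by positivity) h1
  have hXZ : X ≤ Z := by rw [hZ]; have : (0:ℝ) ≤ (H:ℝ) + (k+1:ℕ) := by positivity
                         linarith
  have hNH' : (N:ℝ) ≤ H := by exact_mod_cast hNH
  have hdl : ∀ n, dl^[k+1] (fun n : ℕ => c * Dg 0 (n+X)) n = A * Dg (k+1) (n+X) := by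
    intro n
    rw [dl_Dg A, hc]
    have : (-1:ℝ)^(k+1) * (-1)^(k+1) = 1 := by rw [← mul_pow]; norm_num
    rw [← mul_assoc, this, one_mul]
  have hV := VdC k (fun n => c * Dg 0 (n+X)) μ N hμ0 h0 ?_ ?_ ?_
  · refine hV.trans ?_
    refine (vdc_mono hμ0 (by exact_mod_cast h0) hNH' (k+1) (kk_half (k+1))).trans ?_
    refine mul_le_mul_of_nonneg_left ?_ (by positivity)
    refine Real.rpow_le_rpow_of_nonpos (by positivity) ?_ (by simp)
    rw [hμ]; gcongr
  · intro n hn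
    rw [hdl]
    have hn' : (n:ℝ) ≤ H := by exact_mod_cast (by omega)
    constructor
    · have := Dg_ge k (y := n + X) (Z := Z) (by positivity) (by rw [hZ]; linarith)
      rw [hμ, mul_div_assoc]; gcongr
    · have := Dg_le k (y := n + X) (X := X) hX (by linarith [(Nat.cast_nonneg n : (0:ℝ) ≤ n)])
      calc A * Dg (k+1) (n+X) ≤ A * (k.factorial / X^(k+1)) := by gcongr
        _ = 2 * (A * k.factorial / (2 * X^(k+1))) := by field_simp
        _ ≤ _ := by rw [hμ]; gcongr
  · intro n
    rw [hdl, hdl]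
    have := Dg_anti k (y := n + X) (by positivity)
    have e : ((n+1:ℕ):ℝ) + X = n + X + 1 := by push_cast; ring
    rw [e]; gcongr
  · calc 4 * μ * (N:ℝ)^k ≤ 4 * (A * k.factorial / X^(k+1)) * (H:ℝ)^k := by rw [hμ]; gcongr
      _ = (4 * A * k.factorial * (H:ℝ)^k) / X^(k+1) := by ring
      _ ≤ 1 := by rw [div_le_one (by positivity)]; exact h2

lemma block_sum (g : ℕ → ℂ) {H : ℕ} (hH : 0 < H) {B : ℝ} (hB : 0 ≤ B) (L0 : ℕ)
    (hg : ∀ i, i ≤ L0 → ∀ N ≤ H, ‖∑ n ∈ Finset.range N, g (i+n)‖ ≤ B) (L : ℕ) (hL : L ≤ L0) :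
    ‖∑ n ∈ Finset.range L, g n‖ ≤ ((L:ℝ)/H+1) * B := by
  induction L using Nat.strong_induction_on with
  | _ L ih =>
  have hH' : (0:ℝ) < H := by exact_mod_cast hH
  rcases le_or_gt L H with h | h
  · have := hg 0 (by omega) L h
    simp only [zero_add] at this
    refine this.trans ?_
    have : 0 ≤ (L:ℝ)/H := by positivity
    nlinarith
  · have e : L = (L-H) + H := by omega
    have h1 := ih (L-H) (by omega) (by omega)
    have h2 := hg (L-H) (by omega) H le_rfl
    rw [e, Finset.sum_range_add]
    refine (norm_add_le _ _).trans ?_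
    have e2 : (((L-H+H:ℕ):ℝ)/H+1) = (((L-H:ℕ):ℝ)/H+1) + 1 := by push_cast; field_simp
    rw [e2]; linarith
end

section
open Complex Metric Set Filter Topology

lemma kk_ineq (k : ℕ) : (10+k)*k ≤ 12 * 2^k := by
  induction k with
  | zero => simp
  | succ k ih =>
    rw [pow_succ]
    rcases Nat.lt_or_ge k 3 with h | h
    · interval_cases k <;> norm_num
    · nlinarith

lemma const_bd (k : ℕ) : ((768 * (k:ℝ))^k)^((1/2:ℝ)^k) ≤ 4096 := by
  have h1 : (768 * (k:ℝ)) ≤ 2^(10+k) := by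
    have : (k:ℝ) ≤ 2^k := by exact_mod_cast Nat.lt_two_pow_self.le
    rw [pow_add]; nlinarith
  have h2 : (768 * (k:ℝ))^k ≤ (2:ℝ)^(((10+k)*k : ℕ):ℝ) := by
    rw [Real.rpow_natCast, pow_mul]; gcongr
  calc ((768 * (k:ℝ))^k)^((1/2:ℝ)^k) ≤ ((2:ℝ)^(((10+k)*k : ℕ):ℝ))^((1/2:ℝ)^k) := by gcongr
    _ = (2:ℝ)^((((10+k)*k : ℕ):ℝ) * (1/2:ℝ)^k) := by rw [← Real.rpow_mul (by norm_num)]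
    _ ≤ (2:ℝ)^(12:ℝ) := by
      apply Real.rpow_le_rpow_of_exponent_le (by norm_num)
      have := kk_ineq k
      have h3 : (((10+k)*k : ℕ):ℝ) ≤ 12 * 2^k := by exact_mod_cast this
      rw [div_pow, one_pow, mul_one_div, div_le_iff₀ (by positivity)]; exact h3
    _ = 4096 := by norm_num

set_option maxHeartbeats 1600000 in
lemma dyadic {k : ℕ} (hk : 1 ≤ k) {T : ℝ} (hT : 1 ≤ T) (hTk : 4 * ((k+1:ℕ):ℝ)^2 ≤ T^(1/(k:ℝ))) {M : ℕ}
    (hM : T^(2/((k+1:ℕ):ℝ)) ≤ M) {L : ℕ} (hL : L ≤ M) {x : ℝ} (hx0 : 0 ≤ x) (hx1 : x ≤ 1) (ε : ℝ) (hε : ε = 1 ∨ ε = -1) :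
    ‖∑ n ∈ Finset.range L, ee (ε * (T/(2*Real.pi)) * Real.log (n+(M+x)))‖ ≤
      40960 * M * T^(-((1/2:ℝ)^(k+1)/k)) := by
  have hT0 : 0 < T := by linarith
  have hk0 : (0:ℝ) < k := by exact_mod_cast hk
  have hk1 : (1:ℝ) ≤ k := by exact_mod_cast hk
  set K : ℝ := ((k+1:ℕ):ℝ) with hK
  have hKk : K = k + 1 := by rw [hK]; push_cast; ring
  have hK2 : 2 ≤ K := by linarith
  have hM0 : (0:ℝ) < M := lt_of_lt_of_le (by positivity) hM
  set ρ : ℝ := min 1 ((M/T)^(1/(k:ℝ))) with hρ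
  have hρ0 : 0 < ρ := lt_min one_pos (by positivity)
  have hρ1 : ρ ≤ 1 := min_le_left _ _
  have hρk : ρ^k ≤ M/T := by
    calc ρ^k ≤ ((M/T)^(1/(k:ℝ)))^k := by gcongr; exact min_le_right _ _
      _ = M/T := by
        rw [← Real.rpow_natCast, ← Real.rpow_mul (by positivity), one_div, inv_mul_cancel₀ hk0.ne', Real.rpow_one]
  -- exponent facts
  have hexp : 1/(k:ℝ) ≤ 2/K := by rw [div_le_div_iff₀ hk0 (by linarith)]; linarith
  have hMT : T^(1/(k:ℝ)) ≤ M := (Real.rpow_le_rpow_of_exponent_le hT hexp).trans hM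
  have hMT' : (T^(2/K - 1)) ≤ M/T := by
    rw [Real.rpow_sub hT0, Real.rpow_one]; gcongr
  have hρT : T^((2/K-1)*(1/(k:ℝ))) ≤ (M/T)^(1/(k:ℝ)) := by
    rw [Real.rpow_mul hT0.le]; gcongr
  have hF2 : T^(1/(k:ℝ)) ≤ T * ρ^(k+1) := by
    rcases min_choice 1 ((M/T)^(1/(k:ℝ))) with h | h
    · rw [hρ, h, one_pow, mul_one]
      calc T^(1/(k:ℝ)) ≤ T^(1:ℝ) := Real.rpow_le_rpow_of_exponent_le hT (by rw [div_le_one hk0]; exact hk1)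
        _ = T := Real.rpow_one _
    · rw [hρ, h]
      calc T^(1/(k:ℝ)) = T * (T^((2/K-1)*(1/(k:ℝ))))^(k+1) := by
            rw [← Real.rpow_natCast, ← Real.rpow_mul hT0.le]
            nth_rewrite 2 [← Real.rpow_one T]
            rw [← Real.rpow_add hT0]
            congr 1
            rw [← hK, hKk]; field_simp; ring
        _ ≤ _ := by gcongr
  have hF3 : T^(1/(k:ℝ)) ≤ M * ρ := by
    rcases min_choice 1 ((M/T)^(1/(k:ℝ))) with h | h
    · rw [hρ, h, mul_one]; exact hMT
    · rw [hρ, h]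
      calc T^(1/(k:ℝ)) = T^(2/K) * T^((2/K-1)*(1/(k:ℝ))) := by
            rw [← Real.rpow_add hT0]
            congr 1
            rw [hKk]; field_simp; ring
        _ ≤ _ := by gcongr
  set H : ℕ := ⌊M * ρ / (8*K)⌋₊ with hH
  have hr1 : 1 ≤ M * ρ / (8*K) := by
    rw [le_div_iff₀ (by positivity)]; nlinarith
  have hH1 : 1 ≤ H := Nat.one_le_floor_iff _ |>.mpr hr1
  have hHle : (H:ℝ) ≤ M * ρ / (8*K) := Nat.floor_le (by positivity)
  have hHge : M * ρ / (16*K) ≤ H := by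
    have h1 := Nat.lt_floor_add_one (M * ρ / (8*K))
    have h2 : (1:ℝ) ≤ H := by exact_mod_cast hH1
    have e : M * ρ / (16*K) = (M * ρ / (8*K))/2 := by field_simp; norm_num
    rw [e]; linarith
  have hHM : (H:ℝ) ≤ M / (8*K) := hHle.trans (by gcongr; nlinarith)
  have hHM' : (H:ℝ) ≤ M := hHM.trans (by rw [div_le_iff₀ (by positivity)]; nlinarith)
  set A := T/(2*Real.pi) with hA
  have hA0 : 0 < A := by positivity
  have hAT : 4 * A ≤ T := by
    rw [hA]; have := Real.pi_gt_three
    rw [← mul_div_assoc, div_le_iff₀ (by positivity)]; nlinarith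
  have hAT2 : T/8 ≤ A := by
    rw [hA]; have := Real.pi_lt_four
    gcongr; linarith
  set κ : ℝ := (1/2:ℝ)^(k+1) with hκ
  have hκ0 : 0 < κ := by positivity
  set B := 20480 * H * T^(-(κ/k)) with hB
  have hblock : ∀ i, i ≤ M → ∀ N ≤ H, ‖∑ n ∈ Finset.range N, ee (ε * A * Real.log (((i+n:ℕ):ℝ)+(M+x)))‖ ≤ B := by
    intro i hi N hN
    have hi' : (i:ℝ) ≤ M := by exact_mod_cast hi
    have hi0 : (0:ℝ) ≤ i := by positivity
    have hM1 : (1:ℝ) ≤ M := by nlinarith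
    set X : ℝ := M + x + i with hX
    have hMX : (M:ℝ) ≤ X := by rw [hX]; linarith
    have hX3 : X ≤ 3 * M := by rw [hX]; linarith
    have hX0 : 0 < X := by linarith
    have hv := vdc_block k hA0 hX0 hN hH1 ?_ ?_ ε hε
    · have e : ∀ n : ℕ, ((i+n:ℕ):ℝ)+(M+x) = n + X := by intro n; rw [hX]; push_cast; ring
      simp only [e]
      refine hv.trans ?_
      have hbase : T^(1/(k:ℝ)) / (768*K)^(k+1) ≤ A * k.factorial / (2 * X^(k+1)) * (H:ℝ)^(k+1) := by
        have hf : (1:ℝ) ≤ k.factorial := by exact_mod_cast Nat.one_le_iff_ne_zero.mpr (Nat.factorial_ne_zero k)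
        have h16 : (16:ℝ) ≤ 16^(k+1) := by
          calc (16:ℝ) = 16^1 := by norm_num
            _ ≤ 16^(k+1) := pow_le_pow_right₀ (by norm_num) (by omega)
        calc T^(1/(k:ℝ)) / (768*K)^(k+1) ≤ (T * ρ^(k+1)) / (16^(k+1) * (48*K)^(k+1)) := by
              rw [← mul_pow]
              have : (16 * (48*K)) = 768*K := by ring
              rw [this]; gcongr
          _ ≤ (T * ρ^(k+1)) / (16 * (48*K)^(k+1)) := by gcongr
          _ = (T/8 * 1) / (2 * (3*M)^(k+1)) * (M * ρ / (16*K))^(k+1) := by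
              rw [div_pow, mul_pow (M:ℝ), mul_pow (3:ℝ)]
              have : (48*K)^(k+1) = 3^(k+1) * (16*K)^(k+1) := by rw [← mul_pow]; congr 1; ring
              rw [this]; field_simp; norm_num
          _ ≤ _ := by gcongr
      calc 5 * (H:ℝ) * (A * k.factorial / (2 * X^(k+1)) * (H:ℝ)^(k+1))^(-κ)
          ≤ 5 * H * (T^(1/(k:ℝ)) / (768*K)^(k+1))^(-κ) := by
            refine mul_le_mul_of_nonneg_left ?_ (by positivity)
            exact Real.rpow_le_rpow_of_nonpos (by positivity) hbase (by linarith)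
        _ = 5 * H * (T^(-(κ/k)) * ((768*K)^(k+1))^κ) := by
            rw [Real.div_rpow (by positivity) (by positivity), ← Real.rpow_mul hT0.le, Real.rpow_neg (x := (768*K)^(k+1)) (by positivity)]
            rw [div_inv_eq_mul]
            congr 3
            field_simp
        _ ≤ 5 * H * (T^(-(κ/k)) * 4096) := by
            have := const_bd (k+1)
            rw [← hK, ← hκ] at this
            gcongr
        _ = B := by rw [hB]; ring
    · have h1 : K ≤ M/(4*K) := by
        rw [le_div_iff₀ (by positivity)]; nlinarith
      have h2 : M / (8*K) + M/(4*K) ≤ X / (2*K) := by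
        have : M / (8*K) + M/(4*K) = (3/4*M) / (2*K) := by field_simp; norm_num
        rw [this]; gcongr; linarith
      rw [← hK]; linarith
    · have hf : (k.factorial:ℝ) ≤ (k:ℝ)^k := by exact_mod_cast Nat.factorial_le_pow k
      calc 4 * A * k.factorial * (H:ℝ)^k ≤ T * (k:ℝ)^k * (M * ρ / (8*K))^k := by gcongr
        _ = T * ρ^k * M^k * ((k:ℝ)/(8*K))^k := by rw [div_pow, div_pow, mul_pow]; ring
        _ ≤ T * (M/T) * M^k * 1 := by
            gcongr
            refine pow_le_one₀ (by positivity) ?_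
            rw [div_le_one (by positivity)]; linarith
        _ = M^(k+1) := by field_simp; ring
        _ ≤ X^(k+1) := by gcongr
  have hB0 : 0 ≤ B := by positivity
  have hfin := block_sum (fun n => ee (ε * A * Real.log ((n:ℝ)+(M+x)))) hH1 hB0 M hblock L hL
  refine hfin.trans ?_
  have hL' : (L:ℝ) ≤ M := by exact_mod_cast hL
  have hH0 : (0:ℝ) < H := by exact_mod_cast hH1
  calc ((L:ℝ)/H+1) * B = (L + H) * (20480 * T^(-(κ/k))) := by rw [hB]; field_simp
    _ ≤ (M + M) * (20480 * T^(-(κ/k))) := by gcongr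
    _ = _ := by ring
end

section
open Complex Metric Set Filter Topology

lemma abel_aux (w : ℕ → ℝ) (u : ℕ → ℂ) (hw : ∀ n, w (n+1) ≤ w n) {N : ℕ} {B : ℝ}
    (hB : ∀ L ≤ N, ‖∑ n ∈ Finset.range L, u n‖ ≤ B) : ∀ n ≤ N,
    ‖∑ m ∈ Finset.range n, (w m:ℂ) * u m - w n * ∑ m ∈ Finset.range n, u m‖ ≤ (w 0 - w n) * B := by
  intro n
  induction n with
  | zero => intro _; simp
  | succ n ih =>
    intro hn
    have h1 := ih (by omega)
    have h2 := hB (n+1) hn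
    have e : ∑ m ∈ Finset.range (n+1), (w m:ℂ) * u m - w (n+1) * ∑ m ∈ Finset.range (n+1), u m
        = (∑ m ∈ Finset.range n, (w m:ℂ) * u m - w n * ∑ m ∈ Finset.range n, u m) +
          ((w n - w (n+1) : ℝ):ℂ) * ∑ m ∈ Finset.range (n+1), u m := by
      rw [Finset.sum_range_succ, Finset.sum_range_succ u]; push_cast; ring
    rw [e]
    refine (norm_add_le _ _).trans ?_
    rw [norm_mul, norm_real, Real.norm_eq_abs, abs_of_nonneg (by linarith [hw n])]
    have : (w n - w (n+1)) * ‖∑ m ∈ Finset.range (n+1), u m‖ ≤ (w n - w (n+1)) * B :=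
      mul_le_mul_of_nonneg_left h2 (by linarith [hw n])
    linarith

lemma abel_ineq (w : ℕ → ℝ) (u : ℕ → ℂ) (hw : ∀ n, w (n+1) ≤ w n) (hw0 : ∀ n, 0 ≤ w n) {N : ℕ} {B : ℝ}
    (hB : ∀ L ≤ N, ‖∑ n ∈ Finset.range L, u n‖ ≤ B) :
    ‖∑ m ∈ Finset.range N, (w m:ℂ) * u m‖ ≤ w 0 * B := by
  have h1 := abel_aux w u hw hB N le_rfl
  have h2 : ‖(w N:ℂ) * ∑ m ∈ Finset.range N, u m‖ ≤ w N * B := by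
    rw [norm_mul, norm_real, Real.norm_eq_abs, abs_of_nonneg (hw0 N)]
    exact mul_le_mul_of_nonneg_left (hB N le_rfl) (hw0 N)
  have h3 := norm_sub_norm_le (∑ m ∈ Finset.range N, (w m:ℂ) * u m) (w N * ∑ m ∈ Finset.range N, u m)
  linarith

lemma psum_split {q : ℕ} (χ : DirichletCharacter ℂ q) (M L : ℕ) (s : ℂ) :
    psum χ ((M+L)*q) s = psum χ (M*q) s + ∑ a ∈ Finset.range q, χ ((a+1:ℕ):ZMod q) *
      ∑ m ∈ Finset.range L, (((M+m)*q+a+1:ℕ):ℂ)^(-s) := by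
  induction L with
  | zero => simp
  | succ L ih =>
    have : (M+(L+1))*q = (M+L)*q + q := by ring
    rw [this]
    have e : psum χ ((M+L)*q+q) s = psum χ ((M+L)*q) s + ∑ a ∈ Finset.range q, χ ((a+1:ℕ):ZMod q) * (((M+L)*q+a+1:ℕ):ℂ)^(-s) := by
      unfold psum
      rw [Finset.sum_range_add]
      congr 1
      refine Finset.sum_congr rfl fun a _ => ?_
      rw [add_assoc, chi_period]
    rw [e, ih, add_assoc, ← Finset.sum_add_distrib]
    congr 1
    refine Finset.sum_congr rfl fun a _ => ?_
    rw [Finset.sum_range_succ]; ring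

lemma inner_eq {q : ℕ} (hq : 0 < q) (M m a : ℕ) {s : ℂ} {ε : ℝ} (hε : -s.im = ε * |s.im|) (hM : 0 < M) :
    (((M+m)*q+a+1:ℕ):ℂ)^(-s) = (q:ℂ)^(-s) * (((((m:ℝ)+(M+(a+1:ℝ)/q))^(-s.re):ℝ):ℂ) *
      ee (ε * (|s.im|/(2*Real.pi)) * Real.log ((m:ℝ)+(M+(a+1:ℝ)/q)))) := by
  set y : ℝ := (m:ℝ)+(M+(a+1:ℝ)/q) with hy
  have hM' : (0:ℝ) < M := by exact_mod_cast hM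
  have hq' : (0:ℝ) < q := by exact_mod_cast hq
  have hy0 : 0 < y := by rw [hy]; positivity
  have e1 : (((M+m)*q+a+1:ℕ):ℂ) = ((q:ℝ):ℂ) * (y:ℂ) := by
    rw [← ofReal_mul]
    have : (((M+m)*q+a+1:ℕ):ℝ) = q * y := by rw [hy]; push_cast; field_simp; ring
    rw [← this]; norm_cast
  rw [e1, mul_cpow_ofReal_nonneg hq'.le hy0.le]
  congr 1
  have hy' : (y:ℂ) ≠ 0 := by exact_mod_cast hy0.ne'
  rw [ofReal_cpow hy0.le, cpow_def_of_ne_zero hy', cpow_def_of_ne_zero hy', ee, ← Complex.exp_add]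
  congr 1
  rw [← ofReal_log hy0.le]
  have : (2*Real.pi*(ε * (|s.im|/(2*Real.pi)) * Real.log y)) = -s.im * Real.log y := by
    rw [hε]; field_simp
  rw [this]
  apply Complex.ext <;> simp <;> ring

lemma block_le {q : ℕ} (hq : 0 < q) (χ : DirichletCharacter ℂ q) {k : ℕ} (hk : 1 ≤ k) {s : ℂ} (hT : 1 ≤ |s.im|) (hs : 0 ≤ s.re)
    (hTk : 4 * ((k+1:ℕ):ℝ)^2 ≤ |s.im|^(1/(k:ℝ))) {M : ℕ} (hM : |s.im|^(2/((k+1:ℕ):ℝ)) ≤ M) :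
    ‖psum χ ((M+M)*q) s - psum χ (M*q) s‖ ≤ 40960 * ((q:ℝ)*M)^(1-s.re) * |s.im|^(-((1/2:ℝ)^(k+1)/k)) := by
  have hM0' : (0:ℝ) < M := lt_of_lt_of_le (by positivity) hM
  have hM0 : 0 < M := by exact_mod_cast hM0'
  have hq' : (0:ℝ) < q := by exact_mod_cast hq
  obtain ⟨ε, hε1, hε⟩ : ∃ ε : ℝ, (ε = 1 ∨ ε = -1) ∧ -s.im = ε * |s.im| := by
    rcases abs_choice s.im with h | h
    · exact ⟨-1, Or.inr rfl, by rw [h]; ring⟩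
    · exact ⟨1, Or.inl rfl, by rw [h]; ring⟩
  rw [psum_split, add_sub_cancel_left]
  set P := |s.im|^(-((1/2:ℝ)^(k+1)/k)) with hP
  have hP0 : 0 < P := by positivity
  have hin : ∀ a ∈ Finset.range q, ‖χ ((a+1:ℕ):ZMod q) * ∑ m ∈ Finset.range M, (((M+m)*q+a+1:ℕ):ℂ)^(-s)‖ ≤
      (q:ℝ)^(-s.re) * ((M:ℝ)^(-s.re) * (40960 * M * P)) := by
    intro a ha
    have ha' : (a+1:ℝ) ≤ q := by exact_mod_cast Finset.mem_range.mp ha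
    rw [norm_mul]
    refine (mul_le_mul_of_nonneg_right (norm_chi_le χ _) (norm_nonneg _)).trans ?_
    rw [one_mul]
    simp_rw [inner_eq hq M _ a hε hM0]
    rw [← Finset.mul_sum, norm_mul, norm_natCast_cpow_of_pos hq, neg_re]
    refine mul_le_mul_of_nonneg_left ?_ (by positivity)
    refine (abel_ineq (fun m => ((m:ℝ)+(M+(a+1:ℝ)/q))^(-s.re)) (fun m => ee (ε * (|s.im|/(2*Real.pi)) * Real.log ((m:ℝ)+(M+(a+1:ℝ)/q))))
       ?_ (fun n => by positivity) (fun L hL => dyadic hk hT hTk hM hL (by positivity) ?_ ε hε1)).trans ?_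
    · intro n
      refine Real.rpow_le_rpow_of_nonpos (by positivity) ?_ (by linarith)
      push_cast; linarith
    · rw [div_le_one hq']; exact ha'
    · refine mul_le_mul_of_nonneg_right ?_ (by positivity)
      refine Real.rpow_le_rpow_of_nonpos (by positivity) ?_ (by linarith)
      have : 0 ≤ (a+1:ℝ)/q := by positivity
      push_cast; linarith
  refine (norm_sum_le_of_le _ hin).trans (le_of_eq ?_)
  rw [Finset.sum_const, Finset.card_range, nsmul_eq_mul, Real.mul_rpow hq'.le hM0'.le]
  rw [show 1 - s.re = 1 + -s.re by ring, Real.rpow_add hq', Real.rpow_add hM0', Real.rpow_one, Real.rpow_one]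
  ring
end

section
open Complex Metric Set Filter Topology

lemma psum_first {q : ℕ} (χ : DirichletCharacter ℂ q) {N : ℕ} (hN : 1 ≤ N) {s : ℂ} {η : ℝ} (hη : 0 ≤ η) (hs : 1 - η ≤ s.re) :
    ‖psum χ N s‖ ≤ (N:ℝ)^η * (1 + Real.log N) := by
  unfold psum
  have : ∀ n ∈ Finset.range N, ‖χ ((n+1:ℕ) : ZMod q) * ((n+1:ℕ):ℂ)^(-s)‖ ≤ (N:ℝ)^η * ((n+1:ℕ):ℝ)⁻¹ := by
    intro n hn
    rw [norm_mul, norm_natCast_cpow_of_pos (by omega), neg_re]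
    refine (mul_le_mul_of_nonneg_right (norm_chi_le χ _) (by positivity)).trans ?_
    rw [one_mul]
    have h1 : (1:ℝ) ≤ ((n+1:ℕ):ℝ) := by push_cast; linarith [(Nat.cast_nonneg n : (0:ℝ) ≤ n)]
    have h2 : ((n+1:ℕ):ℝ) ≤ N := by exact_mod_cast Finset.mem_range.mp hn
    calc ((n+1:ℕ):ℝ)^(-s.re) ≤ ((n+1:ℕ):ℝ)^(η + -1) := Real.rpow_le_rpow_of_exponent_le h1 (by linarith)
      _ = ((n+1:ℕ):ℝ)^η * ((n+1:ℕ):ℝ)⁻¹ := by rw [Real.rpow_add (by linarith), Real.rpow_neg_one]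
      _ ≤ _ := by gcongr
  refine (norm_sum_le_of_le _ this).trans ?_
  rw [← Finset.mul_sum]
  refine mul_le_mul_of_nonneg_left ?_ (by positivity)
  have := harmonic_le_one_add_log N
  rw [harmonic] at this
  push_cast at this ⊢
  exact this

lemma psum_blocks {q : ℕ} (χ : DirichletCharacter ℂ q) (M : ℕ) (s : ℂ) (B : ℝ) : ∀ J : ℕ, 
    (∀ j < J, ‖psum χ ((2^j*M+2^j*M)*q) s - psum χ (2^j*M*q) s‖ ≤ B) →
    ‖psum χ (2^J*M*q) s‖ ≤ ‖psum χ (M*q) s‖ + J * B := by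
  intro J
  induction J with
  | zero => intro _; simp
  | succ J ih =>
    intro h
    have h1 := ih fun j hj => h j (by omega)
    have h2 := h J (by omega)
    have e : 2^(J+1)*M*q = (2^J*M+2^J*M)*q := by ring
    rw [e]
    have h3 := norm_sub_norm_le (psum χ ((2^J*M+2^J*M)*q) s) (psum χ (2^J*M*q) s)
    push_cast
    linarith

set_option maxHeartbeats 1000000 in
lemma L_large {q : ℕ} [NeZero q] (χ : DirichletCharacter ℂ q) {k : ℕ} (hk : 1 ≤ k) {s : ℂ} (hT : 1 ≤ |s.im|)
    (hTk : 4 * ((k+1:ℕ):ℝ)^2 ≤ |s.im|^(1/(k:ℝ))) (hqT : (q:ℝ) ≤ |s.im|) {η : ℝ} (hη : 0 ≤ η)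
    (hηk : η ≤ (1/2:ℝ)^(k+1)/k/3) (hs : 1 - η ≤ s.re) (hs2 : s.re ≤ 2) :
    ‖χ.LFunction s‖ ≤ 1000000 * (1 + Real.log |s.im|) * ((q:ℝ)^η * |s.im|^(2*η/((k+1:ℕ):ℝ))) := by
  set T := |s.im| with hTdef
  have hq : 0 < q := Nat.pos_of_ne_zero (NeZero.ne q)
  have hq' : (1:ℝ) ≤ q := by exact_mod_cast hq
  have hT0 : 0 < T := by linarith
  have hk1 : (1:ℝ) ≤ k := by exact_mod_cast hk
  set K : ℝ := ((k+1:ℕ):ℝ) with hK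
  have hK2 : 2 ≤ K := by rw [hK]; push_cast; linarith
  have hη12 : η ≤ 1/12 := by
    refine hηk.trans ?_
    have : (1/2:ℝ)^(k+1) ≤ (1/2)^2 := pow_le_pow_of_le_one (by norm_num) (by norm_num) (by omega)
    rw [div_div, div_le_iff₀ (by positivity)]; nlinarith only [this, hk1]
  have hσ0 : 0 < s.re := by linarith
  set κ0 := (1/2:ℝ)^(k+1)/k with hκ0
  -- choice of the starting point
  obtain ⟨M, hM⟩ : ∃ M : ℕ, M = ⌈T^(2/K)⌉₊ := ⟨_, rfl⟩
  have hTK1 : 1 ≤ T^(2/K) := Real.one_le_rpow hT (by positivity)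
  have hMge : T^(2/K) ≤ M := by rw [hM]; exact Nat.le_ceil _
  have hMle : (M:ℝ) ≤ 2 * T^(2/K) := by
    have := Nat.ceil_lt_add_one (show 0 ≤ T^(2/K) by positivity)
    rw [hM]; linarith
  have hM1 : (1:ℝ) ≤ M := hTK1.trans hMge
  have hTKT : T^(2/K) ≤ T := by
    calc T^(2/K) ≤ T^(1:ℝ) := Real.rpow_le_rpow_of_exponent_le hT (by rw [div_le_one (by linarith)]; exact hK2)
      _ = T := Real.rpow_one T
  have hlogT : 0 ≤ Real.log T := Real.log_nonneg hT
  have hl2 := Real.log_two_gt_d9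
  have hl2' := Real.log_two_lt_d9
  obtain ⟨J, hJ⟩ : ∃ J : ℕ, J = ⌈2 * Real.log T / Real.log 2⌉₊ := ⟨_, rfl⟩
  have hJge : 2 * Real.log T / Real.log 2 ≤ J := by rw [hJ]; exact Nat.le_ceil _
  have hJle : (J:ℝ) ≤ 2 * Real.log T / Real.log 2 + 1 := by
    rw [hJ]; exact (Nat.ceil_lt_add_one (by positivity)).le
  have hJge' : T^2 ≤ (2:ℝ)^J := by
    rw [← Real.log_le_log_iff (by positivity) (by positivity), Real.log_pow, Real.log_pow]
    rw [div_le_iff₀ (by linarith)] at hJge; exact_mod_cast hJge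
  have hJle' : (2:ℝ)^J ≤ 2 * T^2 := by
    rw [← Real.log_le_log_iff (by positivity) (by positivity), Real.log_pow, Real.log_mul (by norm_num) (by positivity), Real.log_pow]
    have : (J:ℝ) * Real.log 2 ≤ (2 * Real.log T / Real.log 2 + 1) * Real.log 2 := by gcongr
    rw [add_mul, div_mul_cancel₀ _ (by linarith)] at this
    push_cast; linarith
  have hJ3 : (J:ℝ) ≤ 3 * Real.log T + 1 := by
    refine hJle.trans ?_
    gcongr
    rw [div_le_iff₀ (by linarith)]; nlinarith only [hl2, hlogT]
  set Q := (q:ℝ)^η with hQ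
  have hQ1 : 1 ≤ Q := Real.one_le_rpow hq' hη
  set Y := T^(2*η/K) with hY
  have hY1 : 1 ≤ Y := Real.one_le_rpow hT (by positivity)
  have hqM1 : (1:ℝ) ≤ M*q := by nlinarith only [hM1, hq']
  -- first part
  have hA : ‖psum χ (M*q) s‖ ≤ 2 * (Q * Y) * (2 + 2 * Real.log T) := by
    have h1 := psum_first χ (N := M*q) (by exact_mod_cast hqM1) hη hs
    refine h1.trans ?_
    push_cast
    have h2 : ((M:ℝ)*q)^η ≤ 2 * (Q*Y) := by
      rw [Real.mul_rpow (by positivity) (by positivity)]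
      have : (M:ℝ)^η ≤ 2 * Y := by
        calc (M:ℝ)^η ≤ (2 * T^(2/K))^η := by gcongr
          _ = 2^η * Y := by
            rw [Real.mul_rpow (by norm_num) (by positivity), ← Real.rpow_mul hT0.le]; congr 2; ring
          _ ≤ 2^(1:ℝ) * Y := by gcongr <;> linarith
          _ = 2 * Y := by rw [Real.rpow_one]
      nlinarith only [this, hQ1]
    have h3 : Real.log (M*q) ≤ 1 + 2 * Real.log T := by
      calc Real.log (M*q) ≤ Real.log (2 * T * T) := by
            gcongr; exact hMle.trans (by gcongr)
        _ = Real.log 2 + 2 * Real.log T := by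
            rw [Real.log_mul (by positivity) (by positivity), Real.log_mul (by norm_num) (by positivity)]; ring
        _ ≤ _ := by linarith
    have h4 : 0 ≤ Real.log (M*q) := Real.log_nonneg hqM1
    calc _ ≤ 2 * (Q*Y) * (1 + Real.log (M*q)) := by gcongr
      _ ≤ _ := by exact mul_le_mul_of_nonneg_left (by linarith) (by positivity)
  -- sizes
  have hsize : ∀ N : ℕ, (1:ℝ) ≤ N → (N:ℝ) ≤ 4 * T^3 → ((q:ℝ)*N)^(1-s.re) ≤ 4 * Q * T^(3*η) := by
    intro N hN hN4
    have : (1:ℝ) ≤ q * N := by nlinarith only [hN, hq']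
    calc ((q:ℝ)*N)^(1-s.re) ≤ ((q:ℝ)*N)^η := Real.rpow_le_rpow_of_exponent_le this (by linarith)
      _ ≤ (q * (4 * T^3))^η := by gcongr
      _ = Q * (4^η * T^(3*η)) := by
          rw [Real.mul_rpow (by positivity) (by positivity), Real.mul_rpow (by positivity) (by positivity)]
          rw [← Real.rpow_natCast, ← Real.rpow_mul hT0.le]; norm_cast
      _ ≤ Q * (4^(1:ℝ) * T^(3*η)) := by gcongr <;> linarith
      _ = _ := by rw [Real.rpow_one]; ring
  have hMJ : ∀ j ≤ J, (((2^j*M:ℕ)):ℝ) ≤ 4 * T^3 := by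
    intro j hj
    push_cast
    calc (2:ℝ)^j * M ≤ 2^J * (2*T) := by
          gcongr
          · norm_num
          · exact hMle.trans (by gcongr)
      _ ≤ (2 * T^2) * (2*T) := by gcongr
      _ = _ := by ring
  have hMj1 : ∀ j : ℕ, (M:ℝ) ≤ ((2^j*M:ℕ):ℝ) := by
    intro j
    push_cast
    have : (1:ℝ) ≤ 2^j := one_le_pow₀ (by norm_num)
    nlinarith only [this, hM1]
  have hB : ‖psum χ (2^J*M*q) s‖ ≤ ‖psum χ (M*q) s‖ + J * (163840 * Q) := by
    refine psum_blocks χ M s _ J fun j hj => ?_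
    refine (block_le hq χ hk hT hσ0.le hTk (M := 2^j*M) (hMge.trans (hMj1 j))).trans ?_
    calc 40960 * ((q:ℝ)*((2^j*M:ℕ):ℝ))^(1-s.re) * T^(-κ0) ≤ 40960 * (4 * Q * T^(3*η)) * T^(-κ0) := by
          have := hsize (2^j*M) (hM1.trans (hMj1 j)) (hMJ j hj.le)
          gcongr
      _ = 163840 * Q * (T^(3*η + -κ0)) := by rw [Real.rpow_add hT0]; ring
      _ ≤ 163840 * Q * 1 := by
          gcongr
          exact Real.rpow_le_one_of_one_le_of_nonpos hT (by linarith)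
      _ = _ := by ring
  -- the tail
  have hMJ0 : 0 < 2^J*M := by
    have : 0 < M := by exact_mod_cast (show (0:ℝ) < M by linarith)
    positivity
  have hform := L1_formula χ hMJ0 hσ0
  have hs1n : T ≤ ‖s-1‖ := by
    have := abs_im_le_norm (s-1); simpa using this
  have hsn : ‖s‖ ≤ 3 * T := by
    have := norm_le_abs_re_add_abs_im s
    rw [abs_of_pos hσ0] at this; linarith
  have hs1 : s - 1 ≠ 0 := by intro h; rw [h, norm_zero] at hs1n; linarith
  rw [L1_eq χ (sub_ne_zero.mp hs1)] at hform
  have hn0 : 0 < ‖s-1‖ := norm_pos_iff.mpr hs1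
  have hbt := blk_tsum_le hq χ hMJ0 hσ0 (by linarith)
  have hT14 : T^(3*η) ≤ T := by
    calc T^(3*η) ≤ T^(1:ℝ) := Real.rpow_le_rpow_of_exponent_le hT (by linarith)
      _ = T := Real.rpow_one T
  have hav : ‖avgc χ * ((2^J*M*q:ℕ):ℂ)^(1-s)‖ ≤ ‖s-1‖ * (4 * Q) := by
    rw [norm_mul, norm_natCast_cpow_of_pos (by positivity)]
    have := hsize (2^J*M) (hM1.trans (hMj1 J)) (hMJ J le_rfl)
    rw [sub_re, one_re]
    have e : ((2^J*M*q:ℕ):ℝ) = (q:ℝ) * ((2^J*M:ℕ):ℝ) := by push_cast; ring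
    rw [e]
    calc _ ≤ 1 * (4 * Q * T^(3*η)) := by
            have := avgc_le χ
            gcongr
      _ ≤ 4 * Q * T := by rw [one_mul]; gcongr
      _ ≤ _ := by nlinarith only [hs1n, hQ1]
  have htl : ‖∑' j, blk χ (2^J*M+j) s‖ ≤ ‖s-1‖ * (96 * Q) := by
    refine hbt.trans ?_
    have h1 : (q:ℝ)^(1-s.re) ≤ Q := Real.rpow_le_rpow_of_exponent_le hq' (by linarith)
    have h2 : ((2^J*M:ℕ):ℝ)^(-s.re) ≤ T^(-1:ℝ) := by
      calc ((2^J*M:ℕ):ℝ)^(-s.re) ≤ (T^(2:ℝ))^(-s.re) := by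
            refine Real.rpow_le_rpow_of_nonpos (by positivity) ?_ (by linarith)
            push_cast
            rw [Real.rpow_two]; nlinarith only [hJge', hM1, hT0]
        _ = T^(2 * -s.re) := by rw [← Real.rpow_mul hT0.le]
        _ ≤ _ := Real.rpow_le_rpow_of_exponent_le hT (by linarith)
    have h3 : 16 / s.re ≤ 32 := by rw [div_le_iff₀ hσ0]; linarith
    calc _ ≤ 32 * ‖s-1‖ * (3*T) * Q * T^(-1:ℝ) := by gcongr
      _ = _ := by rw [Real.rpow_neg_one]; field_simp; norm_num
  have hmain : ‖s-1‖ * ‖χ.LFunction s‖ ≤ ‖s-1‖ * (‖psum χ (2^J*M*q) s‖ + 4*Q + 96*Q) := by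
    rw [← norm_mul, hform]
    refine (norm_add₃_le).trans ?_
    rw [norm_mul]
    linarith
  have hmain' := le_of_mul_le_mul_left hmain hn0
  have hQY : Q ≤ Q * Y := by nlinarith only [hQ1, hY1]
  have hJ4 : (J:ℝ) * (163840 * Q) ≤ (3 * Real.log T + 1) * (163840 * (Q*Y)) := by gcongr
  have : 0 ≤ Real.log T * (Q*Y) := by positivity
  nlinarith only [this, hJ4, hQY, hmain', hA, hB, hQ1]
end

section
open Complex Metric Set Filter Topology

noncomputable def gk (k : ℕ) (σ : ℝ) (n : ℕ) : ℝ := ArithmeticFunction.vonMangoldt n * (Real.log n)^k * (n:ℝ)^(-σ)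
noncomputable def zz {q : ℕ} (χ : DirichletCharacter ℂ q) (t : ℝ) (n : ℕ) : ℂ := χ (n : ZMod q) * (n:ℂ)^(-(t*I))
noncomputable def VV {q : ℕ} [NeZero q] (χ : DirichletCharacter ℂ q) (k : ℕ) (s : ℂ) : ℂ :=
  (-1)^(k+1) * iteratedDeriv k (logDeriv χ.LFunction) s

lemma gk_nonneg (k : ℕ) (σ : ℝ) (n : ℕ) : 0 ≤ gk k σ n := by
  unfold gk
  have h1 : 0 ≤ ArithmeticFunction.vonMangoldt n := ArithmeticFunction.vonMangoldt_nonneg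
  have h2 : 0 ≤ Real.log n := Real.log_natCast_nonneg n
  positivity

lemma logMul_iter (f : ℕ → ℂ) (k n : ℕ) : LSeries.logMul^[k] f n = (Real.log n:ℂ)^k * f n := by
  induction k with
  | zero => simp
  | succ k ih =>
    rw [Function.iterate_succ', Function.comp_apply, LSeries.logMul, ih, natCast_log]; ring

lemma abscissa_le {q : ℕ} (χ : DirichletCharacter ℂ q) {s : ℂ} (hs : 1 < s.re) :
    LSeries.abscissaOfAbsConv ((fun n : ℕ => χ n) * (fun n : ℕ => (ArithmeticFunction.vonMangoldt n : ℂ))) < s.re := by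
  refine lt_of_le_of_lt (LSeries.abscissaOfAbsConv_le_of_forall_lt_LSeriesSummable (x := 1) fun y hy => 
    DirichletCharacter.LSeriesSummable_twist_vonMangoldt χ (by simpa using hy)) ?_
  exact_mod_cast hs

lemma VV_eq {q : ℕ} [NeZero q] (χ : DirichletCharacter ℂ q) (k : ℕ) {s : ℂ} (hs : 1 < s.re) :
    VV χ k s = LSeries (LSeries.logMul^[k] ((fun n : ℕ => χ n) * (fun n : ℕ => (ArithmeticFunction.vonMangoldt n : ℂ)))) s := by
  have h1 := LSeries_iteratedDeriv k (abscissa_le χ hs)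
  have h2 : logDeriv χ.LFunction =ᶠ[𝓝 s] fun z => - LSeries ((fun n : ℕ => χ n) * (fun n : ℕ => (ArithmeticFunction.vonMangoldt n : ℂ))) z := by
    have : {z : ℂ | 1 < z.re} ∈ 𝓝 s := (isOpen_lt continuous_const continuous_re).mem_nhds hs
    filter_upwards [this] with z hz
    rw [DirichletCharacter.LSeries_twist_vonMangoldt_eq χ hz, logDeriv_apply,
      DirichletCharacter.deriv_LFunction_eq_deriv_LSeries χ hz, DirichletCharacter.LFunction_eq_LSeries χ hz]
    ring
  unfold VV
  rw [h2.iteratedDeriv_eq k, iteratedDeriv_fun_neg, h1]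
  rw [pow_succ]
  have : ((-1:ℂ)^k)*(-1)^k = 1 := by rw [← mul_pow]; norm_num
  linear_combination (LSeries (LSeries.logMul^[k] ((fun n : ℕ => χ n) * (fun n : ℕ => (ArithmeticFunction.vonMangoldt n : ℂ)))) s) * this

lemma VV_hasSum {q : ℕ} [NeZero q] (χ : DirichletCharacter ℂ q) (k : ℕ) {σ t : ℝ} (hσ : 1 < σ) :
    HasSum (fun n => gk k σ n * (zz χ t n).re) (VV χ k (σ + t*I)).re := by
  have hs : 1 < (σ + t*I : ℂ).re := by simpa using hσ
  rw [VV_eq χ k hs]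
  have hsum : LSeriesSummable (LSeries.logMul^[k] ((fun n : ℕ => χ n) * (fun n : ℕ => (ArithmeticFunction.vonMangoldt n : ℂ)))) (σ + t*I) := by
    refine LSeriesSummable_of_abscissaOfAbsConv_lt_re ?_
    rw [LSeries.absicssaOfAbsConv_logPowMul]
    exact abscissa_le χ hs
  have := (Complex.hasSum_iff _ _).mp hsum.hasSum |>.1
  refine this.congr_fun ?_ |> id
  intro n
  rcases Nat.eq_zero_or_pos n with rfl | hn
  · simp [gk]
  · rw [LSeries.term_of_ne_zero hn.ne', logMul_iter]
    have hn' : (n:ℂ) ≠ 0 := by exact_mod_cast hn.ne'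
    have e1 : ((Real.log n:ℂ)^k * (((fun n : ℕ => χ n) * (fun n : ℕ => (ArithmeticFunction.vonMangoldt n : ℂ))) n)) / (n:ℂ)^(σ+t*I)
        = ((gk k σ n:ℝ):ℂ) * zz χ t n := by
      unfold gk zz
      rw [div_eq_mul_inv, ← cpow_neg, neg_add, cpow_add _ _ hn']
      push_cast
      rw [ofReal_cpow (by positivity)]
      simp only [Pi.mul_apply]
      push_cast
      ring
    rw [e1, re_ofReal_mul]

lemma zz_norm {q : ℕ} (χ : DirichletCharacter ℂ q) (t : ℝ) {n : ℕ} (hn : n ≠ 0) (h : χ (n:ZMod q) ≠ 0) : ‖zz χ t n‖ = 1 := by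
  have hu : IsUnit (n : ZMod q) := by
    by_contra hc; exact h (χ.map_nonunit hc)
  unfold zz
  rw [norm_mul, norm_natCast_cpow_of_pos (by omega)]
  have : ‖χ (n:ZMod q)‖ = 1 := by
    obtain ⟨u, hu⟩ := hu
    rw [← hu]; exact DirichletCharacter.unit_norm_eq_one χ u
  rw [this]; simp

lemma zz_sq {q : ℕ} (χ : DirichletCharacter ℂ q) (t : ℝ) {n : ℕ} (hn : n ≠ 0) : zz (χ^2) (2*t) n = (zz χ t n)^2 := by
  unfold zz
  have hn' : (n:ℂ) ≠ 0 := by exact_mod_cast hn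
  rw [mul_pow, ← cpow_nat_mul, MulChar.pow_apply' _ (by norm_num)]
  congr 2
  push_cast; ring

lemma zz_one {q : ℕ} (χ : DirichletCharacter ℂ q) {n : ℕ} (h : χ (n:ZMod q) ≠ 0) : zz (1 : DirichletCharacter ℂ q) 0 n = 1 := by
  have hu : IsUnit (n : ZMod q) := by
    by_contra hc; exact h (χ.map_nonunit hc)
  unfold zz
  rw [MulChar.one_apply hu]; simp

lemma re341 (z : ℂ) (hz : ‖z‖ = 1) : 0 ≤ 3 + 4 * z.re + (z^2).re := by
  have : z.re^2 + z.im^2 = 1 := by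
    have := Complex.sq_norm z
    rw [hz, normSq_apply] at this; nlinarith
  rw [sq, mul_re]
  nlinarith [sq_nonneg (1+z.re)]

lemma VV341 {q : ℕ} [NeZero q] (χ : DirichletCharacter ℂ q) {σ : ℝ} (t : ℝ) (hσ : 1 < σ) :
    0 ≤ 3 * (VV (1:DirichletCharacter ℂ q) 0 (σ + (0:ℝ)*I)).re + 4 * (VV χ 0 (σ + t*I)).re + (VV (χ^2) 0 (σ + (2*t:ℝ)*I)).re := by
  have h := (((VV_hasSum (1:DirichletCharacter ℂ q) 0 (t := 0) hσ).mul_left 3).add ((VV_hasSum χ 0 (t := t) hσ).mul_left 4)).add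
    (VV_hasSum (χ^2) 0 (t := 2*t) hσ)
  refine h.nonneg fun n => ?_
  rcases Nat.eq_zero_or_pos n with rfl | hn
  · simp [gk]
  have hg := gk_nonneg 0 σ n
  by_cases hc : χ (n:ZMod q) = 0
  · have h1 : zz (1 : DirichletCharacter ℂ q) 0 n = 0 := by
      unfold zz
      rw [MulChar.map_nonunit, zero_mul]
      intro hu
      exact (hu.map χ).ne_zero hc
    rw [zz_sq χ t hn.ne', h1]
    have : zz χ t n = 0 := by unfold zz; rw [hc, zero_mul]
    rw [this]; simp
  · rw [zz_sq χ t hn.ne', zz_one χ hc]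
    have := re341 _ (zz_norm χ t hn.ne' hc)
    simp only [one_re]
    nlinarith

lemma VV_one_le {q : ℕ} [NeZero q] {σ : ℝ} (hσ : 1 < σ) :
    (VV (1:DirichletCharacter ℂ q) 0 (σ + (0:ℝ)*I)).re ≤ (VV (1:DirichletCharacter ℂ 1) 0 (σ + (0:ℝ)*I)).re := by
  refine hasSum_le (fun n => ?_) (VV_hasSum (1:DirichletCharacter ℂ q) 0 (t := 0) hσ) (VV_hasSum (1:DirichletCharacter ℂ 1) 0 (t := 0) hσ)
  refine mul_le_mul_of_nonneg_left ?_ (gk_nonneg _ _ _)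
  have : zz (1:DirichletCharacter ℂ 1) 0 n = 1 := by
    unfold zz; rw [MulChar.one_apply (isUnit_of_subsingleton _)]; simp
  rw [this]
  by_cases hu : IsUnit (n:ZMod q)
  · unfold zz; rw [MulChar.one_apply hu]; simp
  · unfold zz; rw [MulChar.map_nonunit _ hu]; simp

lemma L1_ne_zero {q : ℕ} [NeZero q] (χ : DirichletCharacter ℂ q) {s : ℂ} (hs : 1 ≤ s.re) (h1 : s ≠ 1) : L1 χ s ≠ 0 := by
  rw [L1_eq χ h1]
  exact mul_ne_zero (sub_ne_zero.mpr h1) (χ.LFunction_ne_zero_of_one_le_re (Or.inr h1) hs)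

lemma L1_one_one_ne {q : ℕ} [NeZero q] : L1 (1:DirichletCharacter ℂ q) 1 ≠ 0 := by
  unfold L1
  rw [if_pos rfl]
  exact DirichletCharacter.LFunctionTrivChar₁_apply_one_ne_zero q

lemma logDeriv_L1 {q : ℕ} [NeZero q] (χ : DirichletCharacter ℂ q) {s : ℂ} (hs : 1 < s.re) :
    logDeriv (L1 χ) s = 1/(s-1) + logDeriv χ.LFunction s := by
  have h1 : s ≠ 1 := by rintro rfl; simp at hs
  have h2 : L1 χ =ᶠ[𝓝 s] fun z => (z-1) * χ.LFunction z := by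
    filter_upwards [isOpen_ne.mem_nhds h1] with z hz
    exact L1_eq χ hz
  have h3 : logDeriv (L1 χ) s = logDeriv (fun z => (z-1) * χ.LFunction z) s := by
    rw [logDeriv_apply, logDeriv_apply, h2.deriv_eq, h2.eq_of_nhds]
  rw [h3, logDeriv_mul (f := fun z => z - 1) s (sub_ne_zero.mpr h1) (χ.LFunction_ne_zero_of_one_le_re (Or.inr h1) hs.le) (by fun_prop)
    (χ.differentiableAt_LFunction s (Or.inl h1))]
  congr 1
  rw [logDeriv_apply]; simp

lemma VV0_eq {q : ℕ} [NeZero q] (χ : DirichletCharacter ℂ q) {s : ℂ} (hs : 1 < s.re) :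
    VV χ 0 s = 1/(s-1) - logDeriv (L1 χ) s := by
  rw [logDeriv_L1 χ hs]; unfold VV; simp

lemma zeta_const : ∃ C0 : ℝ, 0 < C0 ∧ ∀ σ : ℝ, 1 < σ → σ ≤ 2 → (VV (1:DirichletCharacter ℂ 1) 0 (σ + (0:ℝ)*I)).re ≤ 1/(σ-1) + C0 := by
  have hc : ContinuousOn (fun x : ℝ => logDeriv (L1 (1:DirichletCharacter ℂ 1)) (x:ℂ)) (Icc 1 2) := by
    intro x hx
    refine ContinuousAt.continuousWithinAt ?_
    have hne : L1 (1:DirichletCharacter ℂ 1) (x:ℂ) ≠ 0 := by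
      by_cases h1 : (x:ℂ) = 1
      · rw [h1]; exact L1_one_one_ne
      · exact L1_ne_zero _ (by simpa using hx.1) h1
    have hd := L1_diff (1:DirichletCharacter ℂ 1)
    have hcd : Continuous (deriv (L1 (1:DirichletCharacter ℂ 1))) := (hd.contDiff (n := 1)).continuous_deriv le_rfl
    have : ContinuousAt (logDeriv (L1 (1:DirichletCharacter ℂ 1))) (x:ℂ) := by
      unfold logDeriv
      exact hcd.continuousAt.div hd.continuous.continuousAt hne
    exact ContinuousAt.comp (f := fun x : ℝ => (x:ℂ)) this continuous_ofReal.continuousAt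
  obtain ⟨C, hC⟩ := isCompact_Icc.exists_bound_of_continuousOn hc
  refine ⟨|C|+1, by positivity, fun σ h1 h2 => ?_⟩
  rw [VV0_eq _ (by simpa using h1), sub_re]
  have h3 := hC σ ⟨h1.le, h2⟩
  have h4 : (1 / ((σ:ℂ) + (0:ℝ)*I - 1)).re = 1/(σ-1) := by
    have : (1 / ((σ:ℂ) + (0:ℝ)*I - 1)) = ((1/(σ-1):ℝ):ℂ) := by push_cast; ring
    rw [this, ofReal_re]
  rw [h4]
  have h5 := neg_le_of_abs_le ((abs_re_le_norm _).trans h3)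
  have : (σ:ℂ) + (0:ℝ)*I = σ := by simp
  rw [this]
  linarith [le_abs_self C]
end

section
open Complex Metric Set Filter Topology

lemma inv_re_nonneg {z : ℂ} (hz : 0 < z.re) : 0 ≤ (1/z).re := by
  rw [one_div, inv_re]; exact div_nonneg hz.le (normSq_nonneg _)

lemma multiset_re_sum (Z : Multiset ℂ) (g : ℂ → ℂ) : ((Z.map g).sum).re = (Z.map (fun z => (g z).re)).sum := by
  have := AddMonoidHom.map_multiset_sum Complex.reAddGroupHom (Z.map g)
  rw [Multiset.map_map] at this
  simpa using this

lemma logder_upper {c : ℂ} {R : ℝ} (hR : 0 < R) {f : ℂ → ℂ} {M : ℝ} (hf : Differentiable ℂ f) (h0 : f c ≠ 0)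
    (hb : ∀ s ∈ closedBall c R, ‖f s‖ ≤ Real.exp M * ‖f c‖) (hre : ∀ z, f z = 0 → z.re < c.re) :
    -(logDeriv f c).re ≤ 24 * M / R ∧
    ∀ ρ, f ρ = 0 → ρ ∈ closedBall c (R/3) → -(logDeriv f c).re ≤ 24 * M / R - (1/(c-ρ)).re := by
  obtain ⟨Z, hZ1, hZ2, -, hZ⟩ := LF hR hf h0 hb
  have h := hZ 0
  simp only [iteratedDeriv_zero, pow_zero, Nat.factorial_zero, Nat.cast_one, one_mul, zero_add, pow_one, Nat.factorial_one, mul_one] at h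
  have h1 := (abs_re_le_norm _).trans h
  rw [sub_re, multiset_re_sum] at h1
  have h2 := neg_le_of_abs_le h1
  have hpos : ∀ x ∈ Z.map (fun z => (1/(c-z)).re), 0 ≤ x := by
    intro x hx
    obtain ⟨z, hz, rfl⟩ := Multiset.mem_map.mp hx
    exact inv_re_nonneg (by rw [sub_re]; linarith [hre z (hZ1 z hz).1])
  have e : 6 * M * (4/R) = 24 * M / R := by ring
  rw [e] at h2
  refine ⟨?_, fun ρ h3 h4 => ?_⟩
  · have := Multiset.sum_nonneg hpos
    linarith
  · have := Multiset.single_le_sum hpos (1/(c-ρ)).re (Multiset.mem_map.mpr ⟨ρ, hZ2 ρ h4 h3, rfl⟩)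
    linarith
end

section
open Complex Metric Set Filter Topology

set_option maxHeartbeats 1000000 in
lemma VV_large {q : ℕ} [NeZero q] (χ : DirichletCharacter ℂ q) {k : ℕ} (hk : 1 ≤ k) {τ r η M : ℝ} (hT : 2 ≤ |τ|)
    (hTk : 4 * ((k+1:ℕ):ℝ)^2 ≤ (|τ|-1)^(1/(k:ℝ))) (hqT : (q:ℝ) ≤ |τ|-1) (hr : 0 < r) (hr1 : r ≤ 1/2)
    (hη : η = (1/2:ℝ)^(k+1)/k/3)
    (hM : M = Real.log (32000000 * (1+Real.log (2*|τ|))/r) + η * Real.log q + 2*η/((k+1:ℕ):ℝ) * Real.log (2*|τ|)) :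
    (VV χ 0 (1+r+τ*I)).re ≤ 1 + 24*M/η ∧ ∀ ρ, χ.LFunction ρ = 0 → ρ ∈ closedBall (1+r+τ*I:ℂ) (η/3) →
      (VV χ 0 (1+r+τ*I)).re ≤ 1 + 24*M/η - (1/(1+r+τ*I-ρ)).re := by
  set T := |τ| with hTd
  set c : ℂ := 1+r+τ*I with hc
  have hk1 : (1:ℝ) ≤ k := by exact_mod_cast hk
  have hη0 : 0 < η := by rw [hη]; positivity
  have hη12 : η ≤ 1/12 := by
    have : (1/2:ℝ)^(k+1) ≤ (1/2)^2 := pow_le_pow_of_le_one (by norm_num) (by norm_num) (by omega)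
    rw [hη, div_div, div_le_iff₀ (by positivity)]; nlinarith
  have hq : 0 < q := Nat.pos_of_ne_zero (NeZero.ne q)
  have hq' : (1:ℝ) ≤ q := by exact_mod_cast hq
  have hcre : c.re = 1 + r := by simp [hc]
  have hcim : c.im = τ := by simp [hc]
  have hc1 : c ≠ 1 := by
    intro h; rw [h, one_re] at hcre; linarith
  have hlog : 0 ≤ Real.log (2*T) := Real.log_nonneg (by linarith)
  have hcn : T ≤ ‖c-1‖ := by
    have := abs_im_le_norm (c-1); simpa [hcim] using this
  have hLc := L_lower χ (s := c) (by rw [hcre]; linarith) (by rw [hcre]; linarith)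
  rw [hcre] at hLc
  have hexpM : Real.exp M = 32000000 * (1+Real.log (2*T))/r * (q:ℝ)^η * (2*T)^(2*η/((k+1:ℕ):ℝ)) := by
    rw [hM, Real.exp_add, Real.exp_add, Real.exp_log (by positivity), Real.rpow_def_of_pos (by linarith), Real.rpow_def_of_pos (by linarith)]
    rw [mul_comm η, mul_comm (2*η/((k+1:ℕ):ℝ))]
  have hb : ∀ s ∈ closedBall c η, ‖L1 χ s‖ ≤ Real.exp M * ‖L1 χ c‖ := by
    intro s hs
    rw [mem_closedBall, dist_eq] at hs
    have him := (abs_im_le_norm (s-c)).trans hs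
    have hre := (abs_re_le_norm (s-c)).trans hs
    rw [sub_im, hcim] at him
    rw [sub_re, hcre, abs_le] at hre
    have h1 : |s.im| ≤ 2*T := by
      have := abs_sub_abs_le_abs_sub s.im τ; linarith
    have h2 : T - 1 ≤ |s.im| := by
      have := abs_sub_abs_le_abs_sub τ s.im; rw [abs_sub_comm] at this; linarith
    have h3 : 1 ≤ |s.im| := by linarith
    have hs1 : s ≠ 1 := by rintro rfl; simp at h3; linarith
    have hL := L_large χ hk h3 (hTk.trans (Real.rpow_le_rpow (by linarith) h2 (by positivity))) (hqT.trans h2) hη0.le hη.le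
      (by linarith) (by linarith)
    have hL' : ‖χ.LFunction s‖ ≤ 1000000 * (1 + Real.log (2*T)) * ((q:ℝ)^η * (2*T)^(2*η/((k+1:ℕ):ℝ))) := by
      refine hL.trans ?_
      gcongr
    rw [L1_eq χ hs1, L1_eq χ hc1, norm_mul, norm_mul, hexpM]
    have h4 : ‖s-1‖ ≤ 2 * ‖c-1‖ := by
      have : s - 1 = (s-c) + (c-1) := by ring
      rw [this]
      refine (norm_add_le _ _).trans ?_
      linarith
    calc ‖s-1‖ * ‖χ.LFunction s‖ ≤ (2*‖c-1‖) * (1000000 * (1 + Real.log (2*T)) * ((q:ℝ)^η * (2*T)^(2*η/((k+1:ℕ):ℝ)))) := by gcongr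
      _ = 32000000 * (1+Real.log (2*T))/r * (q:ℝ)^η * (2*T)^(2*η/((k+1:ℕ):ℝ)) * (‖c-1‖ * ((1+r-1)/16)) := by
          field_simp; ring
      _ ≤ _ := by gcongr
  have hV := VV0_eq χ (s := c) (by rw [hcre]; linarith)
  have h1 : (1/(c-1)).re ≤ 1 := by
    refine (re_le_norm _).trans ?_
    rw [norm_div, norm_one, div_le_one (by linarith)]; linarith
  obtain ⟨hA, hB⟩ := logder_upper hη0 (L1_diff χ) (L1_ne_zero χ (by rw [hcre]; linarith) hc1) hb (by
    intro z hz
    by_contra hcon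
    push Not at hcon
    rw [hcre] at hcon
    refine L1_ne_zero χ (by linarith) ?_ hz
    rintro rfl; rw [one_re] at hcon; linarith)
  rw [hV, sub_re]
  refine ⟨by linarith, fun ρ h2 h3 => ?_⟩
  have hρ1 : ρ ≠ 1 := by
    rintro rfl
    rw [mem_closedBall, dist_comm, dist_eq] at h3
    linarith
  have := hB ρ (by rw [L1_eq χ hρ1, h2, mul_zero]) h3
  linarith
end

section
open Complex Metric Set Filter Topology

lemma log_small (b : ℝ) (hb : 0 < b) : ∃ x0 : ℝ, 100 ≤ x0 ∧ ∀ x ≥ x0, 144 * (Real.sqrt x * Real.log (200000000 * x^2 / b)) ≤ x := by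
  have h1 : Tendsto (fun x : ℝ => Real.log x / x^(1/2:ℝ)) atTop (𝓝 0) := by
    have := isLittleO_log_rpow_atTop (show (0:ℝ) < 1/2 by norm_num)
    exact this.tendsto_div_nhds_zero
  have h2 : Tendsto (fun x : ℝ => (Real.log (200000000/b)) / x^(1/2:ℝ)) atTop (𝓝 0) :=
    (tendsto_rpow_atTop (show (0:ℝ) < 1/2 by norm_num)).const_div_atTop _
  have h3 := (h2.add (h1.const_mul 2)).const_mul 144
  simp only [mul_zero, add_zero] at h3
  have h4 := h3.eventually_le_const (show (0:ℝ) < 1 by norm_num)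
  obtain ⟨x0, hx0⟩ := (h4.and (eventually_ge_atTop 1)).exists_forall_of_atTop
  refine ⟨max x0 100, le_max_right _ _, fun x hx => ?_⟩
  obtain ⟨h5, h6⟩ := hx0 x ((le_max_left _ _).trans hx)
  have hx1 : 0 < x := by linarith
  have h7 : Real.log (200000000 * x^2 / b) = Real.log (200000000/b) + 2 * Real.log x := by
    rw [mul_div_right_comm, Real.log_mul (by positivity) (by positivity), Real.log_pow]; norm_num
  rw [h7]
  rw [← Real.sqrt_eq_rpow] at h5
  have hs : 0 < Real.sqrt x := Real.sqrt_pos.mpr hx1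
  have hss : Real.sqrt x * Real.sqrt x = x := Real.mul_self_sqrt hx1.le
  have h8 : 144 * (Real.log (200000000/b) + 2 * Real.log x) ≤ Real.sqrt x := by
    have e : 144 * (Real.log (200000000/b) / Real.sqrt x + 2 * (Real.log x / Real.sqrt x)) = (144 * (Real.log (200000000/b) + 2 * Real.log x)) / Real.sqrt x := by
      field_simp
    rw [e, div_le_one hs] at h5; exact h5
  calc 144 * (Real.sqrt x * (Real.log (200000000/b) + 2 * Real.log x)) = Real.sqrt x * (144 * (Real.log (200000000/b) + 2 * Real.log x)) := by ring
    _ ≤ Real.sqrt x * Real.sqrt x := by gcongr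
    _ = x := hss

lemma k_facts {x K : ℝ} (hK : Real.exp 10 ≤ K) (hKx : K ≤ x) (k : ℕ) (hk : k = ⌊Real.log K / 5⌋₊) :
    1 ≤ k ∧ Real.log K / 10 ≤ k ∧ (8:ℝ)^k ≤ Real.sqrt x ∧ (k:ℝ) ≤ K := by
  have hK0 : 0 < K := lt_of_lt_of_le (Real.exp_pos _) hK
  have hl : 10 ≤ Real.log K := by rwa [Real.le_log_iff_exp_le hK0]
  have h1 : (k:ℝ) ≤ Real.log K / 5 := by rw [hk]; exact Nat.floor_le (by linarith)
  have h2 : Real.log K / 5 < k + 1 := by rw [hk]; exact Nat.lt_floor_add_one _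
  refine ⟨?_, by linarith, ?_, ?_⟩
  · rw [hk]; exact Nat.one_le_floor_iff _ |>.mpr (by linarith)
  · refine Real.le_sqrt_of_sq_le ?_
    refine le_trans ?_ hKx
    rw [← pow_mul, ← Real.log_le_log_iff (by positivity) hK0, Real.log_pow]
    have : Real.log 8 = 3 * Real.log 2 := by
      rw [show (8:ℝ) = 2^3 by norm_num, Real.log_pow]; norm_num
    rw [this]
    have := Real.log_two_lt_d9
    push_cast
    have hl2 : Real.log 2 ≤ 0.7 := by linarith
    have : (k:ℝ) * Real.log 2 ≤ k * 0.7 := by gcongr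
    nlinarith
  · have := Real.log_le_sub_one_of_pos hK0
    linarith

set_option maxHeartbeats 2000000 in
theorem partB : ∃ K0 : ℝ, 0 < K0 ∧ ∃ c : ℝ, 0 < c ∧ ∀ (q : ℕ) [NeZero q], 3 ≤ q → ∀ (χ : DirichletCharacter ℂ q) (ρ : ℂ),
    χ.LFunction ρ = 0 → ∀ x K : ℝ, x = Real.log (q * (2+|ρ.im|)) → K = x / Real.log q → K0 ≤ K → c * Real.log K / x < 1 - ρ.re := by
  obtain ⟨C0, hC0, hzeta⟩ := zeta_const
  set b : ℝ := (2/5) / (3*C0+610) with hb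
  have hb0 : 0 < b := by positivity
  have hb1 : b ≤ 1/100 := by rw [hb, div_le_iff₀ (by positivity)]; linarith
  obtain ⟨x0, hx100, hx0⟩ := log_small b hb0
  refine ⟨max x0 (Real.exp 10), by positivity, b/70, by positivity, ?_⟩
  intro q _ hq3 χ ρ hρ x K hx hK hK0
  have hKe : Real.exp 10 ≤ K := (le_max_right _ _).trans hK0
  have hKx0 : x0 ≤ K := (le_max_left _ _).trans hK0
  have hq' : (3:ℝ) ≤ q := by exact_mod_cast hq3
  have hlq : 1 ≤ Real.log q := by
    rw [Real.le_log_iff_exp_le (by linarith)]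
    linarith [Real.exp_one_lt_d9]
  have hK00 : 0 < K := lt_of_lt_of_le (Real.exp_pos _) hKe
  have hxK : x = K * Real.log q := by rw [hK]; field_simp
  have hKx : K ≤ x := by rw [hxK]; exact le_mul_of_one_le_right hK00.le hlq
  have hxx0 : x0 ≤ x := hKx0.trans hKx
  have hx0' := hx0 x hxx0
  have hx1 : 100 ≤ x := hx100.trans hxx0
  obtain ⟨k, hk⟩ : ∃ k : ℕ, k = ⌊Real.log K / 5⌋₊ := ⟨_, rfl⟩
  obtain ⟨hk1, hk10, hk8, hkK⟩ := k_facts hKe hKx k hk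
  have hk1' : (1:ℝ) ≤ k := by exact_mod_cast hk1
  set S := Real.sqrt x with hS
  have hSS : S * S = x := Real.mul_self_sqrt (by linarith)
  have hS10 : 10 ≤ S := Real.le_sqrt_of_sq_le (by linarith)
  have hk2 : (k:ℝ) + 1 ≤ 2^k := by exact_mod_cast Nat.lt_two_pow_self
  have h8 : (8:ℝ)^k = 2^k * 2^k * 2^k := by rw [← mul_pow, ← mul_pow]; norm_num
  have h2k : (2:ℝ) ≤ 2^k := by linarith
  have hkk2 : (k:ℝ)*k*2^k ≤ S := by
    refine le_trans ?_ hk8; rw [h8]; gcongr <;> linarith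
  have hkk1 : 2 * (k:ℝ)*(k+1) ≤ S := by
    refine le_trans ?_ hk8; rw [h8]
    calc 2 * (k:ℝ)*(k+1) = k * (k+1) * 2 := by ring
      _ ≤ 2^k * 2^k * 2^k := by gcongr; linarith
  have hkx : (k:ℝ) ≤ x := by nlinarith only [hkk1, hk1', hSS, hS10]
  -- sizes of t
  set T := |ρ.im| with hT
  have hT0 : 0 ≤ T := abs_nonneg _
  have hxs : x = Real.log q + Real.log (2+T) := by rw [hx, Real.log_mul (by linarith) (by linarith)]
  have hlqx : Real.log q ≤ x/4 := by
    have : (4:ℝ) ≤ K := by linarith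
    rw [hxK]; nlinarith only [this, hlq]
  have hlT : 3/4*x ≤ Real.log (2+T) := by linarith
  have hT2 : Real.exp (x/2) * 25 ≤ 2 + T := by
    have h1 : Real.exp (3/4*x) ≤ 2+T := by rwa [← Real.le_log_iff_exp_le (by linarith)]
    have h2 : (25:ℝ) ≤ Real.exp (x/4) := by linarith [Real.add_one_le_exp (x/4)]
    calc Real.exp (x/2) * 25 ≤ Real.exp (x/2) * Real.exp (x/4) := by gcongr
      _ = Real.exp (3/4*x) := by rw [← Real.exp_add]; congr 1; ring
      _ ≤ _ := h1
  have he1 : 1 ≤ Real.exp (x/2) := Real.one_le_exp (by linarith)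
  have hT1 : Real.exp (x/2) ≤ T - 1 := by linarith
  have hTT : 2 ≤ T := by linarith
  have hqT : (q:ℝ) ≤ T - 1 := by
    refine le_trans ?_ hT1
    rw [← Real.log_le_iff_le_exp (by linarith)]; linarith
  have hTk : 4 * ((k+1:ℕ):ℝ)^2 ≤ (T-1)^(1/(k:ℝ)) := by
    have h1 : (T-1)^(1/(k:ℝ)) ≥ (Real.exp (x/2))^(1/(k:ℝ)) := Real.rpow_le_rpow (by positivity) hT1 (by positivity)
    rw [← Real.exp_mul] at h1
    have h2 : 2*((k:ℝ)+1) ≤ x/2*(1/k) := by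
      rw [mul_one_div, le_div_iff₀ (by linarith)]; nlinarith only [hkk1, hSS, hS10]
    have h3 : (4:ℝ)^(k+1) ≤ Real.exp (2*((k:ℝ)+1)) := by
      rw [mul_comm, Real.exp_mul, ]
      have : (4:ℝ)^(k+1) ≤ (Real.exp 2)^(k+1) := by
        gcongr
        have := Real.exp_one_gt_d9
        calc (4:ℝ) ≤ Real.exp 1 * Real.exp 1 := by nlinarith only [this]
          _ = Real.exp 2 := by rw [← Real.exp_add]; norm_num
      rw [← Real.exp_mul]
      rw [← Real.exp_nat_mul] at this
      convert this using 2; push_cast; ring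
    have h4 : 4 * ((k+1:ℕ):ℝ)^2 ≤ (4:ℝ)^(k+1) := by
      push_cast
      calc 4 * ((k:ℝ)+1)^2 ≤ 4 * (2^k)^2 := by gcongr
        _ = 4^(k+1) := by rw [← pow_mul, mul_comm k 2, pow_mul]; norm_num; ring
    exact h4.trans (h3.trans ((Real.exp_le_exp.mpr h2).trans h1))
  have him0 : ρ.im ≠ 0 := by intro h; rw [hT, h, abs_zero] at hTT; linarith
  have hρ1 : ρ ≠ 1 := by rintro rfl; simp at him0
  have hre1 : ρ.re < 1 := by
    by_contra h; push Not at h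
    exact χ.LFunction_ne_zero_of_one_le_re (Or.inr hρ1) h hρ
  -- parameters
  obtain ⟨r, hr⟩ : ∃ r : ℝ, r = b * k / x := ⟨_, rfl⟩
  have hr0 : 0 < r := by rw [hr]; positivity
  have hr12 : r ≤ 1/2 := by rw [hr, div_le_iff₀ (by linarith)]; nlinarith only [hb1, hkx, hk1', hb0]
  obtain ⟨η, hη⟩ : ∃ η : ℝ, η = (1/2:ℝ)^(k+1)/k/3 := ⟨_, rfl⟩
  have hη0 : 0 < η := by rw [hη]; positivity
  have hηinv : 1/η = 6 * k * 2^k := by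
    rw [hη, one_div_pow]; field_simp; ring
  have hrη : 2 * r ≤ η/3 := by
    have h1 : η = 1/(6 * k * 2^k) := by rw [← hηinv]; field_simp
    rw [h1, hr, div_div, ← mul_div_assoc, div_le_div_iff₀ (by linarith) (by positivity)]
    have : (k:ℝ)*k*2^k ≤ x := by nlinarith only [hkk2, hSS, hS10]
    have h2 : 2*(b*k)*(6*k*2^k*3) = 36 * b * (k*k*2^k) := by ring
    rw [h2]
    have : b * (k*k*2^k) ≤ 1/100 * x := by gcongr
    linarith
  by_contra hcon
  push Not at hcon
  set ε := 1 - ρ.re with hε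
  have hε0 : 0 < ε := by linarith
  have hεr : ε ≤ r/7 := by
    refine hcon.trans ?_
    rw [hr]
    have : b/70 * Real.log K / x = b * (Real.log K/10)/x/7 := by ring
    rw [this]; gcongr
  -- error terms
  have hE : ∀ τ : ℝ, |τ| ≤ 2*T → 2 ≤ |τ| → ∀ M : ℝ, M = Real.log (32000000 * (1+Real.log (2*|τ|))/r) + η * Real.log q + 2*η/((k+1:ℕ):ℝ) * Real.log (2*|τ|) →
      1 + 24 * M / η ≤ 122 * (x/k) := by
    intro τ h1 h2 M hM
    have hl : Real.log (2*|τ|) ≤ 2*x := by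
      calc Real.log (2*|τ|) ≤ Real.log (4 * (2+T)) := Real.log_le_log (by linarith) (by linarith)
        _ = Real.log 4 + Real.log (2+T) := Real.log_mul (by norm_num) (by linarith)
        _ ≤ 2*x := by
          have : Real.log 4 ≤ 3 := by linarith [Real.log_le_sub_one_of_pos (show (0:ℝ) < 4 by norm_num)]
          linarith
    have hl0 : 0 ≤ Real.log (2*|τ|) := Real.log_nonneg (by linarith)
    have hA : Real.log (32000000 * (1+Real.log (2*|τ|))/r) ≤ Real.log (200000000 * x^2 / b) := by
      refine Real.log_le_log (by positivity) ?_
      rw [hr, div_div_eq_mul_div, div_le_div_iff₀ (by positivity) hb0]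
      calc 32000000 * (1+Real.log (2*|τ|)) * x * b ≤ 32000000 * (3*x) * x * b := by gcongr; linarith
        _ = 96000000 * x^2 * b * 1 := by ring
        _ ≤ 200000000 * x^2 * b * k := by gcongr; norm_num
        _ = _ := by ring
    have hBpos : 0 ≤ Real.log (200000000 * x^2 / b) := by
      refine Real.log_nonneg ?_
      rw [le_div_iff₀ hb0]; nlinarith only [hb1, hx1]
    have e : 24*M/η = 24 * (1/η) * Real.log (32000000 * (1+Real.log (2*|τ|))/r) + 24 * Real.log q + 48 * Real.log (2*|τ|) / ((k+1:ℕ):ℝ) := by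
      rw [hM]; field_simp; ring
    rw [e, hηinv]
    have t1 : 24 * (6*k*2^k) * Real.log (32000000 * (1+Real.log (2*|τ|))/r) ≤ x/k := by
      rw [le_div_iff₀ (by linarith)]
      calc 24 * (6*k*2^k) * Real.log (32000000 * (1+Real.log (2*|τ|))/r) * k ≤ 24 * (6*k*2^k) * Real.log (200000000 * x^2 / b) * k := by gcongr
        _ = 144 * ((k*k*2^k) * Real.log (200000000 * x^2 / b)) := by ring
        _ ≤ 144 * (S * Real.log (200000000 * x^2 / b)) := by gcongr
        _ ≤ x := hx0'
    have t2 : Real.log q ≤ x/k := by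
      rw [le_div_iff₀ (by linarith), hxK, mul_comm]; gcongr
    have t3 : 48 * Real.log (2*|τ|) / ((k+1:ℕ):ℝ) ≤ 96 * (x/k) := by
      calc 48 * Real.log (2*|τ|) / ((k+1:ℕ):ℝ) ≤ 48 * (2*x) / k := by gcongr; simp
        _ = _ := by ring
    have t4 : 1 ≤ x/k := by rw [le_div_iff₀ (by linarith)]; linarith
    linarith
  have hA := (VV_large χ hk1 (τ := ρ.im) hTT hTk hqT hr0 hr12 hη rfl).2 ρ hρ (by
    rw [mem_closedBall, dist_eq]
    have : ρ - (1+r+ρ.im*I) = ((-(r+ε):ℝ):ℂ) := by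
      apply Complex.ext <;> simp [hε]
      ring
    rw [this, norm_real, norm_neg, Real.norm_eq_abs, abs_of_pos (by linarith)]
    linarith)
  have h2T : |2*ρ.im| = 2*T := by rw [abs_mul]; simp [hT]
  have hB := (VV_large (χ^2) hk1 (τ := 2*ρ.im) (r := r) (η := η) (by rw [h2T]; linarith) 
    (by rw [h2T]; exact hTk.trans (Real.rpow_le_rpow (by linarith) (by linarith) (by positivity))) (by rw [h2T]; linarith) hr0 hr12 hη rfl).1
  have hEA := hE ρ.im (by linarith) hTT _ rfl
  have hEB := hE (2*ρ.im) h2T.le (by rw [h2T]; linarith) _ rfl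
  have hA' : (1/(1+r+ρ.im*I-ρ)).re = 1/(r+ε) := by
    have : 1/(1+r+ρ.im*I-ρ) = ((1/(r+ε):ℝ):ℂ) := by
      push_cast; congr 1
      apply Complex.ext <;> simp [hε]
      ring
    rw [this, ofReal_re]
  rw [hA'] at hA
  have hA2 : (VV χ 0 (1+r+ρ.im*I)).re ≤ 122 * (x/k) - 1/(r+ε) := by linarith
  have hB2 := hB.trans hEB
  have h341 := VV341 χ (σ := 1+r) ρ.im (by linarith)
  have hV1 := VV_one_le (q := q) (σ := 1+r) (by linarith)
  have hz := hzeta (1+r) (by linarith) (by linarith)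
  rw [add_sub_cancel_left] at hz
  push_cast at h341 hV1 hz hB2
  have hfin : 4 * (1/(r+ε)) ≤ 3 * (1/r) + 3 * C0 + 5 * (122 * (x/k)) := by
    linarith only [h341, hV1, hz, hB2, hA2]
  have hl : 7/2 * (1/r) ≤ 4 * (1/(r+ε)) := by
    rw [mul_one_div, mul_one_div, div_le_div_iff₀ hr0 (by linarith)]; linarith
  have hrinv : 1/r = (x/k)/b := by rw [hr]; field_simp
  have hxk1 : 1 ≤ x/k := by rw [le_div_iff₀ (by linarith)]; linarith
  have h5 : 1/2 * ((x/k)/b) ≤ (3*C0+610) * (x/k) := by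
    rw [← hrinv]; nlinarith only [hfin, hl, hxk1, hC0]
  have h6 : (x/k)/b = 5/2*(3*C0+610) * (x/k) := by
    rw [hb]; field_simp
  rw [h6] at h5
  have : 0 < (3*C0+610) * (x/k) := by positivity
  linarith
end

section
open Complex Metric Set Filter Topology

lemma fejer_aux (u : ℂ) (hu : ‖u‖ ≤ 1) (J : ℕ) :
    ‖∑ j ∈ Finset.range (J+1), u^j‖^2 ≤ ((J:ℝ)+1) + 2 * ∑ k ∈ Finset.range J, ((J:ℝ)-k) * (u^(k+1)).re := by
  induction J with
  | zero => simp
  | succ J ih =>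
    have e1 : ∑ j ∈ Finset.range (J+1+1), u^j = 1 + u * ∑ j ∈ Finset.range (J+1), u^j := by
      rw [Finset.sum_range_succ', Finset.mul_sum, add_comm]
      simp [pow_succ']
    have e2 : u * ∑ j ∈ Finset.range (J+1), u^j = ∑ j ∈ Finset.range (J+1), u^(j+1) := by
      rw [Finset.mul_sum]; simp [pow_succ']
    set T := ∑ j ∈ Finset.range (J+1), u^j with hT
    have e3 : ‖1 + u * T‖^2 = 1 + 2 * (u*T).re + ‖u‖^2 * ‖T‖^2 := by
      rw [← mul_pow, ← norm_mul, Complex.sq_norm, Complex.sq_norm, normSq_add]; simp; ring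
    have e4 : ∑ k ∈ Finset.range (J+1), (((J+1:ℕ):ℝ)-k) * (u^(k+1)).re = ∑ k ∈ Finset.range J, ((J:ℝ)-k) * (u^(k+1)).re + (u*T).re := by
      rw [e2, re_sum, Finset.sum_range_succ, Finset.sum_range_succ (fun i => (u^(i+1)).re), ← add_assoc, ← Finset.sum_add_distrib]
      push_cast
      congr 1
      · refine Finset.sum_congr rfl fun k _ => by ring
      · ring
    rw [e1, e3, e4]
    have : ‖u‖^2 * ‖T‖^2 ≤ 1 * ‖T‖^2 := by
      gcongr; exact pow_le_one₀ (norm_nonneg _) hu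
    push_cast
    linarith

lemma fejer (u : ℂ) (hu : ‖u‖ ≤ 1) (J : ℕ) :
    -(1/2) ≤ ∑ k ∈ Finset.range J, ((J:ℝ)-k)/(J+1) * (u^(k+1)).re := by
  have h := (sq_nonneg _).trans (fejer_aux u hu J)
  have : ∑ k ∈ Finset.range J, ((J:ℝ)-k)/(J+1) * (u^(k+1)).re = (∑ k ∈ Finset.range J, ((J:ℝ)-k) * (u^(k+1)).re)/(J+1) := by
    rw [Finset.sum_div]; refine Finset.sum_congr rfl fun k _ => by ring
  rw [this, le_div_iff₀ (by positivity)]; linarith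

lemma fejer_one (J : ℕ) : ∑ k ∈ Finset.range J, ((J:ℝ)-k)/(J+1) = J/2 := by
  have h : ∀ J : ℕ, ∑ k ∈ Finset.range J, ((J:ℝ)-k) = J*(J+1)/2 := by
    intro J
    induction J with
    | zero => simp
    | succ J ih =>
      have : ∑ k ∈ Finset.range J, (((J+1:ℕ):ℝ)-k) = ∑ k ∈ Finset.range J, ((J:ℝ)-k) + J := by
        have : ∀ k ∈ Finset.range J, (((J+1:ℕ):ℝ)-k) = ((J:ℝ)-k) + 1 := fun k _ => by push_cast; ring
        rw [Finset.sum_congr rfl this, Finset.sum_add_distrib]; simp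
      rw [Finset.sum_range_succ, this, ih]; push_cast; ring
  rw [← Finset.sum_div, h]; field_simp

lemma multiset_swap (W : Multiset ℂ) (J : ℕ) (c : ℕ → ℝ) (g : ℕ → ℂ → ℝ) :
    (W.map (fun w => ∑ k ∈ Finset.range J, c k * g k w)).sum = ∑ k ∈ Finset.range J, c k * (W.map (g k)).sum := by
  induction W using Multiset.induction with
  | empty => simp
  | cons a W ih => simp [ih, mul_add, Finset.sum_add_distrib]

lemma turan (W : Multiset ℂ) (hW : ∀ w ∈ W, w ≠ 0) {w0 : ℂ} (hw0 : w0 ∈ W) {y : ℝ} (hy : ‖w0‖ ≤ y) (B : ℕ → ℝ) (hB0 : ∀ k, 0 ≤ B k)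
    (hB : ∀ k, (W.map (fun w => (1/w^(k+1)).re)).sum ≤ B k) (J : ℕ) :
    (J:ℝ)/4 ≤ W.card + 2 * ∑ k ∈ Finset.range J, y^(k+1) * B k := by
  obtain ⟨w1, hw1, hmin⟩ : ∃ w1 ∈ W, ∀ w ∈ W, ‖w1‖ ≤ ‖w‖ := by
    obtain ⟨w1, h1, h2⟩ := Finset.exists_min_image W.toFinset (fun w => ‖w‖) ⟨w0, Multiset.mem_toFinset.mpr hw0⟩
    exact ⟨w1, Multiset.mem_toFinset.mp h1, fun w hw => h2 w (Multiset.mem_toFinset.mpr hw)⟩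
  set v := ‖w1‖ with hv
  have hv0 : 0 < v := norm_pos_iff.mpr (hW w1 hw1)
  have hvy : v ≤ y := (hmin w0 hw0).trans hy
  set e : ℂ := v / w1 with he
  have hen : ‖e‖ = 1 := by rw [he, norm_div, norm_real, norm_norm, div_self hv0.ne']
  set a : ℕ → ℝ := fun k => ((J:ℝ)-k)/(J+1) with ha
  have hP : ∀ u : ℂ, ∑ k ∈ Finset.range J, a k * (1 + (e^(k+1)).re) * (u^(k+1)).re = ∑ k ∈ Finset.range J, a k * (u^(k+1)).re
     + 1/2 * ∑ k ∈ Finset.range J, a k * ((u*e)^(k+1)).re + 1/2 * ∑ k ∈ Finset.range J, a k * ((u*(starRingEnd ℂ) e)^(k+1)).re := by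
    intro u
    rw [Finset.mul_sum, Finset.mul_sum, ← Finset.sum_add_distrib, ← Finset.sum_add_distrib]
    refine Finset.sum_congr rfl fun k _ => ?_
    rw [mul_pow, mul_pow, ← map_pow, mul_re, mul_re, conj_re, conj_im]; ring
  have hP1 : ∀ u : ℂ, ‖u‖ ≤ 1 → -1 ≤ ∑ k ∈ Finset.range J, a k * (1 + (e^(k+1)).re) * (u^(k+1)).re := by
    intro u hu
    rw [hP]
    have h1 : -(1/2) ≤ ∑ k ∈ Finset.range J, a k * ((u)^(k+1)).re := fejer u hu J
    have h2 : -(1/2) ≤ ∑ k ∈ Finset.range J, a k * (((u*e))^(k+1)).re := fejer (u*e) (by rw [norm_mul, hen, mul_one]; exact hu) J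
    have h3 : -(1/2) ≤ ∑ k ∈ Finset.range J, a k * ((u*(starRingEnd ℂ) e)^(k+1)).re := fejer (u*(starRingEnd ℂ) e) (by rw [norm_mul, RCLike.norm_conj, hen, mul_one]; exact hu) J
    linarith
  have hP2 : (J:ℝ)/4 - 3/4 ≤ ∑ k ∈ Finset.range J, a k * (1 + (e^(k+1)).re) * (e^(k+1)).re := by
    rw [hP]
    have h1 : -(1/2) ≤ ∑ k ∈ Finset.range J, a k * ((e)^(k+1)).re := fejer e hen.le J
    have h2 : -(1/2) ≤ ∑ k ∈ Finset.range J, a k * (((e*e))^(k+1)).re := fejer (e*e) (by rw [norm_mul, hen, mul_one]) J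
    have h3 : ∑ k ∈ Finset.range J, a k * ((e*(starRingEnd ℂ) e)^(k+1)).re = J/2 := by
      rw [← fejer_one J]
      refine Finset.sum_congr rfl fun k _ => ?_
      rw [mul_conj, normSq_eq_norm_sq, hen]; simp [ha]
    rw [h3]
    linarith
  set c : ℕ → ℝ := fun k => a k * (1 + (e^(k+1)).re) * v^(k+1) with hc
  set F : ℂ → ℝ := fun w => ∑ k ∈ Finset.range J, c k * (1/w^(k+1)).re with hF
  have hFe : ∀ w, F w = ∑ k ∈ Finset.range J, a k * (1 + (e^(k+1)).re) * ((v/w:ℂ)^(k+1)).re := by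
    intro w
    refine Finset.sum_congr rfl fun k _ => ?_
    have : ((v/w:ℂ)^(k+1)).re = v^(k+1) * (1/w^(k+1)).re := by
      have : (v/w:ℂ)^(k+1) = ((v^(k+1):ℝ):ℂ) * (1/w^(k+1)) := by rw [div_pow]; push_cast; ring
      rw [this, re_ofReal_mul]
    rw [this, hc]; ring
  have hlow : (J:ℝ)/4 - W.card ≤ (W.map F).sum := by
    obtain ⟨W', rfl⟩ := Multiset.exists_cons_of_mem hw1
    rw [Multiset.map_cons, Multiset.sum_cons, Multiset.card_cons]
    have h1 : (J:ℝ)/4 - 3/4 ≤ F w1 := by rw [hFe]; exact hP2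
    have h2 : -(W'.card:ℝ) ≤ (W'.map F).sum := by
      have : (W'.map F).card • (-1:ℝ) ≤ (W'.map F).sum := by
        refine Multiset.card_nsmul_le_sum fun x hx => ?_
        obtain ⟨w, hw, rfl⟩ := Multiset.mem_map.mp hx
        rw [hFe]
        refine hP1 _ ?_
        rw [norm_div, norm_real, norm_norm]
        exact div_le_one_of_le₀ (hmin w (Multiset.mem_cons_of_mem hw)) (norm_nonneg _)
      simpa using this
    push_cast; linarith
  have hup : (W.map F).sum ≤ 2 * ∑ k ∈ Finset.range J, y^(k+1) * B k := by
    rw [hF, multiset_swap W J c (fun k w => (1/w^(k+1)).re), Finset.mul_sum]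
    refine Finset.sum_le_sum fun k hk => ?_
    have hkJ : (k:ℝ) ≤ J := by exact_mod_cast (Finset.mem_range.mp hk).le
    have ha0 : 0 ≤ a k := div_nonneg (by linarith) (by positivity)
    have ha1 : a k ≤ 1 := by
      rw [ha]; simp only; rw [div_le_one (by positivity)]; linarith [(Nat.cast_nonneg k : (0:ℝ) ≤ k)]
    have hre := (abs_re_le_norm (e^(k+1)))
    rw [norm_pow, hen, one_pow, abs_le] at hre
    have hc0 : 0 ≤ c k := by
      rw [hc]; simp only
      exact mul_nonneg (mul_nonneg ha0 (by linarith)) (by positivity)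
    calc c k * (W.map fun w => (1/w^(k+1)).re).sum ≤ c k * B k := mul_le_mul_of_nonneg_left (hB k) hc0
      _ ≤ (1 * 2 * y^(k+1)) * B k := by
          refine mul_le_mul_of_nonneg_right ?_ (hB0 k)
          rw [hc]; simp only
          have : 1 + (e^(k+1)).re ≤ 2 := by linarith
          have h0 : 0 ≤ 1 + (e^(k+1)).re := by linarith
          gcongr
      _ = _ := by ring
  linarith
end

section
open Complex Metric Set Filter Topology

def PairOK (β : ℝ) (δ M : ℝ) (c : ℂ) (V : ℕ → ℂ) (Z0 : Set ℂ) : Prop :=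
  ∃ Z : Multiset ℂ, (∀ z ∈ Z, c - z ≠ 0) ∧ (∀ z ∈ closedBall c (1/3), z ∈ Z0 → z ≠ β → z.re < 1 → z ∈ Z) ∧
    (Z.card:ℝ) * Real.log 2 ≤ M ∧ ∀ k, (V k).re ≤ k.factorial * ((k+1)*δ*8^(k+2)) + 6*M*(k+1).factorial*4^(k+1)
      - k.factorial * (Z.map (fun z => (1/(c-z)^(k+1)).re)).sum

lemma pair_core {β δ M : ℝ} {c : ℂ} {V : ℕ → ℂ} {Z0 : Set ℂ} {Φ : ℂ → ℂ} (hf : Differentiable ℂ Φ) (h0 : Φ c ≠ 0)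
    (hb : ∀ s ∈ closedBall c 1, ‖Φ s‖ ≤ Real.exp M * ‖Φ c‖) (E : ℕ → ℂ)
    (hV : ∀ k, V k = (-1)^(k+1) * iteratedDeriv k (logDeriv Φ) c + E k)
    (hE : ∀ k, ‖E k‖ ≤ k.factorial * ((k+1)*δ*8^(k+2)))
    (hZ : ∀ z ∈ Z0, z ≠ β → z.re < 1 → Φ z = 0) : PairOK β δ M c V Z0 := by
  obtain ⟨Z, h1, h2, h3, h4⟩ := LF one_pos hf h0 hb
  refine ⟨Z, fun z hz h => h0 ?_, fun z hz hz0 hb h1 => h2 z hz (hZ z hz0 hb h1), h3, fun k => ?_⟩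
  · rw [sub_eq_zero.mp h]; exact (h1 z hz).1
  · have h5 := h4 k
    set D := iteratedDeriv k (logDeriv Φ) c
    set S := (Z.map (fun z => (-1)^k*(k.factorial:ℂ)/(c-z)^(k+1))).sum with hS
    have h6 : (-1)^k * S = k.factorial * (Z.map (fun z => 1/(c-z)^(k+1))).sum := by
      rw [hS, ← Multiset.sum_map_mul_left, ← Multiset.sum_map_mul_left]
      congr 1
      refine Multiset.map_congr rfl fun z _ => ?_
      have : ((-1:ℂ)^k)*(-1)^k = 1 := by rw [← mul_pow]; norm_num
      linear_combination (k.factorial/(c-z)^(k+1)) * this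
    have h7 : V k = -((-1)^k * (D - S)) + E k - (-1)^k * S := by rw [hV k]; ring
    have h8 : (-((-1)^k * (D-S))).re ≤ 6*M*(k+1).factorial*4^(k+1) := by
      refine (re_le_norm _).trans ?_
      rw [norm_neg, norm_mul, norm_pow, norm_neg, norm_one, one_pow, one_mul]
      simpa using h5
    have h9 := (re_le_norm _).trans (hE k)
    have h10 : ((k.factorial:ℂ) * (Z.map (fun z => 1/(c-z)^(k+1))).sum).re = k.factorial * (Z.map (fun z => (1/(c-z)^(k+1)).re)).sum := by
      rw [← multiset_re_sum, ← ofReal_natCast, re_ofReal_mul]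
    rw [h7, h6, sub_re, add_re, h10]
    linarith

lemma ball_facts {t : ℝ} {s : ℂ} (hs : s ∈ closedBall ((9/8:ℝ) + t*I : ℂ) 1) :
    1/8 ≤ s.re ∧ s.re ≤ 17/8 ∧ ‖s‖ ≤ 2*(2+|t|) ∧ ‖s-1‖ ≤ 2*(2+|t|) := by
  rw [mem_closedBall, dist_eq_norm] at hs
  have h1 := (abs_re_le_norm _).trans hs
  have e1 : (s - ((9/8:ℝ) + t*I : ℂ)).re = s.re - 9/8 := by simp
  rw [e1, abs_le] at h1
  have n1 : ‖(t*I:ℂ)‖ = |t| := by simp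
  have n2 : ‖((9/8:ℝ) + t*I : ℂ)‖ ≤ 9/8 + |t| := by
    refine (norm_add_le _ _).trans ?_
    rw [n1, norm_real]; norm_num
  have n3 : ‖((9/8:ℝ) + t*I - 1 : ℂ)‖ ≤ 1/8 + |t| := by
    have : ((9/8:ℝ) + t*I - 1 : ℂ) = ((1/8:ℝ):ℂ) + t*I := by push_cast; ring
    rw [this]
    refine (norm_add_le _ _).trans ?_
    rw [n1, norm_real]; norm_num
  have ht := abs_nonneg t
  refine ⟨by linarith, by linarith, ?_, ?_⟩
  · have := norm_add_le (s - ((9/8:ℝ) + t*I : ℂ)) ((9/8:ℝ) + t*I : ℂ)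
    rw [sub_add_cancel] at this
    linarith
  · have := norm_add_le (s - ((9/8:ℝ) + t*I : ℂ)) ((9/8:ℝ) + t*I - 1 : ℂ)
    have e : (s - ((9/8:ℝ) + t*I : ℂ)) + ((9/8:ℝ) + t*I - 1 : ℂ) = s - 1 := by ring
    rw [e] at this
    linarith

lemma center_facts {q : ℕ} [NeZero q] (χ : DirichletCharacter ℂ q) (t : ℝ) :
    1/128 ≤ ‖χ.LFunction ((9/8:ℝ) + t*I)‖ := by
  have := L_lower χ (s := (9/8:ℝ)+t*I) (by simp; norm_num) (by simp; norm_num)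
  refine le_trans ?_ this
  simp; norm_num

lemma exp20 {x : ℝ} (hx : 6 ≤ x) : 300000000000 * x^3 ≤ Real.exp (20*Real.log x) := by
  have : Real.exp (20*Real.log x) = x^20 := by
    rw [mul_comm, Real.exp_mul, Real.exp_log (by linarith)]
    norm_cast
  rw [this]
  have : (6:ℝ)^17 ≤ x^17 := by gcongr
  have h3 : 0 ≤ x^3 := by positivity
  calc 300000000000 * x^3 ≤ x^17*x^3 := by gcongr; linarith
    _ = x^20 := by ring

lemma pair_general {q : ℕ} [NeZero q] (hq : 3 ≤ q) {χ χ' : DirichletCharacter ℂ q} (h1 : χ ≠ 1) (h2 : χ' ≠ 1) (β : ℝ) {δ : ℝ} (hδ : 0 ≤ δ) (t : ℝ) :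
    PairOK β δ (20*Real.log (q*(2+|t|))) ((9/8:ℝ)+t*I) (fun k => VV χ k ((9/8:ℝ)+t*I) + VV χ' k ((9/8:ℝ)+t*I)) {z | χ.LFunction z = 0} := by
  have hq' : (3:ℝ) ≤ q := by exact_mod_cast hq
  have ht := abs_nonneg t
  have hx : 6 ≤ q*(2+|t|) := by nlinarith
  have c1 := center_facts χ t
  have c2 := center_facts χ' t
  have hd1 := DirichletCharacter.differentiable_LFunction h1
  have hd2 := DirichletCharacter.differentiable_LFunction h2
  have n1 : χ.LFunction ((9/8:ℝ)+t*I) ≠ 0 := fun h => by rw [h] at c1; norm_num at c1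
  have n2 : χ'.LFunction ((9/8:ℝ)+t*I) ≠ 0 := fun h => by rw [h] at c2; norm_num at c2
  refine pair_core (Φ := fun s => χ.LFunction s * χ'.LFunction s) (hd1.mul hd2) (mul_ne_zero n1 n2) ?_ (fun _ => 0) ?_ ?_ ?_
  · intro s hs
    obtain ⟨b1, b2, b3, b4⟩ := ball_facts hs
    have u1 := L_bound h1 (s := s) (by linarith) (by linarith)
    have u2 := L_bound h2 (s := s) (by linarith) (by linarith)
    have u3 : (q:ℝ)*(1+256*‖s‖) ≤ 513*(q*(2+|t|)) := by nlinarith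
    rw [norm_mul, norm_mul]
    set x := (q:ℝ)*(2+|t|)
    have e := exp20 hx
    calc ‖χ.LFunction s‖ * ‖χ'.LFunction s‖ ≤ (513*x)*(513*x) := by gcongr <;> linarith
      _ ≤ (300000000000*x^3)*((1/128)*(1/128)) := by nlinarith [sq_nonneg x]
      _ ≤ _ := by gcongr
  · intro k
    rw [add_zero]
    have hh : logDeriv (fun s => χ.LFunction s * χ'.LFunction s) =ᶠ[𝓝 ((9/8:ℝ)+t*I:ℂ)] fun s => logDeriv χ.LFunction s + logDeriv χ'.LFunction s := by
      filter_upwards [hd1.continuous.continuousAt.eventually_ne n1, hd2.continuous.continuousAt.eventually_ne n2] with s s1 s2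
      exact logDeriv_mul s s1 s2 (hd1 s) (hd2 s)
    rw [hh.iteratedDeriv_eq]
    rw [iteratedDeriv_fun_add]
    · unfold VV; ring
    · have a1 : AnalyticAt ℂ χ.LFunction ((9/8:ℝ)+t*I:ℂ) := hd1.analyticAt _
      exact (a1.deriv.div a1 n1).contDiffAt
    · have a1 : AnalyticAt ℂ χ'.LFunction ((9/8:ℝ)+t*I:ℂ) := hd2.analyticAt _
      exact (a1.deriv.div a1 n2).contDiffAt
  · intro k; rw [norm_zero]; positivity
  · intro z hz _ _
    have : χ.LFunction z = 0 := hz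
    simp [this]
end

section
open Complex Metric Set Filter Topology

lemma pow_sub_pow_le {a b : ℂ} {r : ℝ} (ha : ‖a‖ ≤ r) (hb : ‖b‖ ≤ r) (n : ℕ) : ‖a^(n+1) - b^(n+1)‖ ≤ (n+1)*r^n*‖a-b‖ := by
  have hr : 0 ≤ r := (norm_nonneg a).trans ha
  induction n with
  | zero => simp
  | succ n ih =>
    have : a^(n+1+1) - b^(n+1+1) = a*(a^(n+1)-b^(n+1)) + (a-b)*b^(n+1) := by ring
    rw [this]
    refine (norm_add_le _ _).trans ?_
    rw [norm_mul, norm_mul, norm_pow]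
    calc ‖a‖ * ‖a^(n+1)-b^(n+1)‖ + ‖a-b‖*‖b‖^(n+1) ≤ r * ((n+1)*r^n*‖a-b‖) + ‖a-b‖*r^(n+1) := by gcongr
      _ = _ := by push_cast; ring

lemma dslope_bound {q : ℕ} [NeZero q] {χ : DirichletCharacter ℂ q} (h1 : χ ≠ 1) {β : ℝ} (hβ : 9/10 ≤ β) (hβ1 : β ≤ 1)
    (hz : χ.LFunction β = 0) {t : ℝ} {s : ℂ} (hs : s ∈ closedBall ((9/8:ℝ) + t*I : ℂ) 1) :
    ‖dslope χ.LFunction (β:ℂ) s‖ ≤ 16*(513*(q*(2+|t|))) := by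
  have ht := abs_nonneg t
  have hq0 : (0:ℝ) ≤ q := by positivity
  have hd := DirichletCharacter.differentiable_LFunction h1
  have hds : Differentiable ℂ (dslope χ.LFunction (β:ℂ)) := differentiable_dslope' hd _
  have key : ∀ z : ℂ, 1/16 ≤ ‖z-β‖ → 1/16 < z.re → z.re < 3 → ‖z‖ ≤ 2*(2+|t|) → ‖dslope χ.LFunction (β:ℂ) z‖ ≤ 16*(513*(q*(2+|t|))) := by
    intro z k1 k2 k3 k4
    have hne : z ≠ β := by rintro rfl; simp at k1; norm_num at k1
    rw [dslope_of_ne _ hne, slope_def_field, hz, sub_zero, norm_div]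
    have u := L_bound h1 k2 k3
    have u3 : (q:ℝ)*(1+256*‖z‖) ≤ 513*(q*(2+|t|)) := by nlinarith
    rw [div_le_iff₀ (by linarith)]
    have hX : 0 ≤ 513*(q*(2+|t|)) := by positivity
    have := mul_le_mul_of_nonneg_left k1 hX
    linarith
  obtain ⟨b1, b2, b3, b4⟩ := ball_facts hs
  by_cases hc : 1/16 ≤ ‖s-β‖
  · exact key s hc (by linarith) (by linarith) b3
  · refine Complex.norm_le_of_forall_mem_frontier_norm_le (U := ball (β:ℂ) (1/16)) isBounded_ball hds.diffContOnCl ?_ (subset_closure ?_)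
    · intro z hz
      rw [frontier_ball _ (by norm_num), mem_sphere, dist_eq_norm] at hz
      have h2 := abs_le.mp ((abs_re_le_norm _).trans hz.le)
      simp only [sub_re, ofReal_re] at h2
      refine key z hz.ge (by linarith) (by linarith) ?_
      have := norm_add_le (z-β) β
      rw [sub_add_cancel, hz, norm_real, Real.norm_of_nonneg (by linarith)] at this
      linarith
    · rw [mem_ball, dist_eq_norm]; linarith

lemma pair_special {q : ℕ} [NeZero q] (hq : 3 ≤ q) {χ : DirichletCharacter ℂ q} (h1 : χ ≠ 1) {β δ : ℝ} (hβ : β = 1 - δ) (hδ : 0 < δ) (hδ1 : δ ≤ 1/10)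
    (hz : χ.LFunction β = 0) (t : ℝ) :
    PairOK β δ (20*Real.log (q*(2+|t|))) ((9/8:ℝ)+t*I) (fun k => VV (1:DirichletCharacter ℂ q) k ((9/8:ℝ)+t*I) + VV χ k ((9/8:ℝ)+t*I))
      {z | (1:DirichletCharacter ℂ q).LFunction z = 0 ∨ χ.LFunction z = 0} := by
  have hq' : (3:ℝ) ≤ q := by exact_mod_cast hq
  have ht := abs_nonneg t
  have hx : 6 ≤ q*(2+|t|) := by nlinarith
  have c1 := center_facts (1:DirichletCharacter ℂ q) t
  have c2 := center_facts χ t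
  have hd := DirichletCharacter.differentiable_LFunction h1
  have hds : Differentiable ℂ (dslope χ.LFunction (β:ℂ)) := differentiable_dslope' hd _
  have hL := L1_diff (1:DirichletCharacter ℂ q)
  set c : ℂ := (9/8:ℝ)+t*I with hc
  have hcre : c.re = 9/8 := by simp [hc]
  have hcβ : 1/8 ≤ ‖c - β‖ := by
    refine le_trans ?_ (re_le_norm _)
    rw [sub_re, hcre, ofReal_re]; linarith
  have hc1 : 1/8 ≤ ‖c - 1‖ := by
    refine le_trans ?_ (re_le_norm _)
    rw [sub_re, hcre, one_re]; linarith
  have nβ : c - β ≠ 0 := by intro h; rw [h] at hcβ; norm_num at hcβ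
  have n1 : c - 1 ≠ 0 := by intro h; rw [h] at hc1; norm_num at hc1
  have m1 : (1:DirichletCharacter ℂ q).LFunction c ≠ 0 := fun h => by rw [h] at c1; norm_num at c1
  have m2 : χ.LFunction c ≠ 0 := fun h => by rw [h] at c2; norm_num at c2
  have ds : ∀ s : ℂ, s ≠ β → dslope χ.LFunction (β:ℂ) s = χ.LFunction s / (s-β) := by
    intro s hs; rw [dslope_of_ne _ hs, slope_def_field, hz, sub_zero]
  have hΦc : L1 (1:DirichletCharacter ℂ q) c * dslope χ.LFunction (β:ℂ) c = (c-1) * (1:DirichletCharacter ℂ q).LFunction c * (χ.LFunction c/(c-β)) := by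
    rw [ds c (sub_ne_zero.mp nβ), L1_eq _ (sub_ne_zero.mp n1)]
  refine pair_core (Φ := fun s => L1 (1:DirichletCharacter ℂ q) s * dslope χ.LFunction (β:ℂ) s) (hL.mul hds) ?_ ?_ 
    (fun k => k.factorial*((1/(c-1))^(k+1) - (1/(c-β))^(k+1))) ?_ ?_ ?_
  · show L1 (1:DirichletCharacter ℂ q) c * dslope χ.LFunction (β:ℂ) c ≠ 0
    rw [hΦc]
    exact mul_ne_zero (mul_ne_zero n1 m1) (div_ne_zero m2 nβ)
  · intro s hs
    obtain ⟨b1, b2, b3, b4⟩ := ball_facts hs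
    have u1 := L1_bound (1:DirichletCharacter ℂ q) (s := s) (by linarith) (by linarith)
    have u2 := dslope_bound h1 (by linarith) (by linarith) hz hs
    show ‖L1 (1:DirichletCharacter ℂ q) s * dslope χ.LFunction (β:ℂ) s‖ ≤ _ * ‖L1 (1:DirichletCharacter ℂ q) c * dslope χ.LFunction (β:ℂ) c‖
    rw [hΦc]
    have lower : (1/2)*((1/128)*(1/128)) ≤ ‖(c-1) * (1:DirichletCharacter ℂ q).LFunction c * (χ.LFunction c/(c-β))‖ := by
      have : (c-1) * (1:DirichletCharacter ℂ q).LFunction c * (χ.LFunction c/(c-β)) = ((c-1)/(c-β)) * ((1:DirichletCharacter ℂ q).LFunction c * χ.LFunction c) := by ring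
      rw [this, norm_mul, norm_mul, norm_div]
      have : 1/2 ≤ ‖c-1‖/‖c-β‖ := by
        rw [le_div_iff₀ (by linarith)]
        have := norm_add_le (c-1) (δ:ℂ)
        rw [norm_real, Real.norm_of_nonneg hδ.le] at this
        have e : c - 1 + δ = c - β := by rw [hβ]; push_cast; ring
        rw [e] at this
        linarith
      gcongr
    have u3 : (q:ℝ)*(‖s-1‖+1+256*‖s-1‖*‖s‖) ≤ 1030*(q*(2+|t|)^2) := by
      have : ‖s-1‖+1+256*‖s-1‖*‖s‖ ≤ 1030*(2+|t|)^2 := by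
        have : ‖s-1‖*‖s‖ ≤ (2*(2+|t|))*(2*(2+|t|)) := by gcongr
        nlinarith
      nlinarith
    have u4 : (q:ℝ)*(2+|t|)^2 ≤ (q*(2+|t|))^2 := by
      rw [mul_pow]; gcongr; nlinarith
    set x := (q:ℝ)*(2+|t|)
    have e := exp20 hx
    rw [norm_mul]
    calc _ ≤ (1030*x^2)*(16*(513*x)) := by
          gcongr; linarith
      _ = (1030*16*513)*x^3 := by ring
      _ ≤ (300000000000*x^3)*((1/2)*((1/128)*(1/128))) := by
          have : 0 ≤ x^3 := by positivity
          nlinarith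
      _ ≤ _ := by gcongr
  · intro k
    have a1 : AnalyticAt ℂ (L1 (1:DirichletCharacter ℂ q)) c := hL.analyticAt _
    have hΦne : L1 (1:DirichletCharacter ℂ q) c * dslope χ.LFunction (β:ℂ) c ≠ 0 := by
      rw [hΦc]; exact mul_ne_zero (mul_ne_zero n1 m1) (div_ne_zero m2 nβ)
    have aΦ : AnalyticAt ℂ (fun s => L1 (1:DirichletCharacter ℂ q) s * dslope χ.LFunction (β:ℂ) s) c := (hL.mul hds).analyticAt _
    have ev1 : ∀ᶠ s in 𝓝 c, s ≠ 1 := eventually_ne_nhds (sub_ne_zero.mp n1)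
    have evβ : ∀ᶠ s in 𝓝 c, s ≠ (β:ℂ) := eventually_ne_nhds (sub_ne_zero.mp nβ)
    have evs : ∀ᶠ s in 𝓝 c, 1 < s.re := continuous_re.continuousAt.eventually_const_lt (by rw [hcre]; norm_num)
    have hh : (fun s => logDeriv (1:DirichletCharacter ℂ q).LFunction s + logDeriv χ.LFunction s) =ᶠ[𝓝 c] 
        fun s => (logDeriv (fun s => L1 (1:DirichletCharacter ℂ q) s * dslope χ.LFunction (β:ℂ) s) s + 1/(s-β)) - 1/(s-1) := by
      filter_upwards [ev1, evβ, evs] with s s1 s2 s3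
      have p1 : (1:DirichletCharacter ℂ q).LFunction s ≠ 0 := DirichletCharacter.LFunction_ne_zero_of_one_le_re _ (Or.inr s1) s3.le
      have p2 : χ.LFunction s ≠ 0 := DirichletCharacter.LFunction_ne_zero_of_one_le_re _ (Or.inr s1) s3.le
      have q1 : L1 (1:DirichletCharacter ℂ q) s ≠ 0 := L1_ne_zero _ s3.le s1
      have q2 : dslope χ.LFunction (β:ℂ) s ≠ 0 := by rw [ds s s2]; exact div_ne_zero p2 (sub_ne_zero.mpr s2)
      rw [logDeriv_mul s q1 q2 (hL s) (hds s), logDeriv_L1 _ s3]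
      have : logDeriv χ.LFunction s = logDeriv (dslope χ.LFunction (β:ℂ)) s + 1/(s-β) := by
        have hfun : χ.LFunction = fun s => (fun s => s-(β:ℂ)) s * dslope χ.LFunction (β:ℂ) s := by
          ext w
          by_cases hw : w = β
          · subst hw; simp [hz]
          · simp only; rw [ds w hw, mul_div_cancel₀ _ (sub_ne_zero.mpr hw)]
        conv_lhs => rw [hfun]
        rw [logDeriv_mul (f := fun s => s-(β:ℂ)) s (sub_ne_zero.mpr s2) q2 (by fun_prop) (hds s)]
        rw [logDeriv_apply (f := fun s => s-(β:ℂ))]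
        simp; ring
      rw [this]; ring
    have an1 : AnalyticAt ℂ (1:DirichletCharacter ℂ q).LFunction c := by
      refine DifferentiableOn.analyticAt (s := {s | s ≠ 1}) (fun s hs => (DirichletCharacter.differentiableAt_LFunction _ s (Or.inl hs)).differentiableWithinAt) (isOpen_ne.mem_nhds (sub_ne_zero.mp n1))
    have an2 : AnalyticAt ℂ χ.LFunction c := hd.analyticAt _
    have e1 : VV (1:DirichletCharacter ℂ q) k c + VV χ k c = (-1)^(k+1) * iteratedDeriv k (fun s => logDeriv (1:DirichletCharacter ℂ q).LFunction s + logDeriv χ.LFunction s) c := by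
      rw [iteratedDeriv_fun_add (f := logDeriv (1:DirichletCharacter ℂ q).LFunction) (g := logDeriv χ.LFunction) (an1.deriv.div an1 m1).contDiffAt (an2.deriv.div an2 m2).contDiffAt]
      unfold VV; ring
    have z1 : AnalyticAt ℂ (fun s : ℂ => 1/(s-β)) c := analyticAt_const.div (by fun_prop) nβ
    have z2 : AnalyticAt ℂ (fun s : ℂ => 1/(s-1)) c := analyticAt_const.div (by fun_prop) n1
    have z3 : AnalyticAt ℂ (logDeriv (fun s => L1 (1:DirichletCharacter ℂ q) s * dslope χ.LFunction (β:ℂ) s)) c := aΦ.deriv.div aΦ hΦne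
    show VV (1:DirichletCharacter ℂ q) k c + VV χ k c = _
    rw [e1, hh.iteratedDeriv_eq, iteratedDeriv_fun_sub (f := fun s => logDeriv (fun s => L1 (1:DirichletCharacter ℂ q) s * dslope χ.LFunction (β:ℂ) s) s + 1/(s-β)) (z3.add z1).contDiffAt z2.contDiffAt, iteratedDeriv_fun_add z3.contDiffAt z1.contDiffAt]
    simp only [one_div]
    rw [iteratedDeriv_inv_sub, iteratedDeriv_inv_sub]
    have : ((-1:ℂ)^k)*(-1)^k = 1 := by rw [← mul_pow]; norm_num
    rw [inv_pow, inv_pow, pow_succ (-1:ℂ) k]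
    linear_combination (k.factorial*(((c-1)^(k+1))⁻¹ - ((c-β)^(k+1))⁻¹)) * this
  · intro k
    rw [norm_mul, norm_natCast]
    gcongr
    have a8 : ‖1/(c-1)‖ ≤ 8 := by rw [norm_div, norm_one, div_le_iff₀ (by linarith)]; linarith
    have b8 : ‖1/(c-β)‖ ≤ 8 := by rw [norm_div, norm_one, div_le_iff₀ (by linarith)]; linarith
    refine (pow_sub_pow_le a8 b8 k).trans ?_
    have : ‖1/(c-1) - 1/(c-β)‖ ≤ 64*δ := by
      have e : 1/(c-1) - 1/(c-β) = δ*((1/(c-1))*(1/(c-β))) := by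
        field_simp; rw [hβ]; push_cast; ring
      rw [e, norm_mul, norm_mul, norm_real, Real.norm_of_nonneg hδ.le]
      have : ‖1/(c-1)‖ * ‖1/(c-β)‖ ≤ 8*8 := by gcongr
      nlinarith
    calc _ ≤ ((k:ℝ)+1)*8^k*(64*δ) := by gcongr
      _ = _ := by ring
  · rintro z (hz1 | hz1) h2 h3
    · have : z ≠ 1 := by rintro rfl; simp at h3
      simp [L1_eq _ this, hz1]
    · simp [ds z h2, hz1]
end

section
open Complex Metric Set Filter Topology

lemma posA {q : ℕ} [NeZero q] {χ₁ : DirichletCharacter ℂ q} (h2 : χ₁^2 = 1) (χ : DirichletCharacter ℂ q) (t : ℝ) (k : ℕ) :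
    0 ≤ (VV (1:DirichletCharacter ℂ q) k ((9/8:ℝ)+(0:ℝ)*I) + VV χ₁ k ((9/8:ℝ)+(0:ℝ)*I)).re + (VV χ k ((9/8:ℝ)+t*I) + VV (χ*χ₁) k ((9/8:ℝ)+t*I)).re := by
  have hσ : (1:ℝ) < 9/8 := by norm_num
  have a1 := VV_hasSum (1:DirichletCharacter ℂ q) k (t := 0) hσ
  have a2 := VV_hasSum χ₁ k (t := 0) hσ
  have a3 := VV_hasSum χ k (t := t) hσ
  have a4 := VV_hasSum (χ*χ₁) k (t := t) hσ
  rw [add_re, add_re]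
  refine HasSum.nonneg (fun n => ?_) ((a1.add a2).add (a3.add a4))
  rw [← mul_add, ← mul_add, ← mul_add]
  rcases eq_or_ne n 0 with rfl | hn
  · simp [gk]
  refine mul_nonneg (gk_nonneg _ _ _) ?_
  by_cases h : χ (n:ZMod q) = 0
  · have hu : ¬ IsUnit (n : ZMod q) := fun hu => by
      obtain ⟨u, hu⟩ := hu
      have := DirichletCharacter.unit_norm_eq_one χ u
      rw [hu, h] at this; simp at this
    unfold zz
    rw [MulChar.map_nonunit _ hu, MulChar.map_nonunit _ hu, MulChar.map_nonunit _ hu, MulChar.map_nonunit _ hu]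
    simp
  · have hu : IsUnit (n : ZMod q) := by
      by_contra hc; exact h (χ.map_nonunit hc)
    have hz := zz_norm χ t hn h
    have b1 := zz_one χ h
    have b2 : zz χ₁ 0 n = χ₁ (n:ZMod q) := by unfold zz; simp
    have b4 : zz (χ*χ₁) t n = χ₁ (n:ZMod q) * zz χ t n := by unfold zz; rw [MulChar.mul_apply]; ring
    have hsq : χ₁ (n:ZMod q)^2 = 1 := by
      rw [← MulChar.pow_apply' _ (by norm_num), h2, MulChar.one_apply hu]
    have hre : -1 ≤ (zz χ t n).re := by
      have := (abs_le.mp ((abs_re_le_norm _).trans hz.le)).1; exact this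
    rw [b1, b2, b4]
    rcases sq_eq_one_iff.mp hsq with e | e
    · rw [e]; simp; linarith
    · rw [e]; simp

lemma sum34 (J : ℕ) : ∑ k ∈ Finset.range J, ((k:ℝ)+1)*(3/4)^(k+1) ≤ 12 := by
  have : ∑ k ∈ Finset.range J, ((k:ℝ)+1)*(3/4)^(k+1) = 12 - (3/4)^J*(12+3*J) := by
    induction J with
    | zero => simp
    | succ J ih => rw [Finset.sum_range_succ, ih]; push_cast; ring
  rw [this]
  have : (0:ℝ) ≤ (3/4)^J*(12+3*J) := by positivity
  linarith

lemma partA {q : ℕ} [NeZero q] (hq : 3 ≤ q) {χ₁ : DirichletCharacter ℂ q} (h1 : χ₁ ≠ 1) (h2 : χ₁^2 = 1) {β δ : ℝ} (hβ : β = 1 - δ) (hδ : 0 < δ)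
    (hδ1 : δ ≤ 1/10) (hz : χ₁.LFunction β = 0) (χ : DirichletCharacter ℂ q) {ρ : ℂ} (hρ : χ.LFunction ρ = 0) (hρβ : ρ ≠ β) (hρ1 : ρ.re < 1)
    (hε : 1 - ρ.re ≤ 1/16) : 1 ≤ 12800000*δ*Real.log (q*(2+|ρ.im|))*Real.exp (400000*(1-ρ.re)*Real.log (q*(2+|ρ.im|))) := by
  set t := ρ.im
  have hq' : (3:ℝ) ≤ q := by exact_mod_cast hq
  have ht := abs_nonneg t
  have hx : 6 ≤ q*(2+|t|) := by nlinarith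
  set x := Real.log (q*(2+|t|)) with hxd
  have hx1 : 1 ≤ x := by
    rw [hxd, Real.le_log_iff_exp_le (by linarith)]
    have := Real.exp_one_lt_d9; linarith
  have hx0 : Real.log (q*(2+|(0:ℝ)|)) ≤ x := by
    refine Real.log_le_log (by rw [abs_zero]; positivity) ?_
    rw [abs_zero]; gcongr
  have P0 := pair_special hq h1 hβ hδ hδ1 hz 0
  have P1 : PairOK β δ (20*x) ((9/8:ℝ)+t*I) (fun k => VV χ k ((9/8:ℝ)+t*I) + VV (χ*χ₁) k ((9/8:ℝ)+t*I)) {z | χ.LFunction z = 0} := by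
    by_cases e1 : χ = 1
    · subst e1
      have := pair_special hq h1 hβ hδ hδ1 hz t
      rw [one_mul]
      obtain ⟨Z, a, b, c⟩ := this
      exact ⟨Z, a, fun z hz h => b z hz (Or.inl h), c⟩
    · by_cases e2 : χ = χ₁
      · subst e2
        have := pair_special hq h1 hβ hδ hδ1 hz t
        rw [← pow_two, h2]
        obtain ⟨Z, a, b, c, d⟩ := this
        refine ⟨Z, a, fun z hz h => b z hz (Or.inr h), c, fun k => ?_⟩
        have := d k
        simp only at this ⊢
        rwa [add_comm]
      · refine pair_general hq e1 (fun h => e2 ?_) β hδ.le t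
        have : χ * χ₁ * χ₁ = χ₁ := by rw [h, one_mul]
        rwa [mul_assoc, ← pow_two, h2, mul_one] at this
  obtain ⟨Z0, a0, b0, c0, d0⟩ := P0
  obtain ⟨Z1, a1, b1, c1, d1⟩ := P1
  set M := 20*x with hM
  set C0 : ℂ := (9/8:ℝ)+(0:ℝ)*I with hC0
  set C1 : ℂ := (9/8:ℝ)+t*I with hC1
  have hw : C1 - ρ = ((9/8 - ρ.re : ℝ):ℂ) := by
    apply Complex.ext
    · simp [hC1]
    · simp [hC1, t]
  have hwn : ‖C1 - ρ‖ = 9/8 - ρ.re := by rw [hw, norm_real, Real.norm_of_nonneg (by linarith)]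
  have hρZ : ρ ∈ Z1 := b1 ρ (by rw [mem_closedBall, dist_comm, dist_eq_norm, hwn]; linarith) hρ hρβ hρ1
  set ε := 1 - ρ.re with hεd
  have hε0 : 0 < ε := by linarith
  set B : ℕ → ℝ := fun k => 2*((k+1)*δ*8^(k+2)) + 12*M*((k+1)*4^(k+1)) with hB
  have hM0 : 0 < M := by linarith
  have hTu : ∀ J : ℕ, (J:ℝ)/4 ≤ (Z0.map (fun z => C0 - z) + Z1.map (fun z => C1 - z)).card + 2*∑ k ∈ Finset.range J, (1/8+ε)^(k+1)*B k := by
    intro J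
    refine turan _ ?_ (w0 := C1 - ρ) ?_ (by rw [hwn]; linarith) B (fun k => by positivity) ?_ J
    · intro w hw
      rcases Multiset.mem_add.mp hw with h | h
      · obtain ⟨z, hz, rfl⟩ := Multiset.mem_map.mp h; exact a0 z hz
      · obtain ⟨z, hz, rfl⟩ := Multiset.mem_map.mp h; exact a1 z hz
    · exact Multiset.mem_add.mpr (Or.inr (Multiset.mem_map_of_mem _ hρZ))
    · intro k
      rw [Multiset.map_add, Multiset.map_map, Multiset.map_map, Multiset.sum_add]
      have p := posA h2 χ t k
      have p0 := d0 k
      have p1 := d1 k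
      simp only [Function.comp_def]
      set S0 := (Z0.map (fun z => (1/(C0-z)^(k+1)).re)).sum
      set S1 := (Z1.map (fun z => (1/(C1-z)^(k+1)).re)).sum
      have hk : (0:ℝ) < k.factorial := by positivity
      have hf : ((k+1).factorial:ℝ) = (k+1)*k.factorial := by rw [Nat.factorial_succ]; push_cast; ring
      have hm : 6*(20*Real.log (q*(2+|(0:ℝ)|)))*(k+1).factorial*4^(k+1) ≤ 6*M*(k+1).factorial*4^(k+1) := by
        gcongr; linarith
      have : k.factorial*(S0+S1) ≤ k.factorial * B k := by
        have e : k.factorial*B k = 2*(k.factorial * ((k+1)*δ*8^(k+2))) + 2*(6*M*(k+1).factorial*4^(k+1)) := by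
          rw [hf, hB]; ring
        rw [e]
        simp only at p0 p1
        linarith
      exact le_of_mul_le_mul_left this hk
  set J := ⌈46560*x⌉₊ with hJ
  have J1 : 46560*x ≤ J := Nat.le_ceil _
  have J2 : (J:ℝ) ≤ 50000*x := by
    have := Nat.ceil_lt_add_one (a := 46560*x) (by linarith)
    linarith
  have T := hTu J
  have hcard : ((Z0.map (fun z => C0 - z) + Z1.map (fun z => C1 - z)).card:ℝ) ≤ 3*M := by
    rw [Multiset.card_add, Multiset.card_map, Multiset.card_map]
    push_cast
    have l2 := Real.log_two_gt_d9
    have : ((Z0.card:ℝ)+Z1.card)*Real.log 2 ≤ 2*M := by linarith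
    have h0 : (0:ℝ) ≤ (Z0.card:ℝ)+Z1.card := by positivity
    nlinarith
  have hsum : ∑ k ∈ Finset.range J, (1/8+ε)^(k+1)*B k ≤ 144*M + 16*J^2*δ*Real.exp (8*ε*J) := by
    have hk : ∀ k ∈ Finset.range J, (1/8+ε)^(k+1)*B k ≤ 16*J*δ*Real.exp (8*ε*J) + 12*M*(((k:ℝ)+1)*(3/4)^(k+1)) := by
      intro k hk
      have hkJ : (k:ℝ)+1 ≤ J := by exact_mod_cast Finset.mem_range.mp hk
      have e : (1/8+ε)^(k+1)*B k = 16*(k+1)*δ*(1+8*ε)^(k+1) + 12*M*((k+1)*(4*(1/8+ε))^(k+1)) := by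
        have : (1+8*ε) = 8*(1/8+ε) := by ring
        rw [hB, this, mul_pow 8, mul_pow 4]; ring
      rw [e]
      have e1 : (1+8*ε)^(k+1) ≤ Real.exp (8*ε*J) := by
        calc (1+8*ε)^(k+1) ≤ (Real.exp (8*ε))^(k+1) := by
              gcongr; linarith [Real.add_one_le_exp (8*ε)]
          _ = Real.exp (8*ε*(k+1)) := by rw [← Real.exp_nat_mul]; congr 1; push_cast; ring
          _ ≤ _ := by gcongr
      have e2 : (4*(1/8+ε))^(k+1) ≤ (3/4)^(k+1) := by gcongr; linarith
      gcongr
    refine (Finset.sum_le_sum hk).trans ?_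
    rw [Finset.sum_add_distrib, Finset.sum_const, ← Finset.mul_sum, Finset.card_range, nsmul_eq_mul]
    have := sum34 J
    nlinarith
  have hJ0 : (0:ℝ) < J := by linarith
  have main : (J:ℝ)*1 ≤ J*(256*J*δ*Real.exp (8*ε*J)) := by
    nlinarith
  have main2 := le_of_mul_le_mul_left main hJ0
  refine main2.trans ?_
  have e1 : Real.exp (8*ε*J) ≤ Real.exp (400000*ε*x) := by
    apply Real.exp_le_exp.mpr; nlinarith
  calc 256*J*δ*Real.exp (8*ε*J) ≤ 256*(50000*x)*δ*Real.exp (400000*ε*x) := by gcongr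
    _ = _ := by ring
end

section
open Complex Metric Set Filter Topology

lemma chi_sum_block {q : ℕ} [NeZero q] {χ : DirichletCharacter ℂ q} (hχ : χ ≠ 1) (a : ℕ) :
    ∑ n ∈ Finset.range (a*q), χ ((n+1:ℕ):ZMod q) = 0 := by
  have hq : (q:ℂ) ≠ 0 := by exact_mod_cast NeZero.ne q
  have h0 : ∑ a ∈ Finset.range q, χ ((a+1 : ℕ) : ZMod q) = 0 := by
    have := avgc_zero hχ
    unfold avgc at this
    simpa [hq] using this
  induction a with
  | zero => simp
  | succ a ih =>
    rw [add_mul, one_mul, Finset.sum_range_add, ih, zero_add, ← h0]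
    refine Finset.sum_congr rfl fun n _ => ?_
    rw [add_assoc, chi_period]

lemma chi_sum_le {q : ℕ} [NeZero q] {χ : DirichletCharacter ℂ q} (hχ : χ ≠ 1) (N : ℕ) :
    ‖∑ n ∈ Finset.range N, χ ((n+1:ℕ):ZMod q)‖ ≤ q := by
  have e : N = (N/q)*q + N % q := by rw [mul_comm]; exact (Nat.div_add_mod N q).symm
  rw [e, Finset.sum_range_add, chi_sum_block hχ, zero_add]
  refine (norm_sum_le _ _).trans ?_
  refine (Finset.sum_le_sum fun n _ => norm_chi_le χ _).trans ?_
  simp only [Finset.sum_const, Finset.card_range, nsmul_eq_mul, mul_one]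
  exact_mod_cast (Nat.mod_lt N (Nat.pos_of_ne_zero (NeZero.ne q))).le

lemma psum_one_tendsto {q : ℕ} [NeZero q] {χ : DirichletCharacter ℂ q} (hχ : χ ≠ 1) {M : ℕ} (hM : 0 < M) :
    ‖χ.LFunction 1 - psum χ (M*q) 1‖ ≤ 64/M := by
  have h0 : 0 < q := Nat.pos_of_ne_zero (NeZero.ne q)
  have hM' : (0:ℝ) < M := by exact_mod_cast hM
  have hq' : (0:ℝ) < q := by exact_mod_cast h0
  have key : ∀ s : ℂ, 0 < s.re → s.re ≤ 3 → s ≠ 1 → ‖χ.LFunction s - psum χ (M*q) s‖ ≤ 16/s.re*‖s‖*(q:ℝ)^(1-s.re)*(M:ℝ)^(-s.re) := by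
    intro s hs hs3 hs1
    have h1 := blk_tsum_le h0 χ hM hs hs3
    have h2 := L1_formula χ hM hs
    rw [avgc_zero hχ, zero_mul, add_zero, L1_eq χ hs1] at h2
    have h3 : (s-1)*(χ.LFunction s - psum χ (M*q) s) = ∑' j, blk χ (M+j) s := by rw [mul_sub, h2]; ring
    rw [← h3, norm_mul] at h1
    refine le_of_mul_le_mul_left (h1.trans (le_of_eq (by ring))) (norm_pos_iff.mpr (sub_ne_zero.mpr hs1))
  have hc : Continuous (fun s => ‖χ.LFunction s - psum χ (M*q) s‖) := by
    have := (DirichletCharacter.differentiable_LFunction hχ).continuous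
    unfold psum
    refine (this.sub (continuous_finset_sum _ fun n _ => continuous_const.mul ?_)).norm
    refine continuous_neg.const_cpow (Or.inl ?_)
    exact_mod_cast Nat.succ_ne_zero n
  have hc2 : ContinuousAt (fun s : ℂ => 16/s.re*‖s‖*(q:ℝ)^(1-s.re)*(M:ℝ)^(-s.re)) 1 := by
    have c1 : ContinuousAt (fun s : ℂ => s.re) 1 := continuous_re.continuousAt
    refine ((((continuousAt_const.div c1 (by simp)).mul continuous_norm.continuousAt).mul ?_).mul ?_)
    · exact ContinuousAt.rpow continuousAt_const (continuousAt_const.sub c1) (Or.inl hq'.ne')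
    · exact ContinuousAt.rpow continuousAt_const c1.neg (Or.inl hM'.ne')
  have t1 : Tendsto (fun s => ‖χ.LFunction s - psum χ (M*q) s‖) (𝓝[≠] 1) (𝓝 ‖χ.LFunction 1 - psum χ (M*q) 1‖) :=
    (hc.tendsto 1).mono_left nhdsWithin_le_nhds
  have t2 := hc2.tendsto.mono_left (nhdsWithin_le_nhds (s := {1}ᶜ))
  have := le_of_tendsto_of_tendsto t1 t2 (by
    have e1 : ∀ᶠ s : ℂ in 𝓝[≠] 1, 0 < s.re := (continuous_re.continuousAt.eventually_const_lt (by simp)).filter_mono nhdsWithin_le_nhds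
    have e2 : ∀ᶠ s : ℂ in 𝓝[≠] 1, s.re < 3 := (continuous_re.continuousAt.eventually_lt_const (by simp)).filter_mono nhdsWithin_le_nhds
    filter_upwards [e1, e2, self_mem_nhdsWithin] with s a b c
    exact key s a b.le c)
  refine this.trans ?_
  simp only [one_re, norm_one, sub_self, Real.rpow_zero, Real.rpow_neg_one, div_one, mul_one]
  rw [div_eq_mul_inv]; gcongr; norm_num

noncomputable def phi (u : ℝ) : ℝ := 1/u - 1/(Real.exp u - 1)

lemma phi_nonneg {u : ℝ} (hu : 0 < u) : 0 ≤ phi u := by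
  have := Real.add_one_le_exp u
  unfold phi
  rw [sub_nonneg]
  exact one_div_le_one_div_of_le hu (by linarith)

lemma phi_le {u : ℝ} (hu : 0 < u) : phi u ≤ 1 := by
  have h1 := Real.add_one_lt_exp hu.ne'
  unfold phi
  have h2 := Real.add_one_le_exp (-u)
  have h3 : Real.exp (-u) * Real.exp u = 1 := by rw [← Real.exp_add]; simp
  have he : 0 < Real.exp u := Real.exp_pos u
  rw [div_sub_div _ _ hu.ne' (by linarith), div_le_one (by nlinarith)]
  nlinarith

lemma phi_anti {u v : ℝ} (hu : 0 < u) (huv : u ≤ v) : phi v ≤ phi u := by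
  have hd : ∀ x ∈ Ioi (0:ℝ), HasDerivAt phi (-1/x^2 + Real.exp x/(Real.exp x-1)^2) x := by
    intro x hx
    have hx0 : 0 < x := hx
    have h1 := Real.add_one_lt_exp hx0.ne'
    have a := (hasDerivAt_inv hx0.ne').sub (((Real.hasDerivAt_exp x).sub_const 1).inv (by linarith))
    refine (a.congr_of_eventuallyEq ?_).congr_deriv ?_
    · filter_upwards with z; simp [phi]
    · ring
  have hanti : AntitoneOn phi (Ioi 0) := by
    refine antitoneOn_of_deriv_nonpos (convex_Ioi 0) (fun x hx => (hd x hx).continuousAt.continuousWithinAt) 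
      (fun x hx => (hd x (interior_subset hx)).differentiableAt.differentiableWithinAt) ?_
    intro x hx
    have hx0 : 0 < x := interior_subset hx
    rw [(hd x hx0).deriv]
    have h1 := Real.add_one_lt_exp hx0.ne'
    have h2 : x/2 ≤ Real.sinh (x/2) := Real.self_le_sinh_iff.mpr (by linarith)
    rw [Real.sinh_eq] at h2
    set w := Real.exp (x/2) with hw
    have hw0 : 0 < w := Real.exp_pos _
    have hw2 : Real.exp x = w^2 := by rw [hw, ← Real.exp_nat_mul]; congr 1; push_cast; ring
    have hw3 : Real.exp (-(x/2)) * w = 1 := by rw [hw, ← Real.exp_add]; simp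
    have h4 : x*w ≤ Real.exp x - 1 := by rw [hw2]; nlinarith
    have : Real.exp x/(Real.exp x-1)^2 ≤ 1/x^2 := by
      have hp : 0 < Real.exp x - 1 := by linarith
      rw [div_le_div_iff₀ (by positivity) (by positivity), one_mul, hw2, ← mul_pow, ← hw2]
      rw [mul_comm w x]
      gcongr
    rw [neg_div]; linarith
  exact hanti hu (lt_of_lt_of_le hu huv) huv
end

section
open Complex Metric Set Filter Topology

lemma zetaMul_apply' {q : ℕ} (χ : DirichletCharacter ℂ q) {n : ℕ} (hn : n ≠ 0) : χ.zetaMul n = ∑ i ∈ n.divisors, χ (i:ZMod q) := by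
  rw [DirichletCharacter.zetaMul, ArithmeticFunction.coe_zeta_mul_apply]
  refine Finset.sum_congr rfl fun i hi => ?_
  have : i ≠ 0 := by rintro rfl; simp at hi
  simp [toArithmeticFunction, this]

open scoped ComplexOrder in
lemma zetaMul_re_nonneg {q : ℕ} {χ : DirichletCharacter ℂ q} (h2 : χ^2 = 1) (n : ℕ) : 0 ≤ (χ.zetaMul n).re :=
  (Complex.le_def.mp (DirichletCharacter.zetaMul_nonneg h2 n)).1

open scoped ComplexOrder in
lemma zetaMul_pp {q : ℕ} {χ : DirichletCharacter ℂ q} (h2 : χ^2 = 1) {p : ℕ} (hp : p.Prime) (k : ℕ) : 1 ≤ χ.zetaMul (p^(2*k)) := by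
  rw [zetaMul_apply' χ (pow_ne_zero _ hp.ne_zero), Nat.sum_divisors_prime_pow hp]
  simp only [Nat.cast_pow, map_pow]
  rcases MulChar.isQuadratic_iff_sq_eq_one.mpr h2 p with h | h | h
  · rw [h, Finset.sum_range_succ']; simp
  · rw [h]; simp
    norm_cast; omega
  · rw [h, Finset.sum_range_succ]
    have : ∑ i ∈ Finset.range (2*k), (-1:ℂ)^i = 0 := by
      induction k with
      | zero => simp
      | succ k ih => rw [show 2*(k+1) = 2*k+1+1 by ring, Finset.sum_range_succ, Finset.sum_range_succ, ih]; simp [pow_succ]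
    rw [this]; simp

open scoped ComplexOrder in
lemma zetaMul_sq {q : ℕ} {χ : DirichletCharacter ℂ q} (h2 : χ^2 = 1) {m : ℕ} (hm : m ≠ 0) : 1 ≤ (χ.zetaMul (m^2)).re := by
  have : (1:ℂ) ≤ χ.zetaMul (m^2) := by
    rw [χ.isMultiplicative_zetaMul.multiplicative_factorization _ (pow_ne_zero 2 hm)]
    rw [Nat.factorization_pow]
    unfold Finsupp.prod
    have : ∀ s : Finset ℕ, (∀ p ∈ s, p.Prime) → (1:ℂ) ≤ ∏ a ∈ s, χ.zetaMul (a ^ ((2 • m.factorization) a)) := by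
      intro s
      induction s using Finset.induction_on with
      | empty => simp
      | insert a s ha ih =>
        intro hs
        rw [Finset.prod_insert ha]
        have i1 := ih fun p hp => hs p (Finset.mem_insert_of_mem hp)
        have i2 := zetaMul_pp h2 (hs a (Finset.mem_insert_self _ _)) (m.factorization a)
        have : (2 • m.factorization) a = 2 * m.factorization a := by simp
        rw [this]
        calc (1:ℂ) = 1*1 := by ring
          _ ≤ _ := mul_le_mul i2 i1 (by norm_num) (le_trans (by norm_num) i2)
    refine this _ fun p hp => ?_
    have : p ∈ (m^2).primeFactors := by
      rw [← Nat.support_factorization, Nat.factorization_pow]; exact hp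
    exact Nat.prime_of_mem_primeFactors this
  exact (Complex.le_def.mp this).1

lemma lambert {q : ℕ} (χ : DirichletCharacter ℂ q) {r : ℝ} (hr0 : 0 < r) (hr1 : r < 1) :
    ∃ S : ℂ, HasSum (fun d : ℕ+ => χ ((d:ℕ):ZMod q) * ((r:ℂ)^(d:ℕ)/(1-(r:ℂ)^(d:ℕ)))) S ∧
      HasSum (fun n : ℕ+ => χ.zetaMul n * (r:ℂ)^(n:ℕ)) S := by
  have hrn : ‖(r:ℂ)‖ < 1 := by rw [norm_real, Real.norm_of_nonneg hr0.le]; exact hr1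
  have hs0 := summable_prod_mul_pow (𝕜 := ℂ) 0 hrn
  have hs : Summable fun c : ℕ+ × ℕ+ => χ ((c.1:ℕ):ZMod q) * (r:ℂ)^((c.1:ℕ)*(c.2:ℕ)) := by
    refine Summable.of_norm_bounded hs0.norm fun c => ?_
    rw [norm_mul, norm_mul, pow_zero, norm_one]
    gcongr; exact norm_chi_le χ _
  obtain ⟨S, hS⟩ := hs
  refine ⟨S, ?_, ?_⟩
  · refine HasSum.prod_fiberwise hS fun d => ?_
    have hd : ‖(r:ℂ)^(d:ℕ)‖ < 1 := by rw [norm_pow]; exact pow_lt_one₀ (norm_nonneg _) hrn d.ne_zero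
    have g := (hasSum_geometric_of_norm_lt_one hd).mul_left ((r:ℂ)^(d:ℕ))
    rw [← div_eq_mul_inv] at g
    have key : HasSum (fun i : ℕ+ => (r:ℂ)^((d:ℕ)*(i:ℕ))) ((r:ℂ)^(d:ℕ) / (1-(r:ℂ)^(d:ℕ))) := ?_
    · exact key.mul_left (χ ((d:ℕ):ZMod q))
    rw [← Equiv.pnatEquivNat.symm.hasSum_iff]
    have e : (fun i : ℕ+ => (r:ℂ)^((d:ℕ)*(i:ℕ))) ∘ Equiv.pnatEquivNat.symm = fun n : ℕ => (r:ℂ)^(d:ℕ) * ((r:ℂ)^(d:ℕ))^n := by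
      funext m
      simp only [Function.comp_apply, Equiv.pnatEquivNat_symm_apply, Nat.succPNat_coe]
      rw [pow_mul, Nat.succ_eq_add_one, pow_succ]; ring
    rw [e]; exact g
  · have h := sigmaAntidiagonalEquivProd.hasSum_iff.mpr hS
    refine HasSum.sigma h fun n => ?_
    have := hasSum_fintype (fun c : Nat.divisorsAntidiagonal n => χ ((c.1.1:ℕ):ZMod q) * (r:ℂ)^(n:ℕ))
    have e : ∑ c : Nat.divisorsAntidiagonal n, χ ((c.1.1:ℕ):ZMod q) * (r:ℂ)^(n:ℕ) = χ.zetaMul n * (r:ℂ)^(n:ℕ) := by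
      rw [← Finset.sum_mul, zetaMul_apply' χ n.ne_zero]
      congr 1
      rw [Finset.sum_coe_sort (Nat.divisorsAntidiagonal n) (fun c => χ ((c.1:ℕ):ZMod q)), Nat.sum_divisorsAntidiagonal (fun x _ => χ ((x:ℕ):ZMod q))]
    rw [e] at this
    convert this using 1
    funext c
    have hc := (Nat.mem_divisorsAntidiagonal.mp c.2).1
    simp only [Function.comp_apply, sigmaAntidiagonalEquivProd, divisorsAntidiagonalFactors, Equiv.coe_fn_mk, PNat.mk_coe]
    rw [hc]

lemma lambert_lower {q : ℕ} {χ : DirichletCharacter ℂ q} (h2 : χ^2 = 1) {r : ℝ} (hr0 : 0 < r) {S : ℂ}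
    (h : HasSum (fun n : ℕ+ => χ.zetaMul n * (r:ℂ)^(n:ℕ)) S) (K : ℕ) : ∑ m ∈ Finset.range K, r^((m+1)^2) ≤ S.re := by
  have h1 := (Complex.hasSum_iff _ _).mp h |>.1
  have e : ∀ n : ℕ+, (χ.zetaMul n * (r:ℂ)^(n:ℕ)).re = (χ.zetaMul n).re * r^(n:ℕ) := by
    intro n; rw [← ofReal_pow, re_mul_ofReal]
  simp only [e] at h1
  have hinj : Function.Injective (fun m : ℕ => (m.succPNat^2 : ℕ+)) := by
    intro a b hab
    have : (a+1)^2 = (b+1)^2 := by simpa using congrArg (fun n : ℕ+ => (n:ℕ)) hab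
    have := Nat.pow_left_injective (n := 2) (by norm_num) this
    omega
  have := sum_le_hasSum ((Finset.range K).map ⟨_, hinj⟩) (fun n _ => mul_nonneg (zetaMul_re_nonneg h2 _) (by positivity)) h1
  rw [Finset.sum_map] at this
  refine le_trans (Finset.sum_le_sum fun m _ => ?_) this
  have h3 := zetaMul_sq h2 (m := m+1) (by omega)
  simp only [Function.Embedding.coeFn_mk, PNat.pow_coe, Nat.succPNat_coe, Nat.succ_eq_add_one]
  nlinarith [pow_pos hr0 ((m+1)^2)]

lemma L_one_lower {q : ℕ} [NeZero q] {χ : DirichletCharacter ℂ q} (h1 : χ ≠ 1) (h2 : χ^2 = 1) : 1/(36*q) ≤ ‖χ.LFunction 1‖ := by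
  have hq0 : 0 < q := Nat.pos_of_ne_zero (NeZero.ne q)
  have hq : (1:ℝ) ≤ q := by exact_mod_cast hq0
  set y : ℝ := 1/(36*q^2) with hy
  have hy0 : 0 < y := by positivity
  set r := Real.exp (-y) with hr
  have hr0 : 0 < r := Real.exp_pos _
  have hr1 : r < 1 := by rw [hr, Real.exp_lt_one_iff]; linarith
  obtain ⟨S, hS1, hS2⟩ := lambert χ hr0 hr1
  have low := lambert_lower h2 hr0 hS2 (6*q)
  have low2 : 2*(q:ℝ) ≤ S.re := by
    refine le_trans ?_ low
    have : ∀ m ∈ Finset.range (6*q), (1/3:ℝ) ≤ r^((m+1)^2) := by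
      intro m hm
      have hm' : m + 1 ≤ 6*q := Finset.mem_range.mp hm
      have hm2 : ((m:ℝ)+1)^2 ≤ 36*q^2 := by
        have : ((m:ℝ)+1) ≤ 6*q := by exact_mod_cast hm'
        calc ((m:ℝ)+1)^2 ≤ (6*q)^2 := by gcongr
          _ = _ := by ring
      rw [hr, ← Real.exp_nat_mul]
      have : (-1:ℝ) ≤ ((m+1)^2:ℕ) * -y := by
        push_cast
        have : ((m:ℝ)+1)^2*y ≤ 1 := by rw [hy, mul_one_div, div_le_one (by positivity)]; exact hm2
        linarith
      have e := Real.exp_le_exp.mpr this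
      refine le_trans ?_ e
      rw [Real.exp_neg, ← one_div]
      have := Real.exp_one_lt_d9
      exact one_div_le_one_div_of_le (Real.exp_pos _) (by linarith)
    have := Finset.sum_le_sum this
    rw [Finset.sum_const, Finset.card_range, nsmul_eq_mul] at this
    push_cast at this; linarith
  have hN : HasSum (fun n : ℕ => χ ((n+1:ℕ):ZMod q) * ((r:ℂ)^(n+1)/(1-(r:ℂ)^(n+1)))) S := by
    rw [← Equiv.pnatEquivNat.symm.hasSum_iff] at hS1
    refine hS1.congr_fun ?_ |> id
    intro m
    simp
  have ab : ∀ N, ‖∑ n ∈ Finset.range N, (phi ((n+1)*y):ℂ) * χ ((n+1:ℕ):ZMod q)‖ ≤ q := by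
    intro N
    have := abel_ineq (fun n => phi ((n+1)*y)) (fun n => χ ((n+1:ℕ):ZMod q)) (fun n => phi_anti (by positivity) (by push_cast; gcongr; linarith))
      (fun n => phi_nonneg (by positivity)) (N := N) (fun L _ => chi_sum_le h1 L)
    refine this.trans ?_
    have := phi_le (u := ((0:ℕ)+1)*y) (by positivity)
    nlinarith
  have split : ∀ N, ∑ n ∈ Finset.range N, (phi ((n+1)*y):ℂ) * χ ((n+1:ℕ):ZMod q) = 
      psum χ N 1 / y - ∑ n ∈ Finset.range N, χ ((n+1:ℕ):ZMod q) * ((r:ℂ)^(n+1)/(1-(r:ℂ)^(n+1))) := by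
    intro N
    unfold psum
    rw [Finset.sum_div, ← Finset.sum_sub_distrib]
    refine Finset.sum_congr rfl fun n _ => ?_
    have hp : phi ((n+1)*y) = 1/((n+1)*y) - r^(n+1)/(1-r^(n+1)) := by
      unfold phi
      have e : r^(n+1) = (Real.exp ((n+1)*y))⁻¹ := by
        rw [hr, ← Real.exp_nat_mul, ← Real.exp_neg]; congr 1; push_cast; ring
      rw [e]
      have : 1 < Real.exp ((n+1)*y) := Real.one_lt_exp_iff.mpr (by positivity)
      have h3 : Real.exp ((n+1)*y) - 1 ≠ 0 := by linarith
      have h4 : 1 - (Real.exp ((n+1)*y))⁻¹ ≠ 0 := by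
        have := inv_lt_one_of_one_lt₀ this; linarith
      congr 1
      field_simp
    rw [hp]
    push_cast
    rw [cpow_neg_one]
    have : ((n:ℂ)+1) ≠ 0 := by exact_mod_cast Nat.succ_ne_zero n
    have hyc : (y:ℂ) ≠ 0 := by exact_mod_cast hy0.ne'
    field_simp
  have t1 : Tendsto (fun M : ℕ => psum χ (M*q) 1) atTop (𝓝 (χ.LFunction 1)) := by
    rw [tendsto_iff_norm_sub_tendsto_zero]
    refine squeeze_zero' (Eventually.of_forall fun _ => norm_nonneg _) ?_ (tendsto_const_div_atTop_nhds_zero_nat 64)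
    filter_upwards [eventually_gt_atTop 0] with M hM
    rw [norm_sub_rev]; exact psum_one_tendsto h1 hM
  have t2 : Tendsto (fun M : ℕ => M*q) atTop atTop := tendsto_id.atTop_mul_const' hq0
  have t3 := (t1.div_const (y:ℂ)).sub (hN.tendsto_sum_nat.comp t2)
  have fin := le_of_tendsto t3.norm (Eventually.of_forall fun M => by
    have := ab (M*q); rw [split] at this; exact this)
  have f2 := (abs_le.mp ((abs_re_le_norm _).trans fin)).1
  rw [sub_re] at f2
  have f3 : (χ.LFunction 1/y).re ≤ ‖χ.LFunction 1‖/y := by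
    refine (re_le_norm _).trans (le_of_eq ?_)
    rw [norm_div, norm_real, Real.norm_of_nonneg hy0.le]
  have f4 : (q:ℝ) ≤ ‖χ.LFunction 1‖/y := by linarith
  rw [le_div_iff₀ hy0] at f4
  refine le_trans (le_of_eq ?_) f4
  rw [hy]; field_simp
end

section
open Complex Metric Set Filter Topology

lemma delta_lower {q : ℕ} [NeZero q] {χ : DirichletCharacter ℂ q} (h1 : χ ≠ 1) (h2 : χ^2 = 1) {β δ : ℝ} (hβ : β = 1-δ) (hδ : 0 < δ)
    (hδ1 : δ ≤ 1/10) (hz : χ.LFunction β = 0) : 1 ≤ δ * (591000*(q:ℝ)^2) := by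
  have hq0 : 0 < q := Nat.pos_of_ne_zero (NeZero.ne q)
  have hq : (0:ℝ) < q := by exact_mod_cast hq0
  have a := L_one_lower h1 h2
  have b := dslope_bound h1 (by linarith) (by linarith) hz (s := 1) (t := 0) (by
    rw [mem_closedBall, dist_eq_norm]
    have : (1:ℂ) - ((9/8:ℝ)+(0:ℝ)*I) = ((-1/8:ℝ):ℂ) := by push_cast; ring
    rw [this, norm_real]; norm_num)
  have hb1 : (1:ℂ) ≠ β := by
    intro h
    have : (1:ℝ) = β := by exact_mod_cast h
    linarith
  rw [dslope_of_ne _ hb1, slope_def_field, hz, sub_zero, norm_div] at b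
  have e : ‖(1:ℂ) - β‖ = δ := by
    rw [hβ]; push_cast
    rw [sub_sub_cancel, norm_real, Real.norm_of_nonneg hδ.le]
  rw [e, div_le_iff₀ hδ, abs_zero] at b
  have c := a.trans b
  rw [div_le_iff₀ (by positivity)] at c
  nlinarith [mul_pos hδ (mul_pos hq hq)]
end

section
open Complex Metric Set Filter Topology

noncomputable def PP (q : ℕ) (s : ℂ) : ℂ := ∏ p ∈ q.primeFactors, (1 - (p:ℂ)^(-s))

lemma PP_diff (q : ℕ) : Differentiable ℂ (PP q) := by
  unfold PP
  refine Differentiable.fun_finset_prod fun p hp => ?_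
  have : (p:ℂ) ≠ 0 := by exact_mod_cast (Nat.prime_of_mem_primeFactors hp).ne_zero
  refine (differentiable_const _).sub ?_
  exact differentiable_neg.const_cpow (Or.inl this)

lemma PP_real (q : ℕ) (x : ℝ) : PP q x = ((∏ p ∈ q.primeFactors, (1 - (p:ℝ)^(-x)) : ℝ) : ℂ) := by
  unfold PP
  push_cast
  refine Finset.prod_congr rfl fun p _ => ?_
  rw [ofReal_cpow (by positivity)]; push_cast; rfl

lemma PP_factor {p : ℕ} (hp : p.Prime) {x : ℝ} (hx : 0 < x) : (p:ℝ)^(-x) < 1 :=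
  Real.rpow_lt_one_of_one_lt_of_neg (by exact_mod_cast hp.one_lt) (by linarith)

lemma PP_pos (q : ℕ) {x : ℝ} (hx : 0 < x) : 0 < (PP q x).re := by
  rw [PP_real, ofReal_re]
  refine Finset.prod_pos fun p hp => ?_
  linarith [PP_factor (Nat.prime_of_mem_primeFactors hp) hx]

lemma PP_mono (q : ℕ) {x y : ℝ} (hx : 0 < x) (hxy : x ≤ y) : (PP q x).re ≤ (PP q y).re := by
  rw [PP_real, ofReal_re, PP_real, ofReal_re]
  refine Finset.prod_le_prod (fun p hp => ?_) fun p hp => ?_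
  · linarith [PP_factor (Nat.prime_of_mem_primeFactors hp) hx]
  · have : (1:ℝ) ≤ p := by exact_mod_cast (Nat.prime_of_mem_primeFactors hp).one_lt.le
    have := Real.rpow_le_rpow_of_exponent_le this (neg_le_neg hxy)
    linarith

lemma PP_deriv (q : ℕ) : 0 ≤ (deriv (PP q) 1).re := by
  have h := (PP_diff q (1:ℝ)).hasDerivAt.real_of_complex
  rw [hasDerivAt_iff_tendsto_slope] at h
  have h2 := h.mono_left (nhdsWithin_mono (1:ℝ) (fun x (hx : x ∈ Set.Ioi (1:ℝ)) => (Set.mem_Ioi.mp hx).ne'))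
  have := ge_of_tendsto h2 (b := 0) (by
    filter_upwards [self_mem_nhdsWithin] with x hx
    have hx' : (1:ℝ) < x := hx
    rw [slope_def_field]
    exact div_nonneg (sub_nonneg.mpr (PP_mono q (by norm_num) hx'.le)) (by linarith))
  simpa using this

lemma triv_one_ne {q : ℕ} [NeZero q] (hq : 4 ≤ q) : (1:DirichletCharacter ℂ q).LFunction 1 ≠ 0 := by
  have hq0 : 0 < q := by omega
  have hqc : (q:ℂ) ≠ 0 := by exact_mod_cast hq0.ne'
  set S : ℂ := ∑ j : ZMod q, (1:DirichletCharacter ℂ q) j with hS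
  have hSP : S / q = PP q 1 := by
    have a := ZMod.LFunction_residue_one (fun j => (1:DirichletCharacter ℂ q) j)
    have b := DirichletCharacter.LFunctionTrivChar_residue_one (N := q)
    have c := tendsto_nhds_unique a b
    rw [hS, Finset.sum_div] 
    unfold PP
    rw [c]
    refine Finset.prod_congr rfl fun p _ => ?_
    rw [cpow_neg_one]
  have hlim : Tendsto (fun s : ℂ => (1:DirichletCharacter ℂ q).LFunction s - (q:ℂ)^(-s) * (S * (1/Gammaℝ s/(s-1)))) (𝓝[≠] 1)
      (𝓝 ((1:DirichletCharacter ℂ q).LFunction 1)) := by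
    refine Tendsto.mono_left ?_ nhdsWithin_le_nhds
    have : Tendsto (fun s : ℂ => (q:ℂ)^(-s) * ∑ j : ZMod q, (1:DirichletCharacter ℂ q) j * (HurwitzZeta.hurwitzZeta (ZMod.toAddCircle j) s - 1/(s-1)/Gammaℝ s)) (𝓝 1)
        (𝓝 ((q:ℂ)^(-1:ℂ) * ∑ j : ZMod q, (1:DirichletCharacter ℂ q) j * (HurwitzZeta.hurwitzZeta (ZMod.toAddCircle j) 1))) := by
      refine Tendsto.mul ?_ (tendsto_finset_sum _ fun j _ => (HurwitzZeta.tendsto_hurwitzZeta_sub_one_div_nhds_one _).const_mul _)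
      exact ((differentiable_neg.const_cpow (Or.inl hqc)) (1:ℂ)).continuousAt.tendsto
    refine (this.congr fun s => ?_)
    rw [DirichletCharacter.LFunction, ZMod.LFunction, ← mul_sub, hS, Finset.sum_mul, ← Finset.sum_sub_distrib]
    congr 1
    refine Finset.sum_congr rfl fun j _ => ?_
    rw [div_right_comm]; ring
  set h : ℂ → ℂ := fun s => PP q s - PP q 1 * (q:ℂ)^(1-s) with hh
  have hd : HasDerivAt h (deriv (PP q) 1 + PP q 1 * Complex.log q) 1 := by
    have e1 := (PP_diff q 1).hasDerivAt
    have e2 : HasDerivAt (fun s : ℂ => (q:ℂ)^(1-s)) ((q:ℂ)^(1-1:ℂ) * Complex.log q * (-1)) 1 := by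
      have := ((hasDerivAt_id (1:ℂ)).const_sub 1).const_cpow (c := (q:ℂ)) (Or.inl hqc)
      simpa using this
    have := e1.sub (e2.const_mul (PP q 1))
    refine this.congr_deriv ?_
    simp
  rw [hasDerivAt_iff_tendsto_slope] at hd
  have hG : Tendsto (fun s : ℂ => 1/Gammaℝ s) (𝓝[≠] 1) (𝓝 (1/1)) := by
    have := (hasDerivAt_Gammaℝ_one.continuousAt.tendsto.mono_left nhdsWithin_le_nhds : Tendsto Gammaℝ (𝓝[≠] 1) _)
    rw [Gammaℝ_one] at this
    exact Tendsto.div tendsto_const_nhds this one_ne_zero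
  have hPt : Tendsto (PP q) (𝓝[≠] 1) (𝓝 (PP q 1)) := (PP_diff q 1).continuousAt.tendsto.mono_left nhdsWithin_le_nhds
  have hl2 := (hPt.mul ZetaAsymptotics.tendsto_riemannZeta_sub_one_div_Gammaℝ).add (hd.mul hG)
  have heq := tendsto_nhds_unique hlim (hl2.congr' (by
    filter_upwards [self_mem_nhdsWithin] with s hs
    have hs1 : s ≠ 1 := hs
    have hs2 : s - 1 ≠ 0 := sub_ne_zero.mpr hs1
    have e := DirichletCharacter.LFunctionTrivChar_eq_mul_riemannZeta (N := q) hs1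
    rw [DirichletCharacter.LFunctionTrivChar] at e
    rw [e, slope_def_field, hh]
    have e3 : (q:ℂ)^(1-s) = q * (q:ℂ)^(-s) := by rw [sub_eq_add_neg, cpow_add _ _ hqc, cpow_one]
    have e4 : S = PP q 1 * q := by rw [← hSP]; field_simp
    simp only [sub_self, cpow_zero, mul_one, sub_zero, e3, e4]
    unfold PP
    field_simp
    ring))
  rw [heq]
  intro h0
  have h1 := congrArg Complex.re h0
  have hP1 : PP q 1 = ((PP q 1).re : ℂ) := by
    have := PP_real q 1
    rw [ofReal_one] at this; rw [this, ofReal_re]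
  have hPpos : 0 < (PP q 1).re := by simpa using PP_pos q one_pos
  have hl4 : (Complex.log (4*(Real.pi:ℂ))).re = Real.log (4*Real.pi) := by
    rw [Complex.log_re, norm_mul, norm_real, Real.norm_of_nonneg Real.pi_pos.le]; norm_num
  have hlq : (Complex.log (q:ℂ)).re = Real.log q := by rw [Complex.log_re]; simp
  have k1 : Real.log (4*Real.pi) < 2*Real.log q := by
    have : Real.log (4*Real.pi) < Real.log ((q:ℝ)^2) := by
      refine Real.log_lt_log (by positivity) ?_
      have : (4:ℝ) ≤ q := by exact_mod_cast hq
      nlinarith [Real.pi_lt_four]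
    rwa [Real.log_pow] at this
  have hg : 0 < Real.eulerMascheroniConstant := lt_trans (by norm_num) Real.one_half_lt_eulerMascheroniConstant
  rw [hP1] at h1
  have e5 : ((Real.eulerMascheroniConstant - Complex.log (4*(Real.pi:ℂ)))/2 : ℂ).re = (Real.eulerMascheroniConstant - Real.log (4*Real.pi))/2 := by
    rw [← hl4]; simp [Complex.sub_re]
  simp only [div_one, mul_one, add_re, re_ofReal_mul, e5, hlq, zero_re] at h1
  nlinarith [PP_deriv q]
end

section
open Complex Metric Set Filter Topology

lemma zero_re_lt {q : ℕ} [NeZero q] (hq : 4 ≤ q) {χ : DirichletCharacter ℂ q} {ρ : ℂ} (h : χ.LFunction ρ = 0) : ρ.re < 1 := by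
  by_contra hc
  rw [not_lt] at hc
  by_cases h1 : χ ≠ 1 ∨ ρ ≠ 1
  · exact χ.LFunction_ne_zero_of_one_le_re h1 hc h
  · simp only [not_or, not_not] at h1
    obtain ⟨rfl, rfl⟩ := h1
    exact triv_one_ne hq h

lemma triv_near : ∃ η : ℝ, 0 < η ∧ ∀ (q : ℕ) [NeZero q], ∀ δ : ℝ, 0 < δ → δ < η → δ < 1 →
    (1:DirichletCharacter ℂ q).LFunction ((1-δ:ℝ):ℂ) ≠ 0 := by
  obtain ⟨η, hη, h⟩ := Metric.eventually_nhds_iff.mp riemannZeta_eventually_ne_zero_nhds_one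
  refine ⟨η, hη, fun q _ δ hδ hδη hδ1 => ?_⟩
  have hs : ((1-δ:ℝ):ℂ) ≠ 1 := by
    intro h
    have : (1-δ:ℝ) = 1 := by exact_mod_cast h
    linarith
  have e := DirichletCharacter.LFunctionTrivChar_eq_mul_riemannZeta (N := q) hs
  rw [DirichletCharacter.LFunctionTrivChar] at e
  rw [e]
  refine mul_ne_zero ?_ (h ?_)
  · intro h0
    have := PP_pos q (x := 1-δ) (by linarith)
    unfold PP at this
    rw [h0] at this; simp at this
  · rw [dist_eq_norm]
    have : ((1-δ:ℝ):ℂ) - 1 = ((-δ:ℝ):ℂ) := by push_cast; ring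
    rw [this, norm_real, norm_neg, Real.norm_of_nonneg hδ.le]; exact hδη

lemma ld_bound {q : ℕ} [NeZero q] (hq : 20000000 ≤ q) {χ : DirichletCharacter ℂ q} (h1 : χ ≠ 1) {σ : ℝ}
    (hσ : σ = 1 + 1/(2000*Real.log q)) :
    (VV χ 0 (σ + (0:ℝ)*I)).re ≤ 144*Real.log q ∧
    ∀ β : ℝ, χ.LFunction β = 0 → β < σ → σ - β ≤ 1/6 → (VV χ 0 (σ + (0:ℝ)*I)).re ≤ 144*Real.log q - 1/(σ-β) := by
  have hq' : (20000000:ℝ) ≤ q := by exact_mod_cast hq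
  have hl1 : 1 ≤ Real.log q := by
    rw [Real.le_log_iff_exp_le (by linarith)]
    have := Real.exp_one_lt_d9; linarith
  have hlq : Real.log q ≤ q := (Real.log_le_sub_one_of_pos (by linarith)).trans (by linarith)
  have hr : 1/(2000*Real.log q) ≤ 1/2000 := by
    apply one_div_le_one_div_of_le (by norm_num); linarith
  have hr0 : 0 < 1/(2000*Real.log q) := by positivity
  have ec : ((σ:ℂ) + (0:ℝ)*I) = (σ:ℂ) := by simp
  rw [ec]
  have eV : (VV χ 0 (σ:ℂ)).re = -(logDeriv χ.LFunction σ).re := by simp [VV]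
  have hne : ∀ z, χ.LFunction z = 0 → z.re < (σ:ℂ).re := by
    intro z hz
    rw [ofReal_re]
    have := zero_re_lt (by omega) hz
    linarith
  have h0 : χ.LFunction σ ≠ 0 := fun h => lt_irrefl _ (hne _ h)
  have low := L_lower χ (s := (σ:ℂ)) (by rw [ofReal_re]; linarith) (by rw [ofReal_re]; linarith)
  rw [ofReal_re, hσ, add_sub_cancel_left, ← hσ] at low
  have hb : ∀ s ∈ closedBall (σ:ℂ) (1/2), ‖χ.LFunction s‖ ≤ Real.exp (3*Real.log q) * ‖χ.LFunction σ‖ := by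
    intro s hs
    rw [mem_closedBall, dist_eq_norm] at hs
    have hre := abs_le.mp ((abs_re_le_norm _).trans hs)
    rw [sub_re, ofReal_re] at hre
    have hn : ‖s‖ ≤ 2 := by
      have : ‖s‖ ≤ ‖s-σ‖ + ‖(σ:ℂ)‖ := by simpa using norm_add_le (s-σ) (σ:ℂ)
      rw [norm_real, Real.norm_of_nonneg (by linarith)] at this
      linarith
    have b := L_bound h1 (s := s) (by linarith) (by linarith)
    have e : Real.exp (3*Real.log q) = (q:ℝ)^3 := by
      rw [show 3*Real.log q = ((3:ℕ):ℝ)*Real.log q by norm_num, Real.exp_nat_mul, Real.exp_log (by linarith)]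
    rw [e]
    have b2 : ‖χ.LFunction s‖ ≤ q*513 := b.trans (by gcongr; linarith)
    refine b2.trans ?_
    have l2 : (q:ℝ)^3 * (1/(2000*Real.log q)/16) ≤ (q:ℝ)^3 * ‖χ.LFunction σ‖ := by gcongr
    refine le_trans ?_ l2
    rw [div_div, mul_one_div, le_div_iff₀ (by positivity)]
    have : (513*32000)*Real.log q ≤ (q:ℝ)*q := by
      have := mul_le_mul hq' hlq (by linarith) (by linarith)
      nlinarith
    nlinarith [mul_le_mul_of_nonneg_left this (by linarith : (0:ℝ) ≤ q)]
  obtain ⟨u1, u2⟩ := logder_upper (by norm_num : (0:ℝ) < 1/2) (DirichletCharacter.differentiable_LFunction h1) h0 hb hne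
  have e24 : 24*(3*Real.log q)/(1/2) = 144*Real.log q := by ring
  rw [e24] at u1 u2
  rw [eV]
  refine ⟨u1, fun β hβ hβσ hd => ?_⟩
  have := u2 β hβ (by
    rw [mem_closedBall, dist_eq_norm, ← ofReal_sub, norm_real, Real.norm_eq_abs, abs_sub_comm, abs_of_nonneg (by linarith)]
    linarith)
  rw [← ofReal_sub, ← ofReal_one, ← ofReal_div, ofReal_re] at this
  exact this

lemma complex_excl : ∃ q₁ : ℕ, ∀ (q : ℕ) [NeZero q], q₁ ≤ q → ∀ χ : DirichletCharacter ℂ q, χ ≠ 1 → ∀ lam : ℝ, 0 < lam → lam ≤ 1/20000 →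
    χ.LFunction ((1 - lam/Real.log q : ℝ):ℂ) = 0 → χ^2 = 1 := by
  obtain ⟨C0, hC0, hz⟩ := zeta_const
  refine ⟨max 20000000 (⌈Real.exp C0⌉₊), fun q _ hq χ h1 lam hlam hlam1 hzero => ?_⟩
  by_contra h2
  have hq1 : 20000000 ≤ q := (le_max_left _ _).trans hq
  have hq' : (20000000:ℝ) ≤ q := by exact_mod_cast hq1
  have hqC : Real.exp C0 ≤ q := (Nat.le_ceil _).trans (by exact_mod_cast (le_max_right _ _).trans hq)
  have hl : C0 ≤ Real.log q := by rwa [Real.le_log_iff_exp_le (by linarith)]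
  have hl1 : 1 ≤ Real.log q := by
    rw [Real.le_log_iff_exp_le (by linarith)]
    have := Real.exp_one_lt_d9; linarith
  set l := Real.log q with hldef
  have hr0 : 0 < 1/(2000*l) := by positivity
  have hr : 1/(2000*l) ≤ 1/2000 := by
    apply one_div_le_one_div_of_le (by norm_num); linarith
  obtain ⟨σ, hσ⟩ : ∃ σ : ℝ, σ = 1 + 1/(2000*l) := ⟨_, rfl⟩
  have v := VV341 χ (σ := σ) 0 (by linarith)
  rw [show (2*0:ℝ) = 0 by norm_num] at v
  have v1 := (VV_one_le (q := q) (σ := σ) (by linarith)).trans (hz σ (by linarith) (by linarith))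
  have v3 := (ld_bound hq1 h2 hσ).1
  have hd0 : 0 < lam/l := by positivity
  have hd1 : lam/l ≤ 1/20000 := by
    rw [div_le_iff₀ (by linarith)]; nlinarith
  have v2 := (ld_bound hq1 h1 hσ).2 _ hzero (by linarith) (by linarith)
  have e1 : 1/(σ-1) = 2000*l := by rw [hσ, add_sub_cancel_left, one_div_one_div]
  have e2 : 7270*l ≤ 4*(1/(σ - (1-lam/l))) := by
    have : σ - (1-lam/l) = (1/2000+lam)/l := by rw [hσ]; field_simp; ring
    rw [this, one_div_div, mul_div_assoc', le_div_iff₀ (by linarith)]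
    nlinarith
  rw [e1] at v1
  rw [← hldef] at v2 v3
  linarith
end

/-- **Deuring–Heilbronn phenomenon**: there are `c₁, c₂ > 0` and `q₀` such that for every
`q ≥ q₀`, if `ρ₁ = 1 - λ₁/log q` is a real zero of `∏_{χ mod q} L(s,χ)` with `0 < λ₁ ≤ c₁`,
then every other zero `s = σ + it` of the product satisfies
`σ < 1 - c₂ log(λ₁⁻¹)/log(q(2+|t|))`. -/
theorem deuring_heilbronn :
    ∃ c₁ : ℝ, 0 < c₁ ∧ ∃ c₂ : ℝ, 0 < c₂ ∧ ∃ q₀ : ℕ, ∀ (q : ℕ) [NeZero q], q₀ ≤ q →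
      ∀ lam₁ : ℝ, 0 < lam₁ → lam₁ ≤ c₁ →
        LProd q (((1 : ℝ) - lam₁ / Real.log q : ℝ) : ℂ) = 0 →
        ∀ ρ : ℂ, LProd q ρ = 0 → ρ ≠ (((1 : ℝ) - lam₁ / Real.log q : ℝ) : ℂ) →
          ρ.re < 1 - c₂ * Real.log lam₁⁻¹ / Real.log (q * (2 + |ρ.im|)) := by
  obtain ⟨K0, hK0, c, hc, hB⟩ := partB
  obtain ⟨η, hη, hnear⟩ := triv_near
  obtain ⟨q₁, hcx⟩ := complex_excl
  obtain ⟨X, hX⟩ : ∃ X : ℝ, X = 40000 + 2*|Real.log K0| + |Real.log η| := ⟨_, rfl⟩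
  have ha1 := abs_nonneg (Real.log K0)
  have ha2 := abs_nonneg (Real.log η)
  refine ⟨Real.exp (-X), Real.exp_pos _, min (1/2000000) (c/2), by positivity, max q₁ 1000, ?_⟩
  intro q _ hq lam hlam hlam1 hz ρ hρ hρne
  have hq1 : q₁ ≤ q := (le_max_left _ _).trans hq
  have hq2 : 1000 ≤ q := (le_max_right _ _).trans hq
  have hq' : (1000:ℝ) ≤ q := by exact_mod_cast hq2
  have hl1 : 1 ≤ Real.log q := by
    rw [Real.le_log_iff_exp_le (by linarith)]
    have := Real.exp_one_lt_d9; linarith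
  have hΛX : X ≤ Real.log lam⁻¹ := by
    rw [Real.log_inv]
    have := Real.log_le_log hlam hlam1
    rw [Real.log_exp] at this; linarith
  have hlam2 : lam ≤ 1/20000 := by
    refine hlam1.trans ?_
    rw [Real.exp_neg, ← one_div]
    apply one_div_le_one_div_of_le (by norm_num)
    have := Real.add_one_le_exp X; linarith
  have hlamη : lam < η := by
    refine lt_of_le_of_lt hlam1 ?_
    rw [← Real.exp_log hη]
    apply Real.exp_lt_exp.mpr
    have := neg_abs_le (Real.log η); linarith
  obtain ⟨δ, hδ⟩ : ∃ δ : ℝ, δ = lam/Real.log q := ⟨_, rfl⟩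
  have hδ0 : 0 < δ := by rw [hδ]; positivity
  have hδlam : δ ≤ lam := by rw [hδ]; exact div_le_self hlam.le hl1
  unfold LProd at hz hρ
  obtain ⟨χ₁, -, hz1⟩ := Finset.prod_eq_zero_iff.mp hz
  obtain ⟨χ, -, hρ1⟩ := Finset.prod_eq_zero_iff.mp hρ
  have h1 : χ₁ ≠ 1 := by
    rintro rfl
    rw [← hδ] at hz1
    exact hnear q δ hδ0 (by linarith) (by linarith) hz1
  have h2 := hcx q hq1 χ₁ h1 lam hlam hlam2 hz1
  have hre := zero_re_lt (by omega) hρ1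
  rw [← hδ] at hz1 hρne
  set x := Real.log (q*(2+|ρ.im|)) with hx
  set Λ := Real.log lam⁻¹ with hΛ
  have hlx : Real.log q ≤ x := by
    refine Real.log_le_log (by linarith) ?_
    nlinarith [abs_nonneg ρ.im]
  have hx1 : 1 ≤ x := hl1.trans hlx
  have hx0 : 0 < x := by linarith
  have hΛ0 : 0 < Λ := by linarith
  have m1 := min_le_left (1/2000000:ℝ) (c/2)
  have m2 := min_le_right (1/2000000:ℝ) (c/2)
  set c2 := min (1/2000000:ℝ) (c/2) with hc2
  suffices hgoal : c2*Λ/x < 1 - ρ.re by linarith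
  by_cases hε : 1 - ρ.re ≤ 1/16
  · by_cases hK : Real.log (x/Real.log q) ≤ Λ/2
    · have A := partA (by omega) h1 h2 rfl hδ0 (by linarith) hz1 χ hρ1 hρne hre hε
      rw [← hx] at A
      have lA := Real.log_nonneg A
      have e : 12800000*δ*x = 12800000*(lam*(x/Real.log q)) := by rw [hδ]; field_simp
      have hKp : 0 < x/Real.log q := by positivity
      rw [e, Real.log_mul (by positivity) (Real.exp_pos _).ne', Real.log_exp, Real.log_mul (by norm_num) (by positivity),
        Real.log_mul hlam.ne' hKp.ne'] at lA
      have el : Real.log lam = -Λ := by rw [hΛ, Real.log_inv, neg_neg]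
      have l4 : Real.log 12800000 ≤ 8000 := by
        have a : Real.log 12800000 ≤ Real.log (4000^2) := Real.log_le_log (by norm_num) (by norm_num)
        rw [Real.log_pow] at a
        have b := Real.log_le_sub_one_of_pos (by norm_num : (0:ℝ) < 4000)
        push_cast at a; linarith
      rw [el] at lA
      rw [div_lt_iff₀ hx0]
      have : c2*Λ ≤ 1/2000000*Λ := by gcongr
      nlinarith
    · rw [not_le] at hK
      have hKp : 0 < x/Real.log q := by positivity
      have B := hB q (by omega) χ ρ hρ1 x _ hx rfl (by
        rw [← Real.log_le_log_iff hK0 hKp]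
        have := le_abs_self (Real.log K0); linarith)
      refine lt_of_le_of_lt ?_ B
      refine div_le_div_of_nonneg_right ?_ hx0.le
      calc c2*Λ ≤ c/2*Λ := by gcongr
        _ = c*(Λ/2) := by ring
        _ ≤ _ := by gcongr
  · rw [not_le] at hε
    have D := delta_lower h1 h2 rfl hδ0 (by linarith) hz1
    have D2 : 1 ≤ lam * (q:ℝ)^4 := by
      refine D.trans ?_
      have : (591000:ℝ) ≤ (q:ℝ)^2 := by nlinarith
      calc δ*(591000*(q:ℝ)^2) ≤ lam*((q:ℝ)^2*(q:ℝ)^2) := by gcongr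
        _ = _ := by ring
    have D3 : Λ ≤ 4*x := by
      have := Real.log_nonneg D2
      rw [Real.log_mul hlam.ne' (by positivity), Real.log_pow] at this
      rw [hΛ, Real.log_inv]; push_cast at this; linarith
    refine lt_trans ?_ hε
    rw [div_lt_iff₀ hx0]
    have : c2*Λ ≤ 1/2000000*(4*x) := by gcongr
    linarith
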